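/- For u ∈ ℕ let f ∈ C^u(ℝ²) and set f_j := f·φ_j, where φ ∈ C₀^∞([−π,π]²) and φ_j(x) := φ(2^{j/2}x). Let Ψ^{(i)} ∈ W₂^{2q} with q ≥ 2, i ∈ {h,v}, and let L := I + 2^j Δ, where Δ is the Laplacian. Then for even j ≥ 10 and |ℓ| ≤ 2^{j/2}: (a) ‖L^q[𝓕[f_j]·Ψ_{j,ℓ}^{(i)}]‖²_{L₂(ℝ²)} ≤ C₁(u, q) · 2^{−j(2u+1)}; and (b) for a standard edge fragment ℰ_j and a rotation R_γ by γ ∈ [0, 2π), ‖L^q[𝓕[ℰ_j(R_γᵀ ·)]·Ψ_{j,ℓ}^{(i)}]‖²_{L₂(ℝ²)} ≤ C₂(q) · 2^{−3j/2} · (1 + 2^{j/2}|sin(θ_{j,ℓ}^{(i)} − γ)|)^{−5}. -/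

import Mathlib

open Real MeasureTheory Set
open scoped Classical

noncomputable section

/-- A window function `g ∈ 𝒲`: nonnegative, even, with support `(-2/3, 2/3)`,
and whose integer translates form a partition of unity. -/
structure IsWindow (g : ℝ → ℝ) : Prop where
  nonneg : ∀ x, 0 ≤ g x
  even_fun : ∀ x, g (-x) = g x
  supp_eq : Function.support g = Ioo (-(2/3) : ℝ) (2/3)
  partition : ∀ x : ℝ, HasSum (fun z : ℤ => g (x + (z : ℝ))) 1

/-- `g ∈ 𝒲^q`: a window function that is `q`-times continuously differentiable. -/
def IsWindowQ (g : ℝ → ℝ) (q : ℕ) : Prop := IsWindow g ∧ ContDiff ℝ q g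

/-- `g̃(x) = g(x/2) - g(x)`. -/
def gtilde (g : ℝ → ℝ) : ℝ → ℝ := fun x => g (x / 2) - g x

/-- Horizontal bivariate window `Ψ^{(h)}(x) = g̃(x₁) g(x₂)`. -/
def PsiH (g : ℝ → ℝ) : ℝ × ℝ → ℝ := fun x => gtilde g x.1 * g x.2

/-- Vertical bivariate window `Ψ^{(v)}(x) = g(x₁) g̃(x₂)`. -/
def PsiV (g : ℝ → ℝ) : ℝ × ℝ → ℝ := fun x => g x.1 * gtilde g x.2

/-- `Ψ_{j,ℓ}^{(i)}(ξ) = Ψ^{(i)}((N_{j,ℓ}^{(i)})^{-T} ξ)`, where the inverse transpose of the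
shear matrices has been written out explicitly.  `i = true` is the horizontal case `(h)`,
`i = false` the vertical case `(v)`. -/
def PsiJL (g : ℝ → ℝ) (i : Bool) (j : ℕ) (ℓ : ℤ) : ℝ × ℝ → ℝ := fun ξ =>
  if i then
    PsiH g ((2:ℝ) ^ (-(j:ℝ)) * ξ.1,
            (2:ℝ) ^ (-(j:ℝ)/2) * ξ.2 - (ℓ:ℝ) * (2:ℝ) ^ (-(j:ℝ)) * ξ.1)
  else
    PsiV g ((2:ℝ) ^ (-(j:ℝ)/2) * ξ.1 - (ℓ:ℝ) * (2:ℝ) ^ (-(j:ℝ)) * ξ.2,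
            (2:ℝ) ^ (-(j:ℝ)) * ξ.2)

/-- Discrete angles `θ_{j,ℓ}^{(h)} = arctan(ℓ 2^{-j/2})`,
`θ_{j,ℓ}^{(v)} = arccot(ℓ 2^{-j/2}) = π/2 - arctan(ℓ 2^{-j/2})`. -/
def thetaJL (i : Bool) (j : ℕ) (ℓ : ℤ) : ℝ :=
  if i then arctan ((ℓ:ℝ) * (2:ℝ) ^ (-(j:ℝ)/2))
  else π/2 - arctan ((ℓ:ℝ) * (2:ℝ) ^ (-(j:ℝ)/2))

/-- The pattern `𝒫(N_{j,ℓ}^{(i)}) = (N_{j,ℓ}^{(i)})^{-1} ℤ² ∩ [-1/2,1/2)²`: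
`y` belongs to the pattern iff `N_{j,ℓ}^{(i)} y ∈ ℤ²` and `y ∈ [-1/2,1/2)²`. -/
def pattern (i : Bool) (j : ℕ) (ℓ : ℤ) : Set (ℝ × ℝ) :=
  {y : ℝ × ℝ |
    (∃ k : ℤ × ℤ,
      (if i then ((2:ℝ)^(j:ℝ) * y.1 + (ℓ:ℝ) * (2:ℝ)^((j:ℝ)/2) * y.2, (2:ℝ)^((j:ℝ)/2) * y.2)
       else ((2:ℝ)^((j:ℝ)/2) * y.1, (ℓ:ℝ) * (2:ℝ)^((j:ℝ)/2) * y.1 + (2:ℝ)^(j:ℝ) * y.2))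
        = ((k.1 : ℝ), (k.2 : ℝ)))
    ∧ y.1 ∈ Ico (-(1/2) : ℝ) (1/2) ∧ y.2 ∈ Ico (-(1/2) : ℝ) (1/2)}

/-- `ỹ = y - (2^{-j-1},0)ᵀ` in the horizontal case, `ỹ = y - (0,2^{-j-1})ᵀ` in the vertical one. -/
def ytilde (i : Bool) (j : ℕ) (y : ℝ × ℝ) : ℝ × ℝ :=
  if i then (y.1 - (2:ℝ) ^ (-(j:ℝ) - 1), y.2) else (y.1, y.2 - (2:ℝ) ^ (-(j:ℝ) - 1))

/-- The trigonometric polynomial shearlet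
`ψ_{j,ℓ,y}^{(i)}(x) = ∑_{k∈ℤ²} Ψ_{j,ℓ}^{(i)}(k) e^{i k·(x - 2πỹ)}`. -/
def shearlet (g : ℝ → ℝ) (i : Bool) (j : ℕ) (ℓ : ℤ) (y : ℝ × ℝ) : ℝ × ℝ → ℂ := fun x =>
  ∑' k : ℤ × ℤ, (PsiJL g i j ℓ ((k.1 : ℝ), (k.2 : ℝ)) : ℂ) *
    Complex.exp (Complex.I *
      (((k.1 : ℝ) * (x.1 - 2*π*(ytilde i j y).1)
        + (k.2 : ℝ) * (x.2 - 2*π*(ytilde i j y).2) : ℝ) : ℂ))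

/-- `⟨f,h⟩₂ = (2π)^{-2} ∫_{𝕋²} f(x) conj(h(x)) dx`, with the torus realised as `[-π,π]²`. -/
def inner2 (f h : ℝ × ℝ → ℂ) : ℂ :=
  ((2*π)^2 : ℂ)⁻¹ * ∫ x in (Icc (-π) π ×ˢ Icc (-π) π : Set (ℝ × ℝ)), f x * (starRingEnd ℂ) (h x)

/-- The `2π`-periodization `f^{2π} = ∑_{n∈ℤ²} f(· + 2πn)`. -/
def periodize (f : ℝ × ℝ → ℝ) : ℝ × ℝ → ℝ := fun x =>
  ∑' n : ℤ × ℤ, f (x.1 + 2*π*(n.1 : ℝ), x.2 + 2*π*(n.2 : ℝ))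

/-- Euclidean norm `|x|₂` on `ℝ²`. -/
def nrm2 (x : ℝ × ℝ) : ℝ := Real.sqrt (x.1^2 + x.2^2)

/-- First partial derivative of a complex-valued function of two real variables. -/
def pd1 (f : ℝ × ℝ → ℂ) : ℝ × ℝ → ℂ := fun x => deriv (fun t => f (t, x.2)) x.1

/-- Second partial derivative of a complex-valued function of two real variables. -/
def pd2 (f : ℝ × ℝ → ℂ) : ℝ × ℝ → ℂ := fun x => deriv (fun t => f (x.1, t)) x.2

/-- `∂^r = ∂^{r₁+r₂}/∂x₁^{r₁}∂x₂^{r₂}` (complex-valued). -/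
def pd (r : ℕ × ℕ) (f : ℝ × ℝ → ℂ) : ℝ × ℝ → ℂ := pd1^[r.1] (pd2^[r.2] f)

/-- First partial derivative of a real-valued function of two real variables. -/
def pdR1 (f : ℝ × ℝ → ℝ) : ℝ × ℝ → ℝ := fun x => deriv (fun t => f (t, x.2)) x.1

/-- Second partial derivative of a real-valued function of two real variables. -/
def pdR2 (f : ℝ × ℝ → ℝ) : ℝ × ℝ → ℝ := fun x => deriv (fun t => f (x.1, t)) x.2

/-- `∂^r = ∂^{r₁+r₂}/∂x₁^{r₁}∂x₂^{r₂}` (real-valued). -/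
def pdR (r : ℕ × ℕ) (f : ℝ × ℝ → ℝ) : ℝ × ℝ → ℝ := pdR1^[r.1] (pdR2^[r.2] f)

/-- The Fourier transform `𝓕f(x) = (2π)^{-2} ∫_{ℝ²} f(ξ) e^{-iξ·x} dξ`. -/
def FT (f : ℝ × ℝ → ℂ) : ℝ × ℝ → ℂ := fun x =>
  ((2*π)^2 : ℂ)⁻¹ * ∫ ξ : ℝ × ℝ, f ξ * Complex.exp (-(Complex.I) * ((ξ.1*x.1 + ξ.2*x.2 : ℝ) : ℂ))

/-- Rotation matrix `R_γ` acting on `ℝ²`. -/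
def rotM (γ : ℝ) (x : ℝ × ℝ) : ℝ × ℝ :=
  (Real.cos γ * x.1 - Real.sin γ * x.2, Real.sin γ * x.1 + Real.cos γ * x.2)

/-- Transposed rotation matrix `R_γᵀ` acting on `ℝ²`. -/
def rotT (γ : ℝ) (x : ℝ × ℝ) : ℝ × ℝ :=
  (Real.cos γ * x.1 + Real.sin γ * x.2, -(Real.sin γ) * x.1 + Real.cos γ * x.2)

/-- The standard edge fragment `ℰ_j(x) = f(x) φ(2^{j/2}x) χ_{{x₁ ≥ E(x₂)}}(x)`. -/
def edgeFragment (f φ : ℝ × ℝ → ℝ) (E : ℝ → ℝ) (j : ℕ) : ℝ × ℝ → ℝ := fun x =>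
  f x * φ ((2:ℝ)^((j:ℝ)/2) * x.1, (2:ℝ)^((j:ℝ)/2) * x.2) * (if E x.2 ≤ x.1 then 1 else 0)

/-- The second-order differential operator `L = I + 2^j Δ`. -/
def Lop (j : ℕ) (f : ℝ × ℝ → ℂ) : ℝ × ℝ → ℂ := fun x =>
  f x + (Complex.ofReal ((2:ℝ)^(j:ℝ))) * (pd (2,0) f x + pd (0,2) f x)

/-- The dyadic square `Q` indexed by `(n₁,n₂)` at scale `j`. -/
def dyadicSquare (j : ℕ) (n : ℕ × ℕ) : Set (ℝ × ℝ) :=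
  Ico (2*π*(n.1:ℝ)*(2:ℝ)^(-(j:ℝ)/2) - π) (2*π*((n.1:ℝ)+1)*(2:ℝ)^(-(j:ℝ)/2) - π) ×ˢ
  Ico (2*π*(n.2:ℝ)*(2:ℝ)^(-(j:ℝ)/2) - π) (2*π*((n.2:ℝ)+1)*(2:ℝ)^(-(j:ℝ)/2) - π)

/-- The indices of the dyadic squares at scale `j` meeting `∂T` (the set `𝒬_j^1`). -/
def Q1set (T : Set (ℝ × ℝ)) (j : ℕ) : Finset (ℕ × ℕ) :=
  (Finset.range (2^(j/2)) ×ˢ Finset.range (2^(j/2))).filter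
    (fun n => (frontier T ∩ dyadicSquare j n).Nonempty)

/-- Fresnel integral `Fc(x) = ∫₀ˣ cos v/√v dv`. -/
def Fc (x : ℝ) : ℝ := ∫ v in (0:ℝ)..x, Real.cos v / Real.sqrt v

/-- Fresnel integral `Fs(x) = ∫₀ˣ sin v/√v dv`. -/
def Fs (x : ℝ) : ℝ := ∫ v in (0:ℝ)..x, Real.sin v / Real.sqrt v

/-- `F⁺ = Fc + Fs`. -/
def Fp (x : ℝ) : ℝ := Fc x + Fs x

/-- `F⁻ = Fc - Fs`. -/
def Fm (x : ℝ) : ℝ := Fc x - Fs x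

/-- `a(λ,p,A)` of the paper. -/
def aInt (g : ℝ → ℝ) (l p A : ℝ) : ℝ :=
  ∫ v in Ioi (0:ℝ),
    (g (2*Real.sqrt (A*l*v) + p*l) + g (2*Real.sqrt (A*l*v) - p*l)) * (Real.cos v / Real.sqrt v)

/-- `b(λ,p,A)` of the paper. -/
def bInt (g : ℝ → ℝ) (l p A : ℝ) : ℝ :=
  ∫ v in Ioi (0:ℝ),
    (g (2*Real.sqrt (A*l*v) + p*l) + g (2*Real.sqrt (A*l*v) - p*l)) * (Real.sin v / Real.sqrt v)

/-- `P₁(D,p,A)` of the paper. -/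
def P1 (g : ℝ → ℝ) (D p A : ℝ) : ℝ :=
  ∫ l in (1/3 : ℝ)..(4/3),
    gtilde g l * l⁻¹ *
      ((aInt g l p A + bInt g l p A) * Real.cos (D*l)
        + (aInt g l p A - bInt g l p A) * Real.sin (D*l))

/-- `P₂(D,p,A)` of the paper. -/
def P2 (g : ℝ → ℝ) (D p A : ℝ) : ℝ :=
  ∫ l in (1/3 : ℝ)..(4/3),
    gtilde g l * l⁻¹ *
      ((aInt g l p A + bInt g l p A) * Real.sin (D*l)
        - (aInt g l p A - bInt g l p A) * Real.cos (D*l))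


/-- The oscillatory integral `∫ h(y) e^{-i l p(y)} dμ(y)`. -/
def osc {Y : Type*} [MeasurableSpace Y] (μ : Measure Y) (p : Y → ℝ) (h : Y → ℂ) (l : ℝ) : ℂ :=
  ∫ y, h y * Complex.exp (-(Complex.I) * ((l * p y : ℝ) : ℂ)) ∂μ

lemma norm_exp_neg_I_mul (x : ℝ) : ‖Complex.exp (-(Complex.I) * (x : ℂ))‖ = 1 := by
  have : -(Complex.I) * (x : ℂ) = ((-x : ℝ) : ℂ) * Complex.I := by push_cast; ring
  rw [this, Complex.norm_exp_ofReal_mul_I]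

lemma osc_integrand_integrable {Y : Type*} [MeasurableSpace Y] {μ : Measure Y} {p : Y → ℝ}
    {h : Y → ℂ} (hp : Measurable p) (hh : Integrable h μ) (l : ℝ) :
    Integrable (fun y => h y * Complex.exp (-(Complex.I) * ((l * p y : ℝ) : ℂ))) μ := by
  refine hh.mul_bdd (c := 1) (Measurable.aestronglyMeasurable (by fun_prop)) ?_
  filter_upwards with y
  rw [norm_exp_neg_I_mul]

lemma osc_continuous {Y : Type*} [MeasurableSpace Y] {μ : Measure Y} {p : Y → ℝ}
    {h : Y → ℂ} (hp : Measurable p) (hh : Integrable h μ) : Continuous (osc μ p h) := by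
  unfold osc
  refine continuous_of_dominated (bound := fun y => ‖h y‖) ?_ ?_ hh.norm ?_
  · intro l
    exact (osc_integrand_integrable hp hh l).aestronglyMeasurable
  · intro l
    filter_upwards with y
    rw [norm_mul, norm_exp_neg_I_mul, mul_one]
  · filter_upwards with y
    fun_prop

lemma integral_gaussian_mul_exp {ε : ℝ} (hε : 0 < ε) (d : ℝ) :
    ∫ l : ℝ, ((Real.exp (-ε * l ^ 2) : ℝ) : ℂ) * Complex.exp (-(Complex.I) * ((l * d : ℝ) : ℂ))
      = ((√(π / ε) * Real.exp (-d ^ 2 / (4 * ε)) : ℝ) : ℂ) := by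
  have h := fourierIntegral_gaussian (b := (ε : ℂ)) (by simpa using hε) (-(d : ℂ))
  have h2 : ((π : ℂ) / (ε : ℂ)) ^ (1 / 2 : ℂ) = ((√(π / ε) : ℝ) : ℂ) := by
    rw [Real.sqrt_eq_rpow, Complex.ofReal_cpow (by positivity)]
    push_cast
    rfl
  rw [h2] at h
  convert h using 1
  · congr 1
    ext l
    rw [mul_comm]
    congr 2
    · push_cast; ring
    · push_cast; ring_nf
  · push_cast
    ring_nf

/-- A Plancherel-type bound with a Gaussian weight for oscillatory integrals. -/
lemma osc_gauss_bound {Y : Type*} [MeasurableSpace Y] {μ : Measure Y} [IsFiniteMeasure μ]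
    {p : Y → ℝ} {h : Y → ℂ} (hp : Measurable p) (hh : AEStronglyMeasurable h μ) {M A ε : ℝ}
    (hε : 0 < ε) (hM : ∀ y, ‖h y‖ ≤ M)
    (hA : ∀ᵐ y ∂μ, ∫ y', √(π / ε) * Real.exp (-(p y - p y') ^ 2 / (4 * ε)) ∂μ ≤ A) :
    ∫ l : ℝ, Real.exp (-ε * l ^ 2) * ‖osc μ p h l‖ ^ 2 ≤ M ^ 2 * (A * μ.real univ) := by
  set K : Y × Y → ℝ := fun z => √(π / ε) * Real.exp (-(p z.1 - p z.2) ^ 2 / (4 * ε)) with hK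
  have h_integrable : Integrable h μ := Integrable.of_bound hh M (by filter_upwards with y using hM y)
  have hKm : Measurable K := by fun_prop
  have hKint : Integrable K (μ.prod μ) := by
    refine Integrable.of_bound hKm.aestronglyMeasurable (√(π / ε)) ?_
    filter_upwards with z
    have h1 : Real.exp (-(p z.1 - p z.2) ^ 2 / (4 * ε)) ≤ 1 := by
      rw [Real.exp_le_one_iff]
      apply div_nonpos_of_nonpos_of_nonneg <;> nlinarith [sq_nonneg (p z.1 - p z.2)]
    rw [Real.norm_of_nonneg (by positivity)]
    nlinarith [Real.sqrt_nonneg (π / ε)]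
  set G : ℝ → Y × Y → ℂ := fun l z => ((Real.exp (-ε * l ^ 2) : ℝ) : ℂ) *
    Complex.exp (-(Complex.I) * ((l * (p z.1 - p z.2) : ℝ) : ℂ)) *
    (h z.1 * (starRingEnd ℂ) (h z.2)) with hG
  have hhh : AEStronglyMeasurable (fun z : Y × Y => h z.1 * (starRingEnd ℂ) (h z.2)) (μ.prod μ) :=
    hh.comp_fst.mul (Complex.continuous_conj.comp_aestronglyMeasurable hh.comp_snd)
  have hGn : ∀ l z, ‖G l z‖ ≤ Real.exp (-ε * l ^ 2) * M ^ 2 := by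
    intro l z
    have := norm_nonneg (h z.1)
    simp only [hG, norm_mul, norm_exp_neg_I_mul, RCLike.norm_conj, Complex.norm_real,
      Real.norm_of_nonneg (Real.exp_pos _).le, mul_one]
    gcongr
    rw [sq]
    exact mul_le_mul (hM _) (hM _) (norm_nonneg _) (this.trans (hM _))
  have hGint : Integrable (Function.uncurry G) ((volume : Measure ℝ).prod (μ.prod μ)) := by
    have hb : Integrable (fun w : ℝ × Y × Y => Real.exp (-ε * w.1 ^ 2) * M ^ 2)
        ((volume : Measure ℝ).prod (μ.prod μ)) :=
      (integrable_exp_neg_mul_sq hε).mul_prod (integrable_const (M ^ 2))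
    refine hb.mono' ?_ ?_
    · refine AEStronglyMeasurable.mul (Measurable.aestronglyMeasurable ?_) hhh.comp_snd
      fun_prop
    · filter_upwards with w
      exact hGn _ _
  have hsq : ∀ l, ((Real.exp (-ε * l ^ 2) * ‖osc μ p h l‖ ^ 2 : ℝ) : ℂ)
      = ∫ z, G l z ∂(μ.prod μ) := by
    intro l
    have h1 : ((‖osc μ p h l‖ ^ 2 : ℝ) : ℂ) = osc μ p h l * (starRingEnd ℂ) (osc μ p h l) := by
      rw [Complex.mul_conj, Complex.normSq_eq_norm_sq]
    rw [Complex.ofReal_mul, h1]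
    have h2 : (starRingEnd ℂ) (osc μ p h l)
        = ∫ y, (starRingEnd ℂ) (h y * Complex.exp (-(Complex.I) * ((l * p y : ℝ) : ℂ))) ∂μ :=
      integral_conj.symm
    rw [h2, osc, ← integral_prod_mul, ← integral_const_mul]
    congr 1
    ext z
    simp only [hG, map_mul, ← Complex.exp_conj, map_neg, Complex.conj_I, Complex.conj_ofReal]
    have h3 : Complex.exp (-(Complex.I) * ((l * (p z.1 - p z.2) : ℝ) : ℂ))
        = Complex.exp (-(Complex.I) * ((l * p z.1 : ℝ) : ℂ)) *
          Complex.exp (- -(Complex.I) * ((l * p z.2 : ℝ) : ℂ)) := by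
      rw [← Complex.exp_add]
      congr 1
      push_cast
      ring
    rw [h3]
    ring
  have hkey : ((∫ l : ℝ, Real.exp (-ε * l ^ 2) * ‖osc μ p h l‖ ^ 2 : ℝ) : ℂ)
      = ∫ z, ((K z : ℝ) : ℂ) * (h z.1 * (starRingEnd ℂ) (h z.2)) ∂(μ.prod μ) := by
    rw [← integral_complex_ofReal]
    simp_rw [hsq]
    rw [integral_integral_swap hGint]
    congr 1
    ext z
    simp only [hG]
    rw [integral_mul_const, integral_gaussian_mul_exp hε]
  have hM0 : 0 ≤ M ^ 2 := sq_nonneg M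
  calc ∫ l : ℝ, Real.exp (-ε * l ^ 2) * ‖osc μ p h l‖ ^ 2
      ≤ ‖((∫ l : ℝ, Real.exp (-ε * l ^ 2) * ‖osc μ p h l‖ ^ 2 : ℝ) : ℂ)‖ := by
        rw [Complex.norm_real]; exact Real.le_norm_self _
    _ ≤ ∫ z, K z * M ^ 2 ∂(μ.prod μ) := by
        rw [hkey]
        refine norm_integral_le_of_norm_le (hKint.mul_const _) ?_
        filter_upwards with z
        have hK0 : 0 ≤ K z := by positivity
        rw [norm_mul, Complex.norm_real, Real.norm_of_nonneg hK0, norm_mul, RCLike.norm_conj]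
        gcongr
        rw [sq]
        exact mul_le_mul (hM _) (hM _) (norm_nonneg _) ((norm_nonneg _).trans (hM z.1))
    _ = M ^ 2 * ∫ y, ∫ y', K (y, y') ∂μ ∂μ := by
        rw [integral_mul_const, integral_prod _ hKint, mul_comm]
    _ ≤ M ^ 2 * (A * μ.real univ) := by
        gcongr
        calc ∫ y, ∫ y', K (y, y') ∂μ ∂μ ≤ ∫ _y, A ∂μ :=
              integral_mono_ae hKint.integral_prod_left (integrable_const A) hA
          _ = A * μ.real univ := by rw [integral_const, smul_eq_mul, mul_comm]

/-- The dyadic frequency window `{R/3 ≤ |l| ≤ 4R/3}`. -/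
def freqWin (R : ℝ) : Set ℝ := {l | R / 3 ≤ |l| ∧ |l| ≤ 4 * R / 3}

lemma isCompact_freqWin (R : ℝ) : IsCompact (freqWin R) := by
  refine Metric.isCompact_of_isClosed_isBounded ?_ ?_
  · exact (isClosed_le continuous_const continuous_abs).inter
      (isClosed_le continuous_abs continuous_const)
  · refine (Metric.isBounded_Icc (-(4 * R / 3)) (4 * R / 3)).subset ?_
    rintro l ⟨_, h⟩
    exact abs_le.mp h

lemma measurableSet_freqWin (R : ℝ) : MeasurableSet (freqWin R) :=
  (isCompact_freqWin R).measurableSet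

/-- The energy of `F` on the frequency window at scale `R`. -/
def energy (R : ℝ) (F : ℝ → ℂ) : ℝ := ∫ l in freqWin R, ‖F l‖ ^ 2

lemma energy_integrable (R : ℝ) {F : ℝ → ℂ} (hF : Continuous F) :
    IntegrableOn (fun l => ‖F l‖ ^ 2) (freqWin R) :=
  (by fun_prop : Continuous fun l => ‖F l‖ ^ 2).continuousOn.integrableOn_compact
    (isCompact_freqWin R)

lemma energy_nonneg (R : ℝ) (F : ℝ → ℂ) : 0 ≤ energy R F :=
  setIntegral_nonneg (measurableSet_freqWin R) fun _ _ => by positivity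

/-- Division by the frequency gains a factor `R⁻²` in the energy. -/
lemma energy_le_of_mul_le {R c : ℝ} (hR : 0 < R) {F G₁ G₂ : ℝ → ℂ} (hF : Continuous F)
    (hG₁ : Continuous G₁) (hG₂ : Continuous G₂)
    (h : ∀ l, |l| * ‖F l‖ ≤ c * (‖G₁ l‖ + ‖G₂ l‖)) :
    energy R F ≤ 18 * c ^ 2 / R ^ 2 * (energy R G₁ + energy R G₂) := by
  unfold energy
  rw [← integral_add (energy_integrable R hG₁) (energy_integrable R hG₂), ← integral_const_mul]
  refine setIntegral_mono_on (energy_integrable R hF)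
    (((energy_integrable R hG₁).add (energy_integrable R hG₂)).const_mul _)
    (measurableSet_freqWin R) ?_
  rintro l ⟨hl, -⟩
  have h1 : R * ‖F l‖ ≤ 3 * (c * (‖G₁ l‖ + ‖G₂ l‖)) := by
    have := h l
    have := mul_le_mul_of_nonneg_right hl (norm_nonneg (F l))
    linarith
  have h2 : (R * ‖F l‖) ^ 2 ≤ (3 * (c * (‖G₁ l‖ + ‖G₂ l‖))) ^ 2 :=
    pow_le_pow_left₀ (by positivity) h1 2
  rw [div_mul_eq_mul_div, le_div_iff₀ (by positivity)]
  nlinarith [mul_nonneg (sq_nonneg c) (sq_nonneg (‖G₁ l‖ - ‖G₂ l‖))]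

lemma energy_le_of_le {R c : ℝ} {F G₁ G₂ : ℝ → ℂ} (hF : Continuous F)
    (hG₁ : Continuous G₁) (hG₂ : Continuous G₂)
    (h : ∀ l, ‖F l‖ ≤ c * (‖G₁ l‖ + ‖G₂ l‖)) :
    energy R F ≤ 2 * c ^ 2 * (energy R G₁ + energy R G₂) := by
  unfold energy
  rw [← integral_add (energy_integrable R hG₁) (energy_integrable R hG₂), ← integral_const_mul]
  refine setIntegral_mono_on (energy_integrable R hF)
    (((energy_integrable R hG₁).add (energy_integrable R hG₂)).const_mul _)
    (measurableSet_freqWin R) ?_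
  rintro l -
  have h2 : (‖F l‖) ^ 2 ≤ (c * (‖G₁ l‖ + ‖G₂ l‖)) ^ 2 :=
    pow_le_pow_left₀ (by positivity) (h l) 2
  nlinarith [mul_nonneg (sq_nonneg c) (sq_nonneg (‖G₁ l‖ - ‖G₂ l‖))]

lemma energy_osc_le {Y : Type*} [MeasurableSpace Y] {μ : Measure Y} [IsFiniteMeasure μ]
    {p : Y → ℝ} {h : Y → ℂ} (hp : Measurable p) (hh : AEStronglyMeasurable h μ) {M A R : ℝ}
    (hR : 0 < R) (hM : ∀ y, ‖h y‖ ≤ M)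
    (hA : ∀ᵐ y ∂μ, ∫ y', √(π * R ^ 2) * Real.exp (-(p y - p y') ^ 2 * (R ^ 2 / 4)) ∂μ ≤ A) :
    energy R (osc μ p h) ≤ Real.exp 2 * (M ^ 2 * (A * μ.real univ)) := by
  have h_integrable : Integrable h μ := Integrable.of_bound hh M (by filter_upwards with y using hM y)
  have hc := osc_continuous hp h_integrable
  have hε : 0 < (R ^ 2)⁻¹ := by positivity
  have hb := osc_gauss_bound (A := A) hp hh hε hM (by
    filter_upwards [hA] with y hy
    convert hy using 5
    · rw [div_inv_eq_mul]
    · field_simp)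
  have hbd : ∀ l, ‖osc μ p h l‖ ≤ M * μ.real univ := by
    intro l
    refine (norm_integral_le_of_norm_le_const (C := M) ?_)
    filter_upwards with y
    rw [norm_mul, norm_exp_neg_I_mul, mul_one]
    exact hM y
  have hi : Integrable (fun l : ℝ => Real.exp (-(R ^ 2)⁻¹ * l ^ 2) * ‖osc μ p h l‖ ^ 2) := by
    refine (integrable_exp_neg_mul_sq hε).mul_bdd (c := (M * μ.real univ) ^ 2)
      (by fun_prop) ?_
    filter_upwards with l
    rw [Real.norm_of_nonneg (by positivity)]
    exact pow_le_pow_left₀ (norm_nonneg _) (hbd l) 2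
  refine le_trans ?_ (mul_le_mul_of_nonneg_left hb (Real.exp_pos 2).le)
  rw [← integral_const_mul]
  refine le_trans ?_ (setIntegral_le_integral (s := freqWin R) (hi.const_mul _) ?_)
  · refine setIntegral_mono_on (energy_integrable R hc) (hi.const_mul _).integrableOn
      (measurableSet_freqWin R) ?_
    rintro l ⟨-, hl⟩
    rw [← mul_assoc, ← Real.exp_add]
    refine le_mul_of_one_le_left (by positivity) (Real.one_le_exp ?_)
    have h1 : l ^ 2 ≤ 2 * R ^ 2 := by
      rw [← sq_abs]
      nlinarith [abs_nonneg l]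
    have h2 : (R ^ 2)⁻¹ * l ^ 2 ≤ 2 := by
      rw [inv_mul_le_iff₀ (by positivity)]
      linarith
    linarith
  · filter_upwards with l
    positivity

/-- The square `[-π,π]²`. -/
def sqr : Set (ℝ × ℝ) := Icc (-π) π ×ˢ Icc (-π) π

/-- The linear phase `y ↦ v·y`. -/
def lin (v y : ℝ × ℝ) : ℝ := y.1 * v.1 + y.2 * v.2

lemma measurable_lin (v : ℝ × ℝ) : Measurable (lin v) := by
  unfold lin; fun_prop

lemma isCompact_sqr : IsCompact sqr := isCompact_Icc.prod isCompact_Icc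

lemma measurableSet_sqr : MeasurableSet sqr := isCompact_sqr.measurableSet

instance : IsFiniteMeasure ((volume : Measure (ℝ × ℝ)).restrict sqr) :=
  ⟨by rw [Measure.restrict_apply_univ]; exact isCompact_sqr.measure_lt_top⟩

lemma restrict_sqr : (volume : Measure (ℝ × ℝ)).restrict sqr
    = ((volume : Measure ℝ).restrict (Icc (-π) π)).prod
      ((volume : Measure ℝ).restrict (Icc (-π) π)) := by
  rw [Measure.prod_restrict]; rfl

lemma real_restrict_Icc : ((volume : Measure ℝ).restrict (Icc (-π) π)).real univ = 2 * π := by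
  rw [measureReal_restrict_apply_univ, Real.volume_real_Icc_of_le (by linarith [pi_pos])]
  ring

lemma real_restrict_sqr : ((volume : Measure (ℝ × ℝ)).restrict sqr).real univ = (2 * π) ^ 2 := by
  rw [restrict_sqr, ← univ_prod_univ, measureReal_prod_prod, real_restrict_Icc]
  ring

lemma setIntegral_gaussian_le {S : Set ℝ} (hS : MeasurableSet S) {q : ℝ → ℝ} {c R t₀ : ℝ}
    (hc : 0 < c) (hR : 0 < R) (hq : ∀ t ∈ S, c * |t - t₀| ≤ |q t|) :
    ∫ t in S, √(π * R ^ 2) * Real.exp (-(q t) ^ 2 * (R ^ 2 / 4)) ≤ 2 * π / c := by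
  have hb : 0 < c ^ 2 * R ^ 2 / 4 := by positivity
  have hg : Integrable (fun t : ℝ => √(π * R ^ 2) *
      Real.exp (-(c ^ 2 * R ^ 2 / 4) * (t - t₀) ^ 2)) :=
    ((integrable_exp_neg_mul_sq hb).comp_sub_right t₀).const_mul _
  have hval : ∫ t : ℝ, √(π * R ^ 2) * Real.exp (-(c ^ 2 * R ^ 2 / 4) * (t - t₀) ^ 2)
      = 2 * π / c := by
    rw [integral_const_mul, integral_sub_right_eq_self
      (fun t => Real.exp (-(c ^ 2 * R ^ 2 / 4) * t ^ 2)) t₀, integral_gaussian,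
      ← Real.sqrt_mul (by positivity)]
    rw [show π * R ^ 2 * (π / (c ^ 2 * R ^ 2 / 4)) = (2 * π / c) ^ 2 by field_simp; ring]
    exact Real.sqrt_sq (by positivity)
  rw [← hval]
  refine le_trans ?_ (setIntegral_le_integral (s := S) hg (by filter_upwards with t; positivity))
  refine integral_mono_of_nonneg (by filter_upwards with t; positivity) hg.integrableOn ?_
  refine (ae_restrict_iff' hS).mpr (Filter.Eventually.of_forall fun t ht => ?_)
  have h1 : (c * |t - t₀|) ^ 2 ≤ |q t| ^ 2 := pow_le_pow_left₀ (by positivity) (hq t ht) 2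
  rw [mul_pow, sq_abs, sq_abs] at h1
  refine mul_le_mul_of_nonneg_left (Real.exp_le_exp.mpr ?_) (Real.sqrt_nonneg _)
  nlinarith [mul_le_mul_of_nonneg_right h1 (by positivity : 0 ≤ R ^ 2 / 4)]

lemma energy_osc_interval_le {p : ℝ → ℝ} {h : ℝ → ℂ} (hp : Measurable p)
    (hh : AEStronglyMeasurable h (volume.restrict (Icc (-π) π))) {M c R : ℝ}
    (hR : 0 < R) (hc : 0 < c) (hM0 : 0 ≤ M) (hM : ∀ t ∈ Icc (-π) π, ‖h t‖ ≤ M)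
    (hpc : ∀ t ∈ Icc (-π) π, ∀ t' ∈ Icc (-π) π, c * |t - t'| ≤ |p t - p t'|) :
    energy R (osc (volume.restrict (Icc (-π) π)) p h)
      ≤ Real.exp 2 * (2 * π) ^ 2 * (M ^ 2 / c) := by
  have hind : osc (volume.restrict (Icc (-π) π)) p h
      = osc (volume.restrict (Icc (-π) π)) p ((Icc (-π) π).indicator h) := by
    ext l
    unfold osc
    refine setIntegral_congr_fun measurableSet_Icc fun t ht => ?_
    simp only [indicator_of_mem ht]
  rw [hind]
  have := energy_osc_le (A := 2 * π / c) (M := M) hp 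
    (h := (Icc (-π) π).indicator h) (hh.indicator measurableSet_Icc) hR ?_ ?_
  · rw [real_restrict_Icc] at this
    refine this.trans (le_of_eq ?_)
    field_simp
  · intro t
    by_cases ht : t ∈ Icc (-π) π
    · rw [indicator_of_mem ht]; exact hM t ht
    · rw [indicator_of_notMem ht, norm_zero]; exact hM0
  · refine (ae_restrict_iff' measurableSet_Icc).mpr (Filter.Eventually.of_forall fun t ht => ?_)
    refine setIntegral_gaussian_le (q := fun t' => p t - p t') (t₀ := t) measurableSet_Icc hc hR ?_
    intro t' ht'
    have := hpc t ht t' ht'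
    rwa [abs_sub_comm t' t]

/-- The absolute constant in the energy bound on the square. -/
def sqrConst : ℝ := Real.exp 2 * (8 * π ^ 2 * (2 * π) ^ 2)

lemma sqrConst_nonneg : 0 ≤ sqrConst := by unfold sqrConst; positivity

lemma energy_osc_sqr_le {h : ℝ × ℝ → ℂ} (hh : AEStronglyMeasurable h (volume.restrict sqr))
    {M R : ℝ} {v : ℝ × ℝ} (hR : 0 < R) (hM : ∀ y, ‖h y‖ ≤ M) (hv : 1 ≤ v.1 ^ 2 + v.2 ^ 2) :
    energy R (osc (volume.restrict sqr) (lin v) h) ≤ sqrConst * M ^ 2 := by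
  have := energy_osc_le (A := 8 * π ^ 2) (M := M) (measurable_lin v) hh hR hM ?_
  · rw [real_restrict_sqr] at this
    refine this.trans (le_of_eq ?_)
    unfold sqrConst
    ring
  refine Filter.Eventually.of_forall fun y => ?_
  have h_integrable : Integrable (fun y' : ℝ × ℝ =>
      √(π * R ^ 2) * Real.exp (-(lin v y - lin v y') ^ 2 * (R ^ 2 / 4)))
      (((volume : Measure ℝ).restrict (Icc (-π) π)).prod
      ((volume : Measure ℝ).restrict (Icc (-π) π))) := by
    refine Integrable.of_bound (Measurable.aestronglyMeasurable ?_) (√(π * R ^ 2)) ?_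
    · have := measurable_lin v
      fun_prop
    · filter_upwards with z
      have h1 : Real.exp (-(lin v y - lin v z) ^ 2 * (R ^ 2 / 4)) ≤ 1 := by
        rw [Real.exp_le_one_iff]
        nlinarith [mul_nonneg (sq_nonneg (lin v y - lin v z)) (sq_nonneg R)]
      rw [Real.norm_of_nonneg (by positivity)]
      nlinarith [Real.sqrt_nonneg (π * R ^ 2)]
  rw [restrict_sqr]
  have hmain : ∀ (q : ℝ → ℝ → ℝ) (a : ℝ) (t₀ : ℝ → ℝ), (1 / 2 ≤ |a|) →
      (∀ s t, q s t = a * (t₀ s - t)) →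
      ∫ s in Icc (-π) π, ∫ t in Icc (-π) π,
        √(π * R ^ 2) * Real.exp (-(q s t) ^ 2 * (R ^ 2 / 4)) ≤ 8 * π ^ 2 := by
    intro q a t₀ ha hq
    have hin : ∀ s, ∫ t in Icc (-π) π,
        √(π * R ^ 2) * Real.exp (-(q s t) ^ 2 * (R ^ 2 / 4)) ≤ 4 * π := by
      intro s
      refine (setIntegral_gaussian_le (c := 1 / 2) (t₀ := t₀ s) measurableSet_Icc
        (by norm_num) hR ?_).trans (by linarith [pi_pos])
      intro t _
      rw [hq, abs_mul, abs_sub_comm]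
      gcongr
    calc _ ≤ ∫ _s in Icc (-π) π, 4 * π := by
          refine integral_mono_of_nonneg ?_ (integrable_const _) (Filter.Eventually.of_forall hin)
          filter_upwards with s
          exact integral_nonneg fun t => by positivity
      _ = 8 * π ^ 2 := by
          rw [integral_const, real_restrict_Icc, smul_eq_mul]; ring
  by_cases h1 : 1 / 2 ≤ |v.1|
  · rw [integral_prod_symm _ h_integrable]
    refine hmain (fun s t => lin v y - lin v (t, s)) v.1
      (fun s => y.1 + (y.2 - s) * v.2 / v.1) h1 ?_
    intro s t
    have : v.1 ≠ 0 := by rintro h; rw [h] at h1; norm_num at h1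
    simp only [lin]
    field_simp
    ring
  · have h2 : 1 / 2 ≤ |v.2| := by
      by_contra h2
      push Not at h1 h2
      have e1 : v.1 ^ 2 ≤ 1 / 4 := by rw [← sq_abs]; nlinarith [abs_nonneg v.1]
      have e2 : v.2 ^ 2 ≤ 1 / 4 := by rw [← sq_abs]; nlinarith [abs_nonneg v.2]
      linarith
    rw [integral_prod _ h_integrable]
    refine hmain (fun s t => lin v y - lin v (s, t)) v.2
      (fun s => y.2 + (y.1 - s) * v.1 / v.2) h2 ?_
    intro s t
    have : v.2 ≠ 0 := by rintro h; rw [h] at h2; norm_num at h2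
    simp only [lin]
    field_simp
    ring

/-- Integration by parts for the one-dimensional oscillatory integral. -/
lemma osc_interval_ibp {p p' : ℝ → ℝ} {k k' : ℝ → ℂ}
    (hp : ∀ t, HasDerivAt p (p' t) t) (hp' : Continuous p')
    (hk : ∀ t ∈ Icc (-π) π, HasDerivAt k (k' t) t) (hk' : ContinuousOn k' (Icc (-π) π))
    (h0 : k (-π) = 0) (h1 : k π = 0) (l : ℝ) :
    Complex.I * l * osc (volume.restrict (Icc (-π) π)) p (fun t => k t * p' t) l
      = osc (volume.restrict (Icc (-π) π)) p k' l := by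
  have hle : -π ≤ π := by linarith [pi_pos]
  have hu : uIcc (-π) π = Icc (-π) π := uIcc_of_le hle
  have hpc : Continuous p := continuous_iff_continuousAt.mpr fun t => (hp t).continuousAt
  set e : ℝ → ℂ := fun t => Complex.exp (-(Complex.I) * ((l * p t : ℝ) : ℂ)) with he
  have hed : ∀ t, HasDerivAt e (e t * (-(Complex.I) * ((l * p' t : ℝ) : ℂ))) t := by
    intro t
    have h2 : HasDerivAt (fun t => ((l * p t : ℝ) : ℂ)) ((l * p' t : ℝ) : ℂ) t :=
      ((hp t).const_mul l).ofReal_comp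
    exact (h2.const_mul (-(Complex.I))).cexp
  have hkc : ContinuousOn k (Icc (-π) π) := fun t ht => (hk t ht).continuousAt.continuousWithinAt
  have hec : Continuous e := by fun_prop
  have key := intervalIntegral.integral_mul_deriv_eq_deriv_mul (a := -π) (b := π)
    (u := k) (v := e) (u' := k') (v' := fun t => e t * (-(Complex.I) * ((l * p' t : ℝ) : ℂ)))
    (fun t ht => hk t (hu ▸ ht)) (fun t _ => hed t)
    (by rw [← hu] at hk'; exact hk'.intervalIntegrable)
    (by apply Continuous.intervalIntegrable; fun_prop)
  rw [h0, h1, zero_mul, zero_mul, sub_zero, zero_sub] at key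
  unfold osc
  rw [integral_Icc_eq_integral_Ioc, integral_Icc_eq_integral_Ioc,
    ← intervalIntegral.integral_of_le hle, ← intervalIntegral.integral_of_le hle]
  rw [← neg_eq_iff_eq_neg] at key
  rw [← key, ← intervalIntegral.integral_const_mul, ← intervalIntegral.integral_neg]
  congr 1
  ext t
  simp only [he]
  push_cast
  ring

/-- The shear `(x,t) ↦ (x + E t, t)` straightening the edge `x = E t`. -/
def edgeShear (E : ℝ → ℝ) (hE : Continuous E) : ℝ × ℝ ≃ₜ ℝ × ℝ where
  toFun z := (z.1 + E z.2, z.2)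
  invFun z := (z.1 - E z.2, z.2)
  left_inv z := by simp
  right_inv z := by simp
  continuous_toFun := by fun_prop
  continuous_invFun := by fun_prop

/-- The divergence theorem on the region `E(y₂) ≤ y₁` for a compactly supported function. -/
lemma integral_edge_fderiv {F : ℝ × ℝ → ℂ} (hF : ContDiff ℝ 1 F) (hs : tsupport F ⊆ sqr)
    {E E' : ℝ → ℝ} (hE : ∀ t, HasDerivAt E (E' t) t) (hE' : Continuous E') (v : ℝ × ℝ) :
    ∫ y : ℝ × ℝ, {y : ℝ × ℝ | E y.2 ≤ y.1}.indicator (fun y => fderiv ℝ F y v) y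
      = -∫ t : ℝ, F (E t, t) * ((v.1 - v.2 * E' t : ℝ) : ℂ) := by
  have hEc : Continuous E := continuous_iff_continuousAt.mpr fun t => (hE t).continuousAt
  have hFc : Continuous F := hF.continuous
  have hcs : HasCompactSupport F := isCompact_sqr.of_isClosed_subset (isClosed_tsupport F) hs
  have hfd : Continuous (fderiv ℝ F) := hF.continuous_fderiv one_ne_zero
  have hfdcs : HasCompactSupport (fderiv ℝ F) := hcs.fderiv ℝ
  have hdiff : ∀ y, HasFDerivAt F (fderiv ℝ F y) y := fun y =>
    (hF.differentiable one_ne_zero y).hasFDerivAt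
  have hmeas : MeasurableSet {y : ℝ × ℝ | E y.2 ≤ y.1} :=
    (isClosed_le (by fun_prop) (by fun_prop)).measurableSet
  have hQc : Continuous (fun y => fderiv ℝ F y v) := by fun_prop
  have hQcs : HasCompactSupport (fun y => fderiv ℝ F y v) :=
    hfdcs.comp_left (g := fun L : ℝ × ℝ →L[ℝ] ℂ => L v) (by simp)
  have hQi : Integrable (fun y => fderiv ℝ F y v) := hQc.integrable_of_hasCompactSupport hQcs
  have hslice : ∀ (G : ℝ × ℝ → ℂ) (t : ℝ), Continuous G → HasCompactSupport G →
      HasCompactSupport (fun x => G (x, t)) := fun G t _ h =>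
    h.comp_isClosedEmbedding (g := fun x : ℝ => (x, t))
      (Topology.IsClosedEmbedding.of_continuous_injective_isClosedMap (by fun_prop)
        (fun a b h => (Prod.mk.inj h).1) (isClosedMap_prodMk_right t))
  set bx : ℝ × ℝ → ℂ := fun z => fderiv ℝ F (z.1 + E z.2, z.2) (1, 0) with hbx
  set bt : ℝ × ℝ → ℂ := fun z => fderiv ℝ F (z.1 + E z.2, z.2) (E' z.2, 1) with hbt
  have hdcs : HasCompactSupport (fun z : ℝ × ℝ => fderiv ℝ F (z.1 + E z.2, z.2)) :=
    hfdcs.comp_homeomorph (edgeShear E hEc)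
  have hbcs : HasCompactSupport (fun z : ℝ × ℝ => F (z.1 + E z.2, z.2)) :=
    hcs.comp_homeomorph (edgeShear E hEc)
  have hbxc : Continuous bx := by fun_prop
  have hbtc : Continuous bt := by fun_prop
  have hbxcs : HasCompactSupport bx :=
    hdcs.comp_left (g := fun L : ℝ × ℝ →L[ℝ] ℂ => L (1, 0)) (by simp)
  have hbtcs : HasCompactSupport bt := hdcs.mono' (by
    intro z hz
    apply subset_tsupport
    intro h
    apply hz
    simp only [hbt]
    rw [show fderiv ℝ F (z.1 + E z.2, z.2) = 0 from h]
    simp)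
  have hdec : ∀ z : ℝ × ℝ, fderiv ℝ F (z.1 + E z.2, z.2) v
      = ((v.1 - v.2 * E' z.2 : ℝ) : ℂ) * bx z + (v.2 : ℂ) * bt z := by
    intro z
    have : v = (v.1 - v.2 * E' z.2) • ((1 : ℝ), (0 : ℝ)) + v.2 • (E' z.2, (1 : ℝ)) := by
      ext <;> simp
    conv_lhs => rw [this]
    rw [map_add, map_smul, map_smul]
    simp [hbx, hbt]
  have hbxd : ∀ x t, HasDerivAt (fun x => F (x + E t, t)) (bx (x, t)) x := by
    intro x t
    have h1 : HasDerivAt (fun x : ℝ => (x + E t, t)) ((1 : ℝ), (0 : ℝ)) x :=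
      ((hasDerivAt_id x).add_const _).prodMk (hasDerivAt_const x t)
    exact (hdiff (x + E t, t)).comp_hasDerivAt x h1
  have hbtd : ∀ x t, HasDerivAt (fun t => F (x + E t, t)) (bt (x, t)) t := by
    intro x t
    have h1 : HasDerivAt (fun t : ℝ => (x + E t, t)) (E' t, (1 : ℝ)) t :=
      ((hE t).const_add x).prodMk (hasDerivAt_id t)
    exact (hdiff (x + E t, t)).comp_hasDerivAt (f := fun t : ℝ => (x + E t, t)) t h1
  have hbxint : ∀ t, ∫ x in Ioi (0 : ℝ), bx (x, t) = -F (E t, t) := by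
    intro t
    have := HasCompactSupport.integral_Ioi_deriv_eq
      (f := fun x => F (x + E t, t)) (by
        apply ContDiff.comp hF
        fun_prop) (hslice _ t (by fun_prop) hbcs) 0
    rw [zero_add] at this
    rw [← this]
    congr 1
    ext x
    exact (hbxd x t).deriv.symm
  have hbtint : ∀ x, ∫ t, bt (x, t) = 0 := by
    intro x
    have hsl : HasCompactSupport (fun t => F (x + E t, t)) :=
      hbcs.comp_isClosedEmbedding (g := fun t : ℝ => (x, t))
        (Topology.IsClosedEmbedding.of_continuous_injective_isClosedMap (by fun_prop)
          (fun a b h => (Prod.mk.inj h).2) (isClosedMap_prodMk_left x))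
    have hsl' : HasCompactSupport (fun t => bt (x, t)) :=
      hbtcs.comp_isClosedEmbedding (g := fun t : ℝ => (x, t))
        (Topology.IsClosedEmbedding.of_continuous_injective_isClosedMap (by fun_prop)
          (fun a b h => (Prod.mk.inj h).2) (isClosedMap_prodMk_left x))
    exact integral_eq_zero_of_hasDerivAt_of_integrable (hbtd x)
      ((by fun_prop : Continuous fun t => bt (x, t)).integrable_of_hasCompactSupport hsl')
      ((by fun_prop : Continuous fun t => F (x + E t, t)).integrable_of_hasCompactSupport hsl)
  have hbxi : ∀ t, IntegrableOn (fun x => bx (x, t)) (Ioi 0) := fun t =>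
    ((by fun_prop : Continuous fun x => bx (x, t)).integrable_of_hasCompactSupport
      (hslice _ t hbxc hbxcs)).integrableOn
  have hbti : ∀ t, IntegrableOn (fun x => bt (x, t)) (Ioi 0) := fun t =>
    ((by fun_prop : Continuous fun x => bt (x, t)).integrable_of_hasCompactSupport
      (hslice _ t hbtc hbtcs)).integrableOn
  have hbtprod : Integrable (Function.uncurry fun t x => bt (x, t))
      ((volume : Measure ℝ).prod ((volume : Measure ℝ).restrict (Ioi 0))) := by
    have h1 : Integrable (Function.uncurry fun t x => bt (x, t))
        ((volume : Measure ℝ).prod (volume : Measure ℝ)) :=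
      Continuous.integrable_of_hasCompactSupport (by fun_prop)
        (hbtcs.comp_homeomorph (Homeomorph.prodComm ℝ ℝ))
    have h2 : (volume : Measure ℝ).prod ((volume : Measure ℝ).restrict (Ioi 0))
        = ((volume : Measure ℝ).prod (volume : Measure ℝ)).restrict (univ ×ˢ Ioi 0) := by
      rw [← Measure.prod_restrict, Measure.restrict_univ]
    rw [h2]
    exact h1.integrableOn
  have hinner : ∀ t, ∫ x, {y : ℝ × ℝ | E y.2 ≤ y.1}.indicator (fun y => fderiv ℝ F y v) (x, t)
      = -(F (E t, t) * ((v.1 - v.2 * E' t : ℝ) : ℂ)) + v.2 * ∫ x in Ioi (0 : ℝ), bt (x, t) := by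
    intro t
    rw [← integral_add_right_eq_self _ (E t)]
    have h1 : (fun x => {y : ℝ × ℝ | E y.2 ≤ y.1}.indicator (fun y => fderiv ℝ F y v) (x + E t, t))
        = (Ici (0 : ℝ)).indicator (fun x => ((v.1 - v.2 * E' t : ℝ) : ℂ) * bx (x, t)
          + (v.2 : ℂ) * bt (x, t)) := by
      ext x
      by_cases hx : 0 ≤ x
      · rw [indicator_of_mem (by simpa using hx), indicator_of_mem (by simpa using hx)]
        exact hdec (x, t)
      · rw [indicator_of_notMem (by simpa using hx), indicator_of_notMem (by simpa using hx)]
    rw [h1, integral_indicator measurableSet_Ici, integral_Ici_eq_integral_Ioi,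
      integral_add ((hbxi t).const_mul _) ((hbti t).const_mul _), integral_const_mul,
      integral_const_mul, hbxint]
    ring
  have hFb : Integrable (fun t => F (E t, t) * ((v.1 - v.2 * E' t : ℝ) : ℂ)) := by
    apply Continuous.integrable_of_hasCompactSupport (by fun_prop)
    refine HasCompactSupport.mul_right ?_
    refine HasCompactSupport.intro (isCompact_Icc (a := -π) (b := π)) fun t ht => ?_
    by_contra h
    exact ht (hs (subset_tsupport _ h)).2
  rw [show (volume : Measure (ℝ × ℝ)) = (volume : Measure ℝ).prod volume from rfl,
    integral_prod_symm _ (hQi.indicator hmeas)]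
  simp_rw [hinner]
  have hN : Integrable (fun t => -(F (E t, t) * ((v.1 - v.2 * E' t : ℝ) : ℂ))) := hFb.neg
  have hI : Integrable (fun t => (v.2 : ℂ) * ∫ x in Ioi (0 : ℝ), bt (x, t)) :=
    hbtprod.integral_prod_left.const_mul _
  rw [integral_add hN hI, integral_neg, integral_const_mul, integral_integral_swap hbtprod]
  simp_rw [hbtint]
  simp

lemma integral_edge_restrict {a : ℝ × ℝ → ℂ} (hs : tsupport a ⊆ sqr) (c : ℝ × ℝ → ℂ)
    (D : Set (ℝ × ℝ)) :
    ∫ y in sqr, D.indicator a y * c y = ∫ y, D.indicator a y * c y := by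
  apply setIntegral_eq_integral_of_forall_compl_eq_zero
  intro y hy
  have : a y = 0 := by
    by_contra h
    exact hy (hs (subset_tsupport _ h))
  by_cases h : y ∈ D <;> simp [h, this]

/-- Oscillatory integral over the part of the square to the right of the edge `y₁ = E y₂`. -/
def edgeT (E : ℝ → ℝ) (v : ℝ × ℝ) (a : ℝ × ℝ → ℂ) : ℝ → ℂ :=
  osc (volume.restrict sqr) (lin v) ({y : ℝ × ℝ | E y.2 ≤ y.1}.indicator a)

/-- Boundary integral along the edge `y₁ = E y₂`. -/
def edgeB (E E' : ℝ → ℝ) (v : ℝ × ℝ) (a : ℝ × ℝ → ℂ) : ℝ → ℂ :=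
  osc (volume.restrict (Icc (-π) π)) (fun t => lin v (E t, t))
    (fun t => a (E t, t) * ((v.1 - v.2 * E' t : ℝ) : ℂ))

/-- Directional derivative. -/
def pdir (e : ℝ × ℝ) (f : ℝ × ℝ → ℂ) : ℝ × ℝ → ℂ := fun y => fderiv ℝ f y e

/-- Integration by parts for `edgeT`. -/
lemma edge_identity {a : ℝ × ℝ → ℂ} (ha : ContDiff ℝ 1 a) (hs : tsupport a ⊆ sqr)
    {E E' : ℝ → ℝ} (hE : ∀ t, HasDerivAt E (E' t) t) (hE' : Continuous E') (v : ℝ × ℝ) (l : ℝ) :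
    Complex.I * l * ((v.1 ^ 2 + v.2 ^ 2 : ℝ) : ℂ) * edgeT E v a l
      = edgeT E v (pdir v a) l + edgeB E E' v a l := by
  set ex : ℝ × ℝ → ℂ := fun y => Complex.exp (-(Complex.I) * ((l * lin v y : ℝ) : ℂ)) with hex
  have hlinc : ContDiff ℝ 1 (fun y : ℝ × ℝ => -(Complex.I) * ((l * lin v y : ℝ) : ℂ)) := by
    have : ContDiff ℝ 1 (fun y : ℝ × ℝ => l * (y.1 * v.1 + y.2 * v.2)) := by fun_prop
    exact contDiff_const.mul (Complex.ofRealCLM.contDiff.comp this)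
  have hexc : ContDiff ℝ 1 ex := hlinc.cexp
  have hEc : Continuous E := continuous_iff_continuousAt.mpr fun t => (hE t).continuousAt
  have hmeas : MeasurableSet {y : ℝ × ℝ | E y.2 ≤ y.1} :=
    (isClosed_le (by fun_prop) (by fun_prop)).measurableSet
  have hF : ContDiff ℝ 1 (fun y => a y * ex y) := ha.mul hexc
  have hFs : tsupport (fun y => a y * ex y) ⊆ sqr := (tsupport_mul_subset_left).trans hs
  have key := integral_edge_fderiv hF hFs hE hE' v
  have hexd : ∀ y, HasFDerivAt ex
      (ex y • (-(Complex.I) * l) • (Complex.ofRealCLM.comp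
        (v.1 • ContinuousLinearMap.fst ℝ ℝ ℝ + v.2 • ContinuousLinearMap.snd ℝ ℝ ℝ))) y := by
    intro y
    have h1 : HasFDerivAt (fun y : ℝ × ℝ => -(Complex.I) * ((l * lin v y : ℝ) : ℂ))
        ((-(Complex.I) * l) • (Complex.ofRealCLM.comp
        (v.1 • ContinuousLinearMap.fst ℝ ℝ ℝ + v.2 • ContinuousLinearMap.snd ℝ ℝ ℝ))) y := by
      have := ((-(Complex.I) * (l : ℂ)) • (Complex.ofRealCLM.comp
        (v.1 • ContinuousLinearMap.fst ℝ ℝ ℝ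
          + v.2 • ContinuousLinearMap.snd ℝ ℝ ℝ))).hasFDerivAt (x := y)
      refine this.congr_of_eventuallyEq (Filter.Eventually.of_forall fun z => ?_)
      simp [lin]
      ring
    exact h1.cexp
  have hfd : ∀ y, fderiv ℝ (fun y => a y * ex y) y v
      = pdir v a y * ex y - Complex.I * l * ((v.1 ^ 2 + v.2 ^ 2 : ℝ) : ℂ) * (a y * ex y) := by
    intro y
    have h2 := ((ha.differentiable one_ne_zero y).hasFDerivAt.mul (hexd y)).fderiv
    rw [show (fun y => a y * ex y) = a * ex from rfl, h2]
    simp [pdir]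
    ring
  have hpc : Continuous (pdir v a) := by
    have := ha.continuous_fderiv one_ne_zero
    unfold pdir
    fun_prop
  have hps : tsupport (pdir v a) ⊆ sqr := (tsupport_fderiv_apply_subset ℝ v).trans hs
  have h_integrable : ∀ b : ℝ × ℝ → ℂ, Continuous b → tsupport b ⊆ sqr →
      Integrable (fun y => {y : ℝ × ℝ | E y.2 ≤ y.1}.indicator b y * ex y) := by
    intro b hb hbs
    have h1 : Integrable (fun y => b y * ex y) := by
      apply Continuous.integrable_of_hasCompactSupport (hb.mul hexc.continuous)
      exact HasCompactSupport.mul_right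
        (isCompact_sqr.of_isClosed_subset (isClosed_tsupport _) hbs)
    refine (h1.indicator hmeas).congr (Filter.Eventually.of_forall fun y => ?_)
    by_cases h : E y.2 ≤ y.1 <;> simp [h]
  have h3 : ∫ y : ℝ × ℝ, {y : ℝ × ℝ | E y.2 ≤ y.1}.indicator
        (fun y => fderiv ℝ (fun y => a y * ex y) y v) y
      = edgeT E v (pdir v a) l
        - Complex.I * l * ((v.1 ^ 2 + v.2 ^ 2 : ℝ) : ℂ) * edgeT E v a l := by
    unfold edgeT osc
    rw [integral_edge_restrict hps, integral_edge_restrict hs, ← integral_const_mul,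
      ← integral_sub (h_integrable _ hpc hps) ((h_integrable _ ha.continuous hs).const_mul _)]
    congr 1
    ext y
    by_cases h : E y.2 ≤ y.1
    · simp only [mem_ofPred_eq, h, indicator_of_mem]
      exact hfd y
    · simp [h]
  have h4 : ∫ t : ℝ, (fun y => a y * ex y) (E t, t) * ((v.1 - v.2 * E' t : ℝ) : ℂ)
      = edgeB E E' v a l := by
    unfold edgeB osc
    rw [setIntegral_eq_integral_of_forall_compl_eq_zero]
    · congr 1
      ext t
      simp only [hex]
      ring
    · intro t ht
      have : a (E t, t) = 0 := by
        by_contra h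
        exact ht (hs (subset_tsupport _ h)).2
      simp [this]
  rw [h3, h4] at key
  linear_combination -key

/-- A uniform energy estimate: for parameters `(R, v) ∈ S`, the energy of `F (R, v)` at scale `R`
is bounded by a constant multiple of the weight `w (R, v)`. -/
def Est (S : Set (ℝ × ℝ × ℝ)) (F : ℝ × ℝ × ℝ → ℝ → ℂ) (w : ℝ × ℝ × ℝ → ℝ) : Prop :=
  (∀ p ∈ S, Continuous (F p)) ∧ ∃ C, 0 ≤ C ∧ ∀ p ∈ S, energy p.1 (F p) ≤ C * w p

lemma Est.mono_weight {S : Set (ℝ × ℝ × ℝ)} {F : ℝ × ℝ × ℝ → ℝ → ℂ} {w w' : ℝ × ℝ × ℝ → ℝ}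
    (h : Est S F w) {K : ℝ} (hK : 0 ≤ K) (hw : ∀ p ∈ S, w p ≤ K * w' p) : Est S F w' := by
  obtain ⟨hc, C, hC, hb⟩ := h
  refine ⟨hc, C * K, by positivity, fun p hp => (hb p hp).trans ?_⟩
  rw [mul_assoc]
  exact mul_le_mul_of_nonneg_left (hw p hp) hC

lemma Est.congr {S : Set (ℝ × ℝ × ℝ)} {F G : ℝ × ℝ × ℝ → ℝ → ℂ} {w : ℝ × ℝ × ℝ → ℝ}
    (h : Est S F w) (hFG : ∀ p ∈ S, F p = G p) : Est S G w := by
  obtain ⟨hc, C, hC, hb⟩ := h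
  exact ⟨fun p hp => hFG p hp ▸ hc p hp, C, hC, fun p hp => hFG p hp ▸ hb p hp⟩

lemma Est.add {S : Set (ℝ × ℝ × ℝ)} {F G : ℝ × ℝ × ℝ → ℝ → ℂ} {w : ℝ × ℝ × ℝ → ℝ}
    (hF : Est S F w) (hG : Est S G w) : Est S (fun p l => F p l + G p l) w := by
  obtain ⟨hc, C, hC, hb⟩ := hF
  obtain ⟨hc', C', hC', hb'⟩ := hG
  refine ⟨fun p hp => (hc p hp).add (hc' p hp), 2 * (C + C'), by positivity, fun p hp => ?_⟩
  have := energy_le_of_le (R := p.1) (c := 1) ((hc p hp).add (hc' p hp)) (hc p hp) (hc' p hp)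
    (fun l => by simpa using norm_add_le (F p l) (G p l))
  have h1 := hb p hp
  have h2 := hb' p hp
  change energy p.1 (F p + G p) ≤ _
  linarith

lemma energy_const_mul (R : ℝ) (c : ℂ) (F : ℝ → ℂ) :
    energy R (fun l => c * F l) = ‖c‖ ^ 2 * energy R F := by
  unfold energy
  rw [← integral_const_mul]
  simp only [norm_mul, mul_pow]

lemma Est.smul {S : Set (ℝ × ℝ × ℝ)} {F : ℝ × ℝ × ℝ → ℝ → ℂ} {w w' : ℝ × ℝ × ℝ → ℝ}
    (hF : Est S F w) (c : ℝ × ℝ × ℝ → ℂ) {K : ℝ} (hK : 0 ≤ K)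
    (hw : ∀ p ∈ S, ‖c p‖ ^ 2 * w p ≤ K * w' p) : Est S (fun p l => c p * F p l) w' := by
  obtain ⟨hc, C, hC, hb⟩ := hF
  refine ⟨fun p hp => continuous_const.mul (hc p hp), C * K, by positivity, fun p hp => ?_⟩
  rw [energy_const_mul]
  calc ‖c p‖ ^ 2 * energy p.1 (F p) ≤ ‖c p‖ ^ 2 * (C * w p) :=
        mul_le_mul_of_nonneg_left (hb p hp) (by positivity)
    _ = C * (‖c p‖ ^ 2 * w p) := by ring
    _ ≤ C * (K * w' p) := mul_le_mul_of_nonneg_left (hw p hp) hC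
    _ = C * K * w' p := by ring

lemma Est.of_mul {S : Set (ℝ × ℝ × ℝ)} {F G : ℝ × ℝ × ℝ → ℝ → ℂ} {w : ℝ × ℝ × ℝ → ℝ}
    (hG : Est S G w) (hS : ∀ p ∈ S, 0 < p.1) (hF : ∀ p ∈ S, Continuous (F p))
    (h : ∀ p ∈ S, ∀ l, |l| * ‖F p l‖ ≤ ‖G p l‖) :
    Est S F (fun p => (p.1 ^ 2)⁻¹ * w p) := by
  obtain ⟨hc, C, hC, hb⟩ := hG
  refine ⟨hF, 18 * C, by positivity, fun p hp => ?_⟩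
  have := energy_le_of_mul_le (c := 1) (hS p hp) (hF p hp) (hc p hp) continuous_const (G₂ := 0)
    (fun l => by simpa using h p hp l)
  have h0 : energy p.1 0 = 0 := by simp [energy]
  rw [h0, add_zero] at this
  refine this.trans ?_
  calc 18 * 1 ^ 2 / p.1 ^ 2 * energy p.1 (G p) ≤ 18 * 1 ^ 2 / p.1 ^ 2 * (C * w p) :=
        mul_le_mul_of_nonneg_left (hb p hp) (by positivity)
    _ = 18 * C * ((p.1 ^ 2)⁻¹ * w p) := by ring

/-- A bounded function has energy `O(R)`. -/
lemma energy_le_of_bounded {R C : ℝ} (hR : 0 < R) {F : ℝ → ℂ} (hF : Continuous F)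
    (h : ∀ l, ‖F l‖ ≤ C) : energy R F ≤ 3 * C ^ 2 * R := by
  unfold energy
  have hF2 : IntegrableOn (fun l => ‖F l‖ ^ 2) (Icc (-(4 * R / 3)) (4 * R / 3)) :=
    (by fun_prop : Continuous fun l => ‖F l‖ ^ 2).continuousOn.integrableOn_compact isCompact_Icc
  have h1 : freqWin R ⊆ Icc (-(4 * R / 3)) (4 * R / 3) := fun l hl => abs_le.mp hl.2
  calc ∫ l in freqWin R, ‖F l‖ ^ 2 ≤ ∫ l in Icc (-(4 * R / 3)) (4 * R / 3), ‖F l‖ ^ 2 :=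
        setIntegral_mono_set hF2
          (Filter.Eventually.of_forall fun l => by positivity) h1.eventuallyLE
    _ ≤ ∫ l in Icc (-(4 * R / 3)) (4 * R / 3), C ^ 2 := by
        refine setIntegral_mono_on hF2 (by simp) measurableSet_Icc fun l _ => ?_
        have := h l
        gcongr
    _ = 8 / 3 * C ^ 2 * R := by
        rw [setIntegral_const, Real.volume_real_Icc_of_le (by linarith)]
        simp
        ring
    _ ≤ 3 * C ^ 2 * R := by
        have : 0 ≤ C ^ 2 * R := by positivity
        linarith

/-- A smooth function supported in the square. -/
def IsBump (φ : ℝ × ℝ → ℂ) : Prop := ContDiff ℝ (⊤ : ℕ∞) φ ∧ tsupport φ ⊆ sqr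

lemma IsBump.pdir {φ : ℝ × ℝ → ℂ} (h : IsBump φ) (e : ℝ × ℝ) : IsBump (pdir e φ) := by
  refine ⟨?_, (tsupport_fderiv_apply_subset ℝ e).trans h.2⟩
  exact (h.1.fderiv_right (m := (⊤ : ℕ∞)) (by simp)).clm_apply contDiff_const

lemma IsBump.eq_zero {φ : ℝ × ℝ → ℂ} (h : IsBump φ) {y : ℝ × ℝ} (hy : y ∉ sqr) : φ y = 0 := by
  by_contra h'
  exact hy (h.2 (subset_tsupport _ h'))

lemma contDiff_pdir {f : ℝ × ℝ → ℂ} {n : ℕ} (h : ContDiff ℝ (n + 1 : ℕ) f) (e : ℝ × ℝ) :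
    ContDiff ℝ n (pdir e f) :=
  (h.fderiv_right (m := n) (by norm_cast)).clm_apply contDiff_const

/-- The rescaled amplitude `y ↦ f(y/R) φ(y)`. -/
def amp (f φ : ℝ × ℝ → ℂ) (R : ℝ) : ℝ × ℝ → ℂ := fun y => f (R⁻¹ • y) * φ y

lemma amp_contDiff {f φ : ℝ × ℝ → ℂ} {n : ℕ} (hf : ContDiff ℝ n f) (hφ : IsBump φ) (R : ℝ) :
    ContDiff ℝ n (amp f φ R) := by
  unfold amp
  exact (hf.comp (contDiff_const_smul _)).mul (hφ.1.of_le (by exact_mod_cast le_top))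

lemma amp_tsupport {f φ : ℝ × ℝ → ℂ} (hφ : IsBump φ) (R : ℝ) : tsupport (amp f φ R) ⊆ sqr :=
  tsupport_mul_subset_right.trans hφ.2

lemma smul_mem_sqr {R : ℝ} (hR : 1 ≤ R) {y : ℝ × ℝ} (hy : y ∈ sqr) : R⁻¹ • y ∈ sqr := by
  have hc : Convex ℝ sqr := (convex_Icc _ _).prod (convex_Icc _ _)
  have h0 : (0 : ℝ × ℝ) ∈ sqr := by
    constructor <;> simp [pi_pos.le]
  exact (hc.starConvex h0).smul_mem hy (by positivity) (inv_le_one_of_one_le₀ hR)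

lemma amp_bound {f φ : ℝ × ℝ → ℂ} (hf : Continuous f) (hφ : IsBump φ) :
    ∃ C, 0 ≤ C ∧ ∀ R, 1 ≤ R → ∀ y, ‖amp f φ R y‖ ≤ C := by
  obtain ⟨C₁, h₁⟩ := isCompact_sqr.exists_bound_of_continuousOn hf.continuousOn
  obtain ⟨C₂, h₂⟩ := isCompact_sqr.exists_bound_of_continuousOn hφ.1.continuous.continuousOn
  refine ⟨|C₁| * |C₂|, by positivity, fun R hR y => ?_⟩
  by_cases hy : y ∈ sqr
  · unfold amp
    rw [norm_mul]
    exact mul_le_mul ((h₁ _ (smul_mem_sqr hR hy)).trans (le_abs_self _))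
      ((h₂ _ hy).trans (le_abs_self _)) (norm_nonneg _) (abs_nonneg _)
  · simp only [amp, hφ.eq_zero hy, mul_zero, norm_zero]
    positivity

lemma pdir_amp {f φ : ℝ × ℝ → ℂ} (hf : ContDiff ℝ 1 f) (hφ : IsBump φ) (R : ℝ) (v y : ℝ × ℝ) :
    pdir v (amp f φ R) y
      = (R : ℂ)⁻¹ * v.1 * amp (pdir (1, 0) f) φ R y + (R : ℂ)⁻¹ * v.2 * amp (pdir (0, 1) f) φ R y
        + v.1 * amp f (pdir (1, 0) φ) R y + v.2 * amp f (pdir (0, 1) φ) R y := by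
  have hv : v = v.1 • ((1 : ℝ), (0 : ℝ)) + v.2 • ((0 : ℝ), (1 : ℝ)) := by ext <;> simp
  have hd : ∀ (g : ℝ × ℝ → ℂ) z, fderiv ℝ g z v
      = v.1 * pdir (1, 0) g z + v.2 * pdir (0, 1) g z := by
    intro g z
    conv_lhs => rw [hv]
    rw [map_add, map_smul, map_smul]
    simp [pdir]
  have h1 : HasFDerivAt (fun y => f (R⁻¹ • y)) ((fderiv ℝ f (R⁻¹ • y)).comp
      (R⁻¹ • ContinuousLinearMap.id ℝ (ℝ × ℝ))) y :=
    ((hf.differentiable one_ne_zero _).hasFDerivAt).comp y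
      ((R⁻¹ • ContinuousLinearMap.id ℝ (ℝ × ℝ)).hasFDerivAt)
  have h2 : HasFDerivAt φ (fderiv ℝ φ y) y := (hφ.1.differentiable (by simp) y).hasFDerivAt
  have h3 := (h1.mul h2).fderiv
  change fderiv ℝ ((fun y => f (R⁻¹ • y)) * φ) y v = _
  rw [h3]
  simp only [add_apply, smul_apply,
    ContinuousLinearMap.comp_apply, ContinuousLinearMap.id_apply, map_smul, hd, amp]
  simp
  ring

lemma osc_add {Y : Type*} [MeasurableSpace Y] {μ : Measure Y} {p : Y → ℝ} (hp : Measurable p)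
    {h k : Y → ℂ} (hh : Integrable h μ) (hk : Integrable k μ) (l : ℝ) :
    osc μ p (fun y => h y + k y) l = osc μ p h l + osc μ p k l := by
  unfold osc
  rw [← integral_add (osc_integrand_integrable hp hh l) (osc_integrand_integrable hp hk l)]
  simp only [add_mul]

lemma osc_const_mul {Y : Type*} [MeasurableSpace Y] {μ : Measure Y} {p : Y → ℝ} (c : ℂ)
    (h : Y → ℂ) (l : ℝ) : osc μ p (fun y => c * h y) l = c * osc μ p h l := by
  unfold osc
  rw [← integral_const_mul]
  simp only [mul_assoc]

lemma norm_osc_le {Y : Type*} [MeasurableSpace Y] {μ : Measure Y} {p : Y → ℝ} {h : Y → ℂ}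
    [IsFiniteMeasure μ] {M : ℝ} (hM : ∀ᵐ y ∂μ, ‖h y‖ ≤ M) (l : ℝ) :
    ‖osc μ p h l‖ ≤ M * μ.real univ := by
  refine norm_integral_le_of_norm_le_const ?_
  filter_upwards [hM] with y hy
  rwa [norm_mul, norm_exp_neg_I_mul, mul_one]

lemma measurableSet_edge {E : ℝ → ℝ} (hE : Continuous E) :
    MeasurableSet {y : ℝ × ℝ | E y.2 ≤ y.1} :=
  (isClosed_le (by fun_prop) (by fun_prop)).measurableSet

lemma edge_integrable {E : ℝ → ℝ} (hE : Continuous E) {a : ℝ × ℝ → ℂ} (ha : Continuous a) :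
    Integrable ({y : ℝ × ℝ | E y.2 ≤ y.1}.indicator a) (volume.restrict sqr) :=
  (ha.continuousOn.integrableOn_compact isCompact_sqr).indicator (measurableSet_edge hE)

lemma edgeT_continuous {E : ℝ → ℝ} (hE : Continuous E) (v : ℝ × ℝ) {a : ℝ × ℝ → ℂ}
    (ha : Continuous a) : Continuous (edgeT E v a) :=
  osc_continuous (measurable_lin v) (edge_integrable hE ha)

lemma edgeT_add {E : ℝ → ℝ} (hE : Continuous E) (v : ℝ × ℝ) {a b : ℝ × ℝ → ℂ}
    (ha : Continuous a) (hb : Continuous b) (l : ℝ) :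
    edgeT E v (fun y => a y + b y) l = edgeT E v a l + edgeT E v b l := by
  unfold edgeT
  rw [← osc_add (measurable_lin v) (edge_integrable hE ha) (edge_integrable hE hb)]
  congr 1
  ext y
  by_cases h : E y.2 ≤ y.1 <;> simp [h]

lemma edgeT_const_mul {E : ℝ → ℝ} (v : ℝ × ℝ) (c : ℂ) (a : ℝ × ℝ → ℂ) (l : ℝ) :
    edgeT E v (fun y => c * a y) l = c * edgeT E v a l := by
  unfold edgeT
  rw [← osc_const_mul]
  congr 1
  ext y
  by_cases h : E y.2 ≤ y.1 <;> simp [h]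

lemma edgeB_continuous {E E' : ℝ → ℝ} (hE : Continuous E) (hE' : Continuous E') (v : ℝ × ℝ)
    {a : ℝ × ℝ → ℂ} (ha : Continuous a) : Continuous (edgeB E E' v a) := by
  refine osc_continuous (Continuous.measurable ?_) ?_
  · unfold lin
    fun_prop
  · exact (by fun_prop : Continuous fun t => a (E t, t) * ((v.1 - v.2 * E' t : ℝ) : ℂ)).continuousOn.integrableOn_compact
      isCompact_Icc

/-- The admissible range of parameters: `R ≥ 1` and `1 ≤ |v|² ≤ 10`. -/
def baseRange : Set (ℝ × ℝ × ℝ) :=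
  {p | 1 ≤ p.1 ∧ 1 ≤ p.2.1 ^ 2 + p.2.2 ^ 2 ∧ p.2.1 ^ 2 + p.2.2 ^ 2 ≤ 10}

lemma est_edgeT_one {S : Set (ℝ × ℝ × ℝ)} (hS : S ⊆ baseRange) {Ed : ℝ → ℝ → ℝ}
    (hEd : ∀ R, Continuous (Ed R)) {f φ : ℝ × ℝ → ℂ} (hf : Continuous f) (hφ : IsBump φ) :
    Est S (fun p => edgeT (Ed p.1) p.2 (amp f φ p.1)) (fun _ => 1) := by
  have hac : ∀ R, Continuous (amp f φ R) := fun R =>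
    (amp_contDiff (n := 0) (contDiff_zero.mpr hf) hφ R).continuous
  obtain ⟨C, hC, hb⟩ := amp_bound hf hφ
  refine ⟨fun p hp => edgeT_continuous (hEd _) _ (hac _), sqrConst * C ^ 2,
    mul_nonneg sqrConst_nonneg (by positivity), fun p hp => ?_⟩
  rw [mul_one]
  refine energy_osc_sqr_le (edge_integrable (hEd _) (hac _)).aestronglyMeasurable
    (by linarith [(hS hp).1]) (fun y => ?_) (hS hp).2.1
  by_cases h : Ed p.1 y.2 ≤ y.1
  · simpa [h] using hb _ (hS hp).1 y
  · simpa [h] using hC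

/-- One integration by parts: the energy estimates for the derivatives of the amplitude and for
the boundary term give an estimate improved by `R⁻²`. -/
lemma est_edgeT_step {S : Set (ℝ × ℝ × ℝ)} (hS : S ⊆ baseRange) {Ed Ed' : ℝ → ℝ → ℝ}
    (hEd : ∀ R t, HasDerivAt (Ed R) (Ed' R t) t) (hEd' : ∀ R, Continuous (Ed' R))
    {f φ : ℝ × ℝ → ℂ} (hf : ContDiff ℝ 1 f) (hφ : IsBump φ) {w : ℝ × ℝ × ℝ → ℝ}
    (hw : ∀ p ∈ S, 0 ≤ w p)
    (h1 : ∀ e, Est S (fun p => edgeT (Ed p.1) p.2 (amp (pdir e f) φ p.1))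
      (fun p => p.1 ^ 2 * w p))
    (h2 : ∀ e, Est S (fun p => edgeT (Ed p.1) p.2 (amp f (pdir e φ) p.1)) w)
    (hB : Est S (fun p => edgeB (Ed p.1) (Ed' p.1) p.2 (amp f φ p.1)) w) :
    Est S (fun p => edgeT (Ed p.1) p.2 (amp f φ p.1)) (fun p => (p.1 ^ 2)⁻¹ * w p) := by
  have hEc : ∀ R, Continuous (Ed R) := fun R =>
    continuous_iff_continuousAt.mpr fun t => (hEd R t).continuousAt
  have hac : ∀ R, Continuous (amp f φ R) := fun R =>
    (amp_contDiff (n := 1) (by exact_mod_cast hf) hφ R).continuous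
  have hc1 : ∀ e R, Continuous (amp (pdir e f) φ R) := fun e R =>
    (amp_contDiff (n := 0) (contDiff_pdir (n := 0) (by simpa using hf) e) hφ R).continuous
  have hc2 : ∀ e R, Continuous (amp f (pdir e φ) R) := fun e R =>
    (amp_contDiff (n := 1) (by exact_mod_cast hf) (hφ.pdir e) R).continuous
  have hR : ∀ p ∈ S, 0 < p.1 := fun p hp => by linarith [(hS hp).1]
  have hv : ∀ p ∈ S, p.2.1 ^ 2 ≤ 10 ∧ p.2.2 ^ 2 ≤ 10 := fun p hp =>
    ⟨by nlinarith [(hS hp).2.2], by nlinarith [(hS hp).2.2]⟩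
  have hc1' : ∀ x : ℝ × ℝ × ℝ → ℝ, (∀ p ∈ S, (x p) ^ 2 ≤ 10) → ∀ p ∈ S,
      ‖((p.1 : ℂ)⁻¹ * (x p : ℂ))‖ ^ 2 * (p.1 ^ 2 * w p) ≤ 10 * w p := by
    intro x hx p hp
    have hRp := hR p hp
    rw [norm_mul, norm_inv, Complex.norm_real, Complex.norm_real, mul_pow, Real.norm_eq_abs,
      Real.norm_eq_abs, sq_abs, inv_pow, sq_abs]
    calc (p.1 ^ 2)⁻¹ * x p ^ 2 * (p.1 ^ 2 * w p) = x p ^ 2 * w p := by field_simp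
      _ ≤ 10 * w p := mul_le_mul_of_nonneg_right (hx p hp) (hw p hp)
  have hc2' : ∀ x : ℝ × ℝ × ℝ → ℝ, (∀ p ∈ S, (x p) ^ 2 ≤ 10) → ∀ p ∈ S,
      ‖(x p : ℂ)‖ ^ 2 * w p ≤ 10 * w p := by
    intro x hx p hp
    rw [Complex.norm_real, Real.norm_eq_abs, sq_abs]
    exact mul_le_mul_of_nonneg_right (hx p hp) (hw p hp)
  have hG := ((((h1 (1, 0)).smul (fun p => (p.1 : ℂ)⁻¹ * (p.2.1 : ℂ)) (K := 10) (by norm_num)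
    (hc1' (fun p => p.2.1) fun p hp => (hv p hp).1)).add
    ((h1 (0, 1)).smul (fun p => (p.1 : ℂ)⁻¹ * (p.2.2 : ℂ)) (K := 10) (by norm_num)
    (hc1' (fun p => p.2.2) fun p hp => (hv p hp).2))).add
    (((h2 (1, 0)).smul (fun p => (p.2.1 : ℂ)) (K := 10) (by norm_num)
    (hc2' (fun p => p.2.1) fun p hp => (hv p hp).1)))).add
    (((h2 (0, 1)).smul (fun p => (p.2.2 : ℂ)) (K := 10) (by norm_num)
    (hc2' (fun p => p.2.2) fun p hp => (hv p hp).2))) |>.add hB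
  refine Est.of_mul hG hR (fun p _ => edgeT_continuous (hEc _) _ (hac _)) fun p hp l => ?_
  have hN := (hS hp).2.1
  have hid := edge_identity (amp_contDiff (n := 1) (by exact_mod_cast hf) hφ p.1)
    (amp_tsupport hφ p.1) (hEd p.1) (hEd' p.1) p.2 l
  have hsum : edgeT (Ed p.1) p.2 (pdir p.2 (amp f φ p.1)) l
      = (p.1 : ℂ)⁻¹ * (p.2.1 : ℂ) * edgeT (Ed p.1) p.2 (amp (pdir (1, 0) f) φ p.1) l
        + (p.1 : ℂ)⁻¹ * (p.2.2 : ℂ) * edgeT (Ed p.1) p.2 (amp (pdir (0, 1) f) φ p.1) l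
        + (p.2.1 : ℂ) * edgeT (Ed p.1) p.2 (amp f (pdir (1, 0) φ) p.1) l
        + (p.2.2 : ℂ) * edgeT (Ed p.1) p.2 (amp f (pdir (0, 1) φ) p.1) l := by
    have d1 := hc1 (1, 0) p.1
    have d2 := hc1 (0, 1) p.1
    have d3 := hc2 (1, 0) p.1
    have d4 := hc2 (0, 1) p.1
    simp only [← edgeT_const_mul]
    rw [← edgeT_add (hEc _) _ (by fun_prop) (by fun_prop),
      ← edgeT_add (hEc _) _ (by fun_prop) (by fun_prop),
      ← edgeT_add (hEc _) _ (by fun_prop) (by fun_prop)]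
    congr 1
    ext y
    exact pdir_amp hf hφ p.1 p.2 y
  rw [hsum] at hid
  have hn : |l| * (p.2.1 ^ 2 + p.2.2 ^ 2) * ‖edgeT (Ed p.1) p.2 (amp f φ p.1) l‖
      = ‖Complex.I * l * ((p.2.1 ^ 2 + p.2.2 ^ 2 : ℝ) : ℂ) * edgeT (Ed p.1) p.2 (amp f φ p.1) l‖ := by
    simp only [norm_mul, Complex.norm_I, Complex.norm_real, Real.norm_eq_abs, one_mul]
    rw [abs_of_nonneg (by positivity : (0 : ℝ) ≤ p.2.1 ^ 2 + p.2.2 ^ 2)]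
  rw [← hid, hn.symm]
  calc |l| * ‖edgeT (Ed p.1) p.2 (amp f φ p.1) l‖
      = |l| * 1 * ‖edgeT (Ed p.1) p.2 (amp f φ p.1) l‖ := by ring
    _ ≤ _ := by gcongr

/-- Decay of the oscillatory integral of a `C^m` amplitude without an edge. The edge is placed
outside the square. -/
lemma est_interior (k : ℕ) : ∀ (m : ℕ) (f φ : ℝ × ℝ → ℂ), k ≤ 2 * m → ContDiff ℝ m f → IsBump φ →
    Est baseRange (fun p => edgeT (fun _ => -4) p.2 (amp f φ p.1)) (fun p => ((p.1 ^ 2)⁻¹) ^ k) := by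
  induction k using Nat.strong_induction_on with
  | _ k ih =>
    intro m f φ hk hf hφ
    rcases k with _ | k
    · simpa using est_edgeT_one (Ed := fun _ _ => -4) Subset.rfl (fun _ => continuous_const)
        hf.continuous hφ
    obtain ⟨m, rfl⟩ : ∃ n, m = n + 1 := ⟨m - 1, by omega⟩
    have hstep := est_edgeT_step (S := baseRange) Subset.rfl (Ed := fun _ _ => -4)
      (Ed' := fun _ _ => 0) (fun R t => hasDerivAt_const t _) (fun _ => continuous_const)
      (hf.of_le (by exact_mod_cast Nat.le_add_left 1 m)) hφ
      (w := fun p => ((p.1 ^ 2)⁻¹) ^ k) (fun p _ => by positivity) ?_ ?_ ?_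
    · simpa only [pow_succ'] using hstep
    · intro e
      refine (ih (k - 1) (by omega) m _ φ (by omega) (contDiff_pdir hf e) hφ).mono_weight
        zero_le_one fun p hp => ?_
      rw [one_mul]
      have hp1 : 1 ≤ p.1 ^ 2 := one_le_pow₀ hp.1
      rcases k with _ | k
      · simpa using hp1
      · rw [pow_succ' _ k, ← mul_assoc, mul_inv_cancel₀ (by positivity), one_mul]
        simp
    · intro e
      exact ih k (by omega) (m + 1) f _ (by omega) hf (hφ.pdir e)
    · have hz : ∀ p : ℝ × ℝ × ℝ, edgeB (fun _ => -4) (fun _ => 0) p.2 (amp f φ p.1) = 0 := by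
        intro p
        ext l
        have h0 : ∀ t, amp f φ p.1 (-4, t) = 0 := fun t => by
          have : ((-4 : ℝ), t) ∉ sqr := fun h => by
            have := h.1.1
            simp only at this
            linarith [pi_lt_d2]
          simp [amp, hφ.eq_zero this]
        simp [edgeB, osc, h0]
      refine ⟨fun p _ => ?_, 0, le_rfl, fun p _ => ?_⟩
      · simp only [hz]
        exact continuous_const
      · simp only [hz]
        simp [energy]

/-- Families of functions on `[-π, π]` with `k` uniformly bounded derivatives. -/
def UB {ι A : Type*} [NormedRing A] [NormedAlgebra ℝ A] : ℕ → (ι → ℝ → A) → Prop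
  | 0, F => (∀ i, ContinuousOn (F i) (Icc (-π) π)) ∧ ∃ C, ∀ i, ∀ t ∈ Icc (-π) π, ‖F i t‖ ≤ C
  | k + 1, F => ((∀ i, ContinuousOn (F i) (Icc (-π) π)) ∧
        ∃ C, ∀ i, ∀ t ∈ Icc (-π) π, ‖F i t‖ ≤ C) ∧
      ∃ F' : ι → ℝ → A, UB k F' ∧ ∀ i, ∀ t ∈ Icc (-π) π, HasDerivAt (F i) (F' i t) t

section UB
variable {ι A : Type*} [NormedRing A] [NormedAlgebra ℝ A]

lemma UB.zero {k : ℕ} {F : ι → ℝ → A} (h : UB k F) : UB 0 F := by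
  cases k with
  | zero => exact h
  | succ k => exact h.1

lemma UB.pred {k : ℕ} {F : ι → ℝ → A} (h : UB (k + 1) F) : UB k F := by
  induction k generalizing F with
  | zero => exact h.zero
  | succ k ih =>
    obtain ⟨h0, F', hF', hd⟩ := h
    exact ⟨h0, F', ih hF', hd⟩

lemma UB.succ_intro {k : ℕ} {F F' : ι → ℝ → A} (hF' : UB k F')
    (hd : ∀ i, ∀ t ∈ Icc (-π) π, HasDerivAt (F i) (F' i t) t)
    (hb : ∃ C, ∀ i, ∀ t ∈ Icc (-π) π, ‖F i t‖ ≤ C) : UB (k + 1) F :=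
  ⟨⟨fun i t ht => (hd i t ht).continuousAt.continuousWithinAt, hb⟩, F', hF', hd⟩

lemma UB.add {k : ℕ} {F G : ι → ℝ → A} (hF : UB k F) (hG : UB k G) :
    UB k (fun i t => F i t + G i t) := by
  have hz : ∀ {F G : ι → ℝ → A}, UB 0 F → UB 0 G → UB 0 (fun i t => F i t + G i t) := by
    rintro F G ⟨hc, C, hC⟩ ⟨hc', C', hC'⟩
    exact ⟨fun i => (hc i).add (hc' i), C + C', fun i t ht =>
      (norm_add_le _ _).trans (add_le_add (hC i t ht) (hC' i t ht))⟩
  induction k generalizing F G with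
  | zero => exact hz hF hG
  | succ k ih =>
    obtain ⟨h0, F', hF', hd⟩ := hF
    obtain ⟨h0', G', hG', hd'⟩ := hG
    exact ⟨hz h0 h0', _, ih hF' hG', fun i t ht => (hd i t ht).add (hd' i t ht)⟩

lemma UB.mul {k : ℕ} {F G : ι → ℝ → A} (hF : UB k F) (hG : UB k G) :
    UB k (fun i t => F i t * G i t) := by
  have hz : ∀ {F G : ι → ℝ → A}, UB 0 F → UB 0 G → UB 0 (fun i t => F i t * G i t) := by
    rintro F G ⟨hc, C, hC⟩ ⟨hc', C', hC'⟩
    refine ⟨fun i => (hc i).mul (hc' i), |C| * |C'|, fun i t ht =>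
      (norm_mul_le _ _).trans (mul_le_mul ((hC i t ht).trans (le_abs_self _))
        ((hC' i t ht).trans (le_abs_self _)) (norm_nonneg _) (abs_nonneg _))⟩
  induction k generalizing F G with
  | zero => exact hz hF hG
  | succ k ih =>
    have hFp := hF.pred
    have hGp := hG.pred
    obtain ⟨h0, F', hF', hd⟩ := hF
    obtain ⟨h0', G', hG', hd'⟩ := hG
    exact ⟨hz h0 h0', _, (ih hF' hGp).add (ih hFp hG'), fun i t ht =>
      (hd i t ht).mul (hd' i t ht)⟩

lemma UB.const (k : ℕ) {c : ι → A} {C : ℝ} (hc : ∀ i, ‖c i‖ ≤ C) : UB k (fun i (_ : ℝ) => c i) := by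
  have hz : ∀ {c : ι → A} {C : ℝ}, (∀ i, ‖c i‖ ≤ C) → UB 0 (fun i (_ : ℝ) => c i) :=
    fun hc => ⟨fun i => continuousOn_const, _, fun i _ _ => hc i⟩
  induction k generalizing c C with
  | zero => exact hz hc
  | succ k ih =>
    exact ⟨hz hc, fun _ _ => 0, ih (C := 0) (c := fun _ => 0) (by simp),
      fun i t _ => hasDerivAt_const t _⟩

end UB

lemma UB.ofReal {ι : Type*} {k : ℕ} {F : ι → ℝ → ℝ} (h : UB k F) :
    UB k (fun i t => (F i t : ℂ)) := by
  have hz : ∀ {F : ι → ℝ → ℝ}, UB 0 F → UB 0 (fun i t => (F i t : ℂ)) := by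
    rintro F ⟨hc, C, hC⟩
    exact ⟨fun i => Complex.continuous_ofReal.comp_continuousOn (hc i), C, fun i t ht => by
      simpa using hC i t ht⟩
  induction k generalizing F with
  | zero => exact hz h
  | succ k ih =>
    obtain ⟨h0, F', hF', hd⟩ := h
    exact ⟨hz h0, _, ih hF', fun i t ht => (hd i t ht).ofReal_comp⟩

/-- Inverses of families bounded below. -/
lemma UB.inv {ι : Type*} {k : ℕ} {F : ι → ℝ → ℝ} (h : UB k F) {c : ℝ} (hc : 0 < c)
    (hF : ∀ i, ∀ t ∈ Icc (-π) π, c ≤ |F i t|) : UB k (fun i t => (F i t)⁻¹) := by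
  have hne : ∀ i, ∀ t ∈ Icc (-π) π, F i t ≠ 0 := fun i t ht =>
    abs_pos.mp (hc.trans_le (hF i t ht))
  have hz : UB 0 (fun i t => (F i t)⁻¹) := by
    refine ⟨fun i => (h.zero.1 i).inv₀ (hne i), c⁻¹, fun i t ht => ?_⟩
    rw [norm_inv, Real.norm_eq_abs]
    exact inv_anti₀ hc (hF i t ht)
  induction k with
  | zero => exact hz
  | succ k ih =>
    have hp := ih h.pred
    obtain ⟨h0, F', hF', hd⟩ := h
    refine ⟨hz, fun i t => (-1) * (F' i t * ((F i t)⁻¹ * (F i t)⁻¹)),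
      (UB.const k (C := 1) (by simp)).mul (hF'.mul (hp.mul hp)), fun i t ht => ?_⟩
    refine ((hd i t ht).inv (hne i t ht)).congr_deriv ?_
    have := hne i t ht
    field_simp

/-- Composition of a `C^k` function of two variables with a family of curves. -/
lemma UB.comp {ι : Type*} {k : ℕ} {f : ℝ × ℝ → ℂ} (hf : ContDiff ℝ k f) {x y : ι → ℝ → ℝ}
    (hx : UB k x) (hy : UB k y) : UB k (fun i t => f (x i t, y i t)) := by
  have hz : ∀ {f : ℝ × ℝ → ℂ}, Continuous f → UB 0 x → UB 0 y →
      UB 0 (fun i t => f (x i t, y i t)) := by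
    rintro f hf ⟨hc, C, hC⟩ ⟨hc', C', hC'⟩
    obtain ⟨M, hM⟩ := (isCompact_Icc.prod isCompact_Icc :
      IsCompact (Icc (-C) C ×ˢ Icc (-C') C')).exists_bound_of_continuousOn hf.continuousOn
    exact ⟨fun i => hf.comp_continuousOn ((hc i).prodMk (hc' i)), M, fun i t ht =>
      hM _ ⟨abs_le.mp (hC i t ht), abs_le.mp (hC' i t ht)⟩⟩
  induction k generalizing f with
  | zero => exact hz hf.continuous hx hy
  | succ k ih =>
    have hxp := hx.pred
    have hyp := hy.pred
    have h0 := hz hf.continuous hx.zero hy.zero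
    obtain ⟨-, x', hx', hdx⟩ := hx
    obtain ⟨-, y', hy', hdy⟩ := hy
    refine ⟨h0, _, ((ih (contDiff_pdir hf (1, 0)) hxp hyp).mul hx'.ofReal).add
      ((ih (contDiff_pdir hf (0, 1)) hxp hyp).mul hy'.ofReal), fun i t ht => ?_⟩
    have h1 := ((hf.differentiable (by simp) (x i t, y i t)).hasFDerivAt).comp_hasDerivAt
      (f := fun t => (x i t, y i t)) t ((hdx i t ht).prodMk (hdy i t ht))
    refine h1.congr_deriv ?_
    have : ((x' i t, y' i t) : ℝ × ℝ) = x' i t • ((1 : ℝ), (0 : ℝ)) + y' i t • ((0 : ℝ), (1 : ℝ)) := by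
      ext <;> simp
    rw [this, map_add, map_smul, map_smul]
    simp [pdir]
    ring

/-- The edge function at scale `R`. -/
def scaledEdge (E : ℝ → ℝ) (R t : ℝ) : ℝ := R * E (R⁻¹ * t)

/-- First derivative of `scaledEdge`. -/
def scaledEdge' (E : ℝ → ℝ) (R t : ℝ) : ℝ := R * (deriv E (R⁻¹ * t) * R⁻¹)

/-- Second derivative of `scaledEdge`. -/
def scaledEdge'' (E : ℝ → ℝ) (R t : ℝ) : ℝ := R * (deriv (deriv E) (R⁻¹ * t) * R⁻¹ * R⁻¹)

lemma hasDerivAt_comp_inv_mul {E E' : ℝ → ℝ} (h : ∀ t, HasDerivAt E (E' t) t) (R t : ℝ) :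
    HasDerivAt (fun t => E (R⁻¹ * t)) (E' (R⁻¹ * t) * R⁻¹) t := by
  have h1 : HasDerivAt (fun t => R⁻¹ * t) R⁻¹ t := by
    simpa using (hasDerivAt_id t).const_mul R⁻¹
  exact (h (R⁻¹ * t)).comp t h1

section edge
variable {E : ℝ → ℝ}

lemma hasDerivAt_deriv_of_contDiff_two (hE : ContDiff ℝ 2 E) :
    (∀ t, HasDerivAt E (deriv E t) t) ∧ (∀ t, HasDerivAt (deriv E) (deriv (deriv E) t) t)
      ∧ Continuous (deriv (deriv E)) := by
  have h2 : ContDiff ℝ 1 (deriv E) := by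
    have : ContDiff ℝ (1 + 1) E := by simpa [one_add_one_eq_two] using hE
    exact (contDiff_succ_iff_deriv.mp this).2.2
  exact ⟨fun t => (hE.differentiable (by simp) t).hasDerivAt,
    fun t => (h2.differentiable one_ne_zero t).hasDerivAt, h2.continuous_deriv le_rfl⟩

lemma hasDerivAt_scaledEdge (hE : ContDiff ℝ 2 E) (R t : ℝ) :
    HasDerivAt (scaledEdge E R) (scaledEdge' E R t) t :=
  (hasDerivAt_comp_inv_mul (hasDerivAt_deriv_of_contDiff_two hE).1 R t).const_mul R

lemma hasDerivAt_scaledEdge' (hE : ContDiff ℝ 2 E) (R t : ℝ) :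
    HasDerivAt (scaledEdge' E R) (scaledEdge'' E R t) t :=
  ((hasDerivAt_comp_inv_mul (hasDerivAt_deriv_of_contDiff_two hE).2.1 R t).mul_const
    R⁻¹).const_mul R

lemma continuous_scaledEdge' (hE : ContDiff ℝ 2 E) (R : ℝ) : Continuous (scaledEdge' E R) :=
  continuous_iff_continuousAt.mpr fun t => (hasDerivAt_scaledEdge' hE R t).continuousAt

lemma continuous_scaledEdge (hE : ContDiff ℝ 2 E) (R : ℝ) : Continuous (scaledEdge E R) :=
  continuous_iff_continuousAt.mpr fun t => (hasDerivAt_scaledEdge hE R t).continuousAt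

lemma continuous_scaledEdge'' (hE : ContDiff ℝ 2 E) (R : ℝ) : Continuous (scaledEdge'' E R) := by
  have := (hasDerivAt_deriv_of_contDiff_two hE).2.2
  unfold scaledEdge''
  fun_prop

/-- `K` bounds the scaled edge functions and their derivatives. -/
structure EdgeBound (E : ℝ → ℝ) (K : ℝ) : Prop where
  nonneg : 0 ≤ K
  bound : ∀ R, 1 ≤ R → ∀ t ∈ Icc (-π) π, |scaledEdge E R t| ≤ K
  bound' : ∀ R, 1 ≤ R → ∀ t ∈ Icc (-π) π, |scaledEdge' E R t| ≤ K / R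
  bound'' : ∀ R, 1 ≤ R → ∀ t ∈ Icc (-π) π, |scaledEdge'' E R t| ≤ K / R
  lip : ∀ R, 1 ≤ R → ∀ t ∈ Icc (-π) π, ∀ t' ∈ Icc (-π) π,
    |scaledEdge E R t - scaledEdge E R t'| ≤ K / R * |t - t'|

lemma exists_edgeBound (hE : ContDiff ℝ 2 E) (h0 : E 0 = 0) (h0' : deriv E 0 = 0) :
    ∃ K, EdgeBound E K := by
  obtain ⟨hd, hd', hc⟩ := hasDerivAt_deriv_of_contDiff_two hE
  obtain ⟨M, hM⟩ := (isCompact_Icc (a := -π) (b := π)).exists_bound_of_continuousOn hc.continuousOn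
  have hpi := pi_gt_three
  have h0m : (0 : ℝ) ∈ Icc (-π) π := by constructor <;> linarith
  have hM0 : 0 ≤ M := (norm_nonneg _).trans (hM 0 h0m)
  have hmem : ∀ R : ℝ, 1 ≤ R → ∀ t ∈ Icc (-π) π, R⁻¹ * t ∈ Icc (-π) π := by
    intro R hR t ht
    have h1 : R⁻¹ ≤ 1 := inv_le_one_of_one_le₀ hR
    have h2 : 0 ≤ R⁻¹ := by positivity
    have h3 := abs_le.mpr ht
    refine abs_le.mp ?_
    rw [abs_mul, abs_of_nonneg h2]
    nlinarith [abs_nonneg t]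
  have h1 : ∀ s ∈ Icc (-π) π, |deriv E s| ≤ M * |s| := by
    intro s hs
    have := (convex_Icc (-π) π).norm_image_sub_le_of_norm_hasDerivWithin_le
      (f := deriv E) (fun x _ => (hd' x).hasDerivWithinAt) hM h0m hs
    simpa [h0'] using this
  have hMle : M ≤ M * π ^ 2 := by nlinarith [mul_nonneg hM0 (by nlinarith : (0 : ℝ) ≤ π ^ 2 - 1)]
  have hMle' : M * π ≤ M * π ^ 2 := by nlinarith [mul_nonneg hM0 (by linarith : 0 ≤ π)]
  have hb' : ∀ R, 1 ≤ R → ∀ t ∈ Icc (-π) π, |scaledEdge' E R t| ≤ M * π / R := by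
    intro R hR t ht
    have hR0 : 0 < R := by linarith
    have e : scaledEdge' E R t = deriv E (R⁻¹ * t) := by
      unfold scaledEdge'
      field_simp
    rw [e]
    refine (h1 _ (hmem R hR t ht)).trans ?_
    rw [abs_mul, abs_of_pos (by positivity : 0 < R⁻¹)]
    have : |t| ≤ π := abs_le.mpr ht
    calc M * (R⁻¹ * |t|) ≤ M * (R⁻¹ * π) := by gcongr
      _ = M * π / R := by field_simp
  have hlip : ∀ R, 1 ≤ R → ∀ t ∈ Icc (-π) π, ∀ t' ∈ Icc (-π) π,
      |scaledEdge E R t - scaledEdge E R t'| ≤ M * π / R * |t - t'| := fun R hR t ht t' ht' =>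
    (convex_Icc (-π) π).norm_image_sub_le_of_norm_hasDerivWithin_le
      (fun x _ => (hasDerivAt_scaledEdge hE R x).hasDerivWithinAt) (hb' R hR) ht' ht
  refine ⟨M * π ^ 2, by positivity, fun R hR t ht => ?_, fun R hR t ht => ?_,
    fun R hR t ht => ?_, fun R hR t ht t' ht' => ?_⟩
  · have h2 := hlip R hR t ht 0 h0m
    have h3 : scaledEdge E R 0 = 0 := by simp [scaledEdge, h0]
    rw [h3, sub_zero, sub_zero] at h2
    have h4 : |t| ≤ π := abs_le.mpr ht
    have h5 : M * π / R ≤ M * π := div_le_self (by positivity) hR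
    calc |scaledEdge E R t| ≤ M * π / R * |t| := h2
      _ ≤ M * π * π := by gcongr
      _ = M * π ^ 2 := by ring
  · refine (hb' R hR t ht).trans ?_
    gcongr
  · have hR0 : 0 < R := by linarith
    have e : scaledEdge'' E R t = deriv (deriv E) (R⁻¹ * t) / R := by
      unfold scaledEdge''
      field_simp
    rw [e, abs_div, abs_of_pos hR0]
    have := hM _ (hmem R hR t ht)
    rw [Real.norm_eq_abs] at this
    gcongr
    linarith
  · refine (hlip R hR t ht t' ht').trans ?_
    gcongr

/-- The parameters for which the phase along the edge is not stationary. -/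
def steepRange (K : ℝ) : Set (ℝ × ℝ × ℝ) := {p | p ∈ baseRange ∧ 8 * K + 1 ≤ p.1 * |p.2.2|}

/-- The derivative of the phase along the edge. -/
def phase' (E : ℝ → ℝ) (p : ℝ × ℝ × ℝ) (t : ℝ) : ℝ := p.2.2 + scaledEdge' E p.1 t * p.2.1

lemma hasDerivAt_phase (hE : ContDiff ℝ 2 E) (p : ℝ × ℝ × ℝ) (t : ℝ) :
    HasDerivAt (fun t => lin p.2 (scaledEdge E p.1 t, t)) (phase' E p t) t := by
  unfold lin phase'
  have := ((hasDerivAt_scaledEdge hE p.1 t).mul_const p.2.1).add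
    ((hasDerivAt_id t).mul_const p.2.2)
  exact this.congr_deriv (by ring)

lemma abs_fst_le_four {p : ℝ × ℝ × ℝ} (hp : p ∈ baseRange) : |p.2.1| ≤ 4 ∧ |p.2.2| ≤ 4 := by
  constructor <;> refine abs_le_of_sq_le_sq ?_ (by norm_num) <;> nlinarith [hp.2.2,
    sq_nonneg p.2.1, sq_nonneg p.2.2]

lemma steep_aux {K : ℝ} (hK : 0 ≤ K) {p : ℝ × ℝ × ℝ} (hp : p ∈ steepRange K) :
    K / p.1 * 4 ≤ |p.2.2| / 2 ∧ 0 < |p.2.2| := by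
  have hR : 0 < p.1 := by linarith [hp.1.1]
  have h := hp.2
  constructor
  · rw [div_mul_eq_mul_div, div_le_iff₀ hR]
    linarith
  · by_contra h'
    have : |p.2.2| = 0 := le_antisymm (not_lt.mp h') (abs_nonneg _)
    rw [this, mul_zero] at h
    linarith

lemma phase'_lower {K : ℝ} (hK : EdgeBound E K) {p : ℝ × ℝ × ℝ} (hp : p ∈ steepRange K) {t : ℝ}
    (ht : t ∈ Icc (-π) π) : |p.2.2| / 2 ≤ |phase' E p t| := by
  have h1 := hK.bound' p.1 hp.1.1 t ht
  have h2 := (steep_aux hK.nonneg hp).1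
  have h3 : |scaledEdge' E p.1 t * p.2.1| ≤ K / p.1 * 4 := by
    rw [abs_mul]
    exact mul_le_mul h1 (abs_fst_le_four hp.1).1 (abs_nonneg _) ((abs_nonneg _).trans h1)
  have h4 : |p.2.2| ≤ |phase' E p t| + |scaledEdge' E p.1 t * p.2.1| := by
    have := abs_sub (phase' E p t) (scaledEdge' E p.1 t * p.2.1)
    simpa [phase'] using this
  linarith

lemma phase_expansive {K : ℝ} (hK : EdgeBound E K) {p : ℝ × ℝ × ℝ} (hp : p ∈ steepRange K)
    {t t' : ℝ} (ht : t ∈ Icc (-π) π) (ht' : t' ∈ Icc (-π) π) :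
    |p.2.2| / 2 * |t - t'|
      ≤ |lin p.2 (scaledEdge E p.1 t, t) - lin p.2 (scaledEdge E p.1 t', t')| := by
  have h1 := hK.lip p.1 hp.1.1 t ht t' ht'
  have h2 := (steep_aux hK.nonneg hp).1
  have h3 : |(scaledEdge E p.1 t - scaledEdge E p.1 t') * p.2.1| ≤ |p.2.2| / 2 * |t - t'| := by
    rw [abs_mul]
    calc _ ≤ (K / p.1 * |t - t'|) * 4 :=
          mul_le_mul h1 (abs_fst_le_four hp.1).1 (abs_nonneg _) ((abs_nonneg _).trans h1)
      _ = (K / p.1 * 4) * |t - t'| := by ring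
      _ ≤ _ := mul_le_mul_of_nonneg_right h2 (abs_nonneg _)
  have h4 := abs_sub (lin p.2 (scaledEdge E p.1 t, t) - lin p.2 (scaledEdge E p.1 t', t'))
    ((scaledEdge E p.1 t - scaledEdge E p.1 t') * p.2.1)
  have h5 : lin p.2 (scaledEdge E p.1 t, t) - lin p.2 (scaledEdge E p.1 t', t')
      - (scaledEdge E p.1 t - scaledEdge E p.1 t') * p.2.1 = p.2.2 * (t - t') := by
    simp only [lin]
    ring
  rw [h5, abs_mul] at h4
  linarith

end edge

section edgeB
variable {E : ℝ → ℝ} {K : ℝ}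

/-- Oscillatory integral along the scaled edge. -/
def edgeOsc (E : ℝ → ℝ) (p : ℝ × ℝ × ℝ) (h : ℝ → ℂ) : ℝ → ℂ :=
  osc (volume.restrict (Icc (-π) π)) (fun t => lin p.2 (scaledEdge E p.1 t, t)) h

lemma measurable_edgePhase (hE : ContDiff ℝ 2 E) (p : ℝ × ℝ × ℝ) :
    Measurable (fun t => lin p.2 (scaledEdge E p.1 t, t)) := by
  have := continuous_scaledEdge hE p.1
  unfold lin
  exact Continuous.measurable (by fun_prop)

lemma edgeOsc_continuous (hE : ContDiff ℝ 2 E) (p : ℝ × ℝ × ℝ) {h : ℝ → ℂ}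
    (hh : ContinuousOn h (Icc (-π) π)) : Continuous (edgeOsc E p h) :=
  osc_continuous (measurable_edgePhase hE p) (hh.integrableOn_compact isCompact_Icc)

lemma edgeOsc_congr (p : ℝ × ℝ × ℝ) {h k : ℝ → ℂ} (hk : ∀ t ∈ Icc (-π) π, h t = k t) :
    edgeOsc E p h = edgeOsc E p k := by
  ext l
  refine setIntegral_congr_fun measurableSet_Icc fun t ht => ?_
  simp only [hk t ht]

lemma est_edgeOsc (hE : ContDiff ℝ 2 E) (hK : EdgeBound E K) {h : ℝ × ℝ × ℝ → ℝ → ℂ}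
    (hh : UB 0 (fun (i : steepRange K) t => h i.1 t)) :
    Est (steepRange K) (fun p => edgeOsc E p (h p)) (fun p => |p.2.2|⁻¹) := by
  obtain ⟨hc, C, hC⟩ := hh
  refine ⟨fun p hp => edgeOsc_continuous hE p (hc ⟨p, hp⟩),
    Real.exp 2 * (2 * π) ^ 2 * (2 * |C| ^ 2), by positivity, fun p hp => ?_⟩
  have hs := (steep_aux hK.nonneg hp).2
  refine (energy_osc_interval_le (c := |p.2.2| / 2) (M := |C|) (measurable_edgePhase hE p)
    ((hc ⟨p, hp⟩).aestronglyMeasurable measurableSet_Icc) (by linarith [hp.1.1]) (by linarith)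
    (abs_nonneg _) (fun t ht => (hC ⟨p, hp⟩ t ht).trans (le_abs_self _))
    (fun t ht t' ht' => phase_expansive hK hp ht ht')).trans (le_of_eq ?_)
  field_simp

/-- Integration by parts along the edge. -/
lemma est_edgeOsc_mul_phase' (hE : ContDiff ℝ 2 E) (hK : EdgeBound E K)
    {k : ℝ × ℝ × ℝ → ℝ → ℂ} (hk : UB 1 (fun (i : steepRange K) t => k i.1 t))
    (h0 : ∀ p ∈ steepRange K, k p (-π) = 0) (h1 : ∀ p ∈ steepRange K, k p π = 0) :
    Est (steepRange K) (fun p => edgeOsc E p (fun t => k p t * phase' E p t))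
      (fun p => (p.1 ^ 2)⁻¹ * |p.2.2|⁻¹) := by
  obtain ⟨⟨hkc, -⟩, k', hk', hd⟩ := hk
  have hpc : ∀ p, Continuous (phase' E p) := fun p => by
    have := continuous_scaledEdge' hE p.1
    unfold phase'
    fun_prop
  set k'' : ℝ × ℝ × ℝ → ℝ → ℂ := fun p => if hp : p ∈ steepRange K then k' ⟨p, hp⟩ else 0
  have hk'' : ∀ p (hp : p ∈ steepRange K), k'' p = k' ⟨p, hp⟩ := fun p hp => by simp [k'', hp]
  have hest := est_edgeOsc hE hK (h := k'') (by
    convert hk' using 2 with i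
    rw [hk'' i.1 i.2])
  refine hest.of_mul (fun p hp => by linarith [hp.1.1]) (fun p hp => edgeOsc_continuous hE p ?_)
    fun p hp l => ?_
  · exact (hkc ⟨p, hp⟩).mul (Complex.continuous_ofReal.comp (hpc p)).continuousOn
  · have := osc_interval_ibp (hasDerivAt_phase hE p) (hpc p) (hd ⟨p, hp⟩) (hk'.zero.1 ⟨p, hp⟩)
      (h0 p hp) (h1 p hp) l
    simp only [edgeOsc, hk'' p hp]
    rw [← this]
    simp [Complex.norm_I]

lemma IsBump.eq_zero_of_not_mem_Ioo {φ : ℝ × ℝ → ℂ} (h : IsBump φ) {x t : ℝ}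
    (ht : t ∉ Ioo (-π) π) : φ (x, t) = 0 := by
  have hcl : IsClosed {t : ℝ | φ (x, t) = 0} :=
    isClosed_eq (h.1.continuous.comp (by fun_prop)) continuous_const
  have hout : ∀ t, t ∉ Icc (-π) π → φ (x, t) = 0 := fun t ht => h.eq_zero fun h' => ht h'.2
  have h1 : Ioi π ⊆ {t : ℝ | φ (x, t) = 0} := fun t ht => hout t fun h => (not_le.mpr ht) h.2
  have h2 : Iio (-π) ⊆ {t : ℝ | φ (x, t) = 0} := fun t ht => hout t fun h => (not_le.mpr ht) h.1
  have h1' := hcl.closure_subset_iff.mpr h1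
  have h2' := hcl.closure_subset_iff.mpr h2
  rw [closure_Ioi] at h1'
  rw [closure_Iio] at h2'
  by_cases h3 : t ≤ -π
  · exact h2' h3
  · exact h1' (not_lt.mp fun h4 => ht ⟨not_le.mp h3, h4⟩)

/-- The amplitude along the edge. -/
def edgeAmp (E : ℝ → ℝ) (f φ : ℝ × ℝ → ℂ) (p : ℝ × ℝ × ℝ) (t : ℝ) : ℂ :=
  amp f φ p.1 (scaledEdge E p.1 t, t)

lemma edgeAmp_eq_zero {f φ : ℝ × ℝ → ℂ} (hφ : IsBump φ) (p : ℝ × ℝ × ℝ) {t : ℝ}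
    (ht : t ∉ Ioo (-π) π) : edgeAmp E f φ p t = 0 := by
  simp [edgeAmp, amp, hφ.eq_zero_of_not_mem_Ioo ht]

lemma edgeAmp_deriv_endpoints {f φ : ℝ × ℝ → ℂ} (hφ : IsBump φ) (p : ℝ × ℝ × ℝ) {a : ℂ} :
    (HasDerivAt (edgeAmp E f φ p) a (-π) → a = 0) ∧ (HasDerivAt (edgeAmp E f φ p) a π → a = 0) := by
  constructor
  · intro h
    have h1 : HasDerivWithinAt (edgeAmp E f φ p) 0 (Iic (-π)) (-π) :=
      (hasDerivWithinAt_const (-π) (Iic (-π)) (0 : ℂ)).congr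
        (fun t ht => edgeAmp_eq_zero hφ p fun h => (not_lt.mpr ht) h.1)
        (edgeAmp_eq_zero hφ p fun h => (lt_irrefl _) h.1)
    exact (uniqueDiffWithinAt_Iic (-π)).eq_deriv _ h.hasDerivWithinAt h1
  · intro h
    have h1 : HasDerivWithinAt (edgeAmp E f φ p) 0 (Ici π) π :=
      (hasDerivWithinAt_const π (Ici π) (0 : ℂ)).congr
        (fun t ht => edgeAmp_eq_zero hφ p fun h => (not_lt.mpr ht) h.2)
        (edgeAmp_eq_zero hφ p fun h => (lt_irrefl _) h.2)
    exact (uniqueDiffWithinAt_Ici π).eq_deriv _ h.hasDerivWithinAt h1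

variable {ι : Type*} {P : ι → ℝ × ℝ × ℝ}

lemma ub_scaledEdge'' (hE : ContDiff ℝ 2 E) (hK : EdgeBound E K) (hP : ∀ i, 1 ≤ (P i).1) :
    UB 0 (fun i t => (P i).1 * scaledEdge'' E (P i).1 t) := by
  refine ⟨fun i => (continuous_const.mul (continuous_scaledEdge'' hE _)).continuousOn, K,
    fun i t ht => ?_⟩
  have h := hK.bound'' _ (hP i) t ht
  have hR : 0 < (P i).1 := by linarith [hP i]
  rw [Real.norm_eq_abs, abs_mul, abs_of_pos hR]
  rw [le_div_iff₀ hR] at h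
  linarith

lemma ub_inv (k : ℕ) (hP : ∀ i, 1 ≤ (P i).1) : UB k (fun i (_ : ℝ) => ((P i).1)⁻¹) :=
  UB.const k (C := 1) fun i => by
    rw [norm_inv, Real.norm_eq_abs, abs_of_nonneg (by linarith [hP i])]
    exact inv_le_one_of_one_le₀ (hP i)

lemma ub_scaledEdge' (hE : ContDiff ℝ 2 E) (hK : EdgeBound E K) (hP : ∀ i, 1 ≤ (P i).1) :
    UB 1 (fun i t => scaledEdge' E (P i).1 t) := by
  refine UB.succ_intro (F' := fun i t => scaledEdge'' E (P i).1 t) ?_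
    (fun i t _ => hasDerivAt_scaledEdge' hE _ t) ⟨K, fun i t ht => ?_⟩
  · convert (ub_inv 0 hP).mul (ub_scaledEdge'' hE hK hP) using 3 with i t
    have hR : (P i).1 ≠ 0 := by linarith [hP i]
    field_simp
  · exact (hK.bound' _ (hP i) t ht).trans (div_le_self hK.nonneg (hP i))

lemma ub_scaledEdge (hE : ContDiff ℝ 2 E) (hK : EdgeBound E K) (hP : ∀ i, 1 ≤ (P i).1) :
    UB 2 (fun i t => scaledEdge E (P i).1 t) :=
  UB.succ_intro (ub_scaledEdge' hE hK hP) (fun _ t _ => hasDerivAt_scaledEdge hE _ t)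
    ⟨K, fun i t ht => hK.bound _ (hP i) t ht⟩

lemma ub_id (k : ℕ) : UB k (fun (_ : ι) (t : ℝ) => t) := by
  have h0 : UB 0 (fun (_ : ι) (t : ℝ) => t) :=
    ⟨fun _ => continuousOn_id, π, fun _ t ht => abs_le.mpr ht⟩
  cases k with
  | zero => exact h0
  | succ k => exact ⟨h0, _, UB.const k (c := fun _ => 1) (C := 1) (by simp), fun _ t _ =>
      hasDerivAt_id t⟩

lemma UB.of_le {A : Type*} [NormedRing A] [NormedAlgebra ℝ A] {F : ι → ℝ → A} {k m : ℕ}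
    (h : UB m F) (hkm : k ≤ m) : UB k F := by
  induction m, hkm using Nat.le_induction with
  | base => exact h
  | succ m _ ih => exact ih h.pred

lemma ub_edgeAmp (hE : ContDiff ℝ 2 E) (hK : EdgeBound E K) (hP : ∀ i, 1 ≤ (P i).1) {k : ℕ}
    (hk : k ≤ 2) {f φ : ℝ × ℝ → ℂ} (hf : ContDiff ℝ k f) (hφ : IsBump φ) :
    UB k (fun i t => edgeAmp E f φ (P i) t) := by
  have h1 := (ub_scaledEdge hE hK hP).of_le hk
  have h2 := UB.comp hf ((ub_inv k hP).mul h1) ((ub_inv k hP).mul (ub_id k))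
  have h3 := UB.comp (hφ.1.of_le (by exact_mod_cast le_top)) h1 (ub_id k)
  exact h2.mul h3

end edgeB

section edgeEst
variable {E : ℝ → ℝ} {K : ℝ}

lemma UB.exists_deriv {S : Set (ℝ × ℝ × ℝ)} {k : ℕ} {F : ℝ × ℝ × ℝ → ℝ → ℂ}
    (h : UB (k + 1) (fun (i : S) t => F i.1 t)) :
    ∃ F' : ℝ × ℝ × ℝ → ℝ → ℂ, UB k (fun (i : S) t => F' i.1 t) ∧
      ∀ p ∈ S, ∀ t ∈ Icc (-π) π, HasDerivAt (F p) (F' p t) t := by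
  obtain ⟨-, F', hF', hd⟩ := h
  refine ⟨fun p => if hp : p ∈ S then F' ⟨p, hp⟩ else 0, ?_, fun p hp => ?_⟩
  · simpa using hF'
  · simpa [hp] using hd ⟨p, hp⟩

/-- The factor `r'` of the boundary term. -/
def normalFactor (E : ℝ → ℝ) (p : ℝ × ℝ × ℝ) (t : ℝ) : ℝ := p.2.1 - p.2.2 * scaledEdge' E p.1 t

/-- The normalised inverse `v₂ / p'` of the phase derivative. -/
def invPhase (E : ℝ → ℝ) (p : ℝ × ℝ × ℝ) (t : ℝ) : ℝ :=
  (1 + scaledEdge' E p.1 t * (p.2.1 / p.2.2))⁻¹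

lemma steep_ne {p : ℝ × ℝ × ℝ} (hK : 0 ≤ K) (hp : p ∈ steepRange K) : p.2.2 ≠ 0 :=
  abs_pos.mp (steep_aux hK hp).2

lemma phase'_eq (hK : 0 ≤ K) {p : ℝ × ℝ × ℝ} (hp : p ∈ steepRange K) (t : ℝ) :
    phase' E p t = p.2.2 * (1 + scaledEdge' E p.1 t * (p.2.1 / p.2.2)) := by
  have := steep_ne hK hp
  unfold phase'
  field_simp

lemma invPhase_aux (hK : EdgeBound E K) {p : ℝ × ℝ × ℝ} (hp : p ∈ steepRange K) {t : ℝ}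
    (ht : t ∈ Icc (-π) π) : 1 / 2 ≤ |1 + scaledEdge' E p.1 t * (p.2.1 / p.2.2)| := by
  have h := phase'_lower hK hp ht
  rw [phase'_eq hK.nonneg hp, abs_mul] at h
  have := (steep_aux hK.nonneg hp).2
  by_contra h'
  nlinarith [not_le.mp h']

lemma invPhase_mul (hK : EdgeBound E K) {p : ℝ × ℝ × ℝ} (hp : p ∈ steepRange K) {t : ℝ}
    (ht : t ∈ Icc (-π) π) : invPhase E p t * phase' E p t = p.2.2 := by
  have h0 : 1 + scaledEdge' E p.1 t * (p.2.1 / p.2.2) ≠ 0 := by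
    rw [← abs_pos]
    linarith [invPhase_aux hK hp ht]
  rw [phase'_eq hK.nonneg hp, invPhase, mul_left_comm, inv_mul_cancel₀ h0, mul_one]

lemma ub_normalFactor {S : Set (ℝ × ℝ × ℝ)} (hS : S ⊆ baseRange) (hE : ContDiff ℝ 2 E)
    (hK : EdgeBound E K) : UB 1 (fun (i : S) t => normalFactor E i.1 t) := by
  have h1 : UB 1 (fun (i : S) (_ : ℝ) => i.1.2.1) := UB.const 1 (C := 4)
    fun i => (abs_fst_le_four (hS i.2)).1
  have h2 : UB 1 (fun (i : S) (_ : ℝ) => -i.1.2.2) := UB.const 1 (C := 4)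
    fun i => by simpa using (abs_fst_le_four (hS i.2)).2
  convert h1.add (h2.mul (ub_scaledEdge' (P := fun i : S => i.1) hE hK fun i => (hS i.2).1))
    using 3
  simp only [normalFactor]
  ring

lemma ub_invPhase (hE : ContDiff ℝ 2 E) (hK : EdgeBound E K) :
    UB 1 (fun (i : steepRange K) t => invPhase E i.1 t) := by
  have hP : ∀ i : steepRange K, 1 ≤ i.1.1 := fun i => i.2.1.1
  have h1 : UB 1 (fun (i : steepRange K) t => i.1.1 * scaledEdge' E i.1.1 t) := by
    refine UB.succ_intro (ub_scaledEdge'' (P := fun i : steepRange K => i.1) hE hK hP)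
      (fun i t _ => (hasDerivAt_scaledEdge' hE _ t).const_mul _) ⟨K, fun i t ht => ?_⟩
    have h := hK.bound' _ (hP i) t ht
    have hR : 0 < i.1.1 := by linarith [hP i]
    rw [le_div_iff₀ hR] at h
    rw [Real.norm_eq_abs, abs_mul, abs_of_pos hR]
    linarith
  have h2 : UB 1 (fun (i : steepRange K) (_ : ℝ) => i.1.2.1 / (i.1.1 * i.1.2.2)) := by
    refine UB.const 1 (C := 4) fun i => ?_
    have hR : 0 < i.1.1 := by linarith [hP i]
    have h3 := i.2.2
    have h4 := hK.nonneg
    have h5 : 1 ≤ i.1.1 * |i.1.2.2| := by linarith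
    rw [Real.norm_eq_abs, abs_div, abs_mul, abs_of_pos hR, div_le_iff₀ (by linarith)]
    linarith [(abs_fst_le_four i.2.1).1]
  have h3 : UB 1 (fun (_ : steepRange K) (_ : ℝ) => (1 : ℝ)) := UB.const 1 (C := 1) (by simp)
  have h4 : UB 1 (fun (i : steepRange K) t => 1 + scaledEdge' E i.1.1 t * (i.1.2.1 / i.1.2.2)) := by
    convert h3.add (h1.mul h2) using 4 with i t
    have hR : i.1.1 ≠ 0 := by linarith [hP i]
    field_simp
  exact h4.inv (by norm_num : (0 : ℝ) < 1 / 2) fun i t ht => invPhase_aux hK i.2 ht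

lemma hasDerivAt_normalFactor_mul_invPhase (hE : ContDiff ℝ 2 E) (hK : EdgeBound E K)
    {p : ℝ × ℝ × ℝ} (hp : p ∈ steepRange K) {t : ℝ} (ht : t ∈ Icc (-π) π) :
    HasDerivAt (fun t => normalFactor E p t * invPhase E p t)
      (-((p.2.1 ^ 2 + p.2.2 ^ 2) / (p.1 * p.2.2)) * (p.1 * scaledEdge'' E p.1 t
        * (invPhase E p t * invPhase E p t))) t := by
  have h0 : 1 + scaledEdge' E p.1 t * (p.2.1 / p.2.2) ≠ 0 := by
    rw [← abs_pos]
    linarith [invPhase_aux hK hp ht]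
  have hd := hasDerivAt_scaledEdge' hE p.1 t
  have h1 : HasDerivAt (normalFactor E p) (-(p.2.2 * scaledEdge'' E p.1 t)) t :=
    (hd.const_mul p.2.2).const_sub p.2.1
  have h2 : HasDerivAt (invPhase E p) _ t :=
    ((hd.mul_const (p.2.1 / p.2.2)).const_add 1).inv h0
  refine (h1.mul h2).congr_deriv ?_
  have hR : p.1 ≠ 0 := by linarith [hp.1.1]
  have hv := steep_ne hK.nonneg hp
  have h3 : p.2.2 + scaledEdge' E p.1 t * p.2.1 ≠ 0 := by
    have h4 := phase'_eq (E := E) hK.nonneg hp t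
    unfold phase' at h4
    rw [h4]
    exact mul_ne_zero hv h0
  simp only [invPhase, normalFactor]
  field_simp
  ring

variable {f φ : ℝ × ℝ → ℂ}

lemma edgeB_eq (p : ℝ × ℝ × ℝ) :
    edgeB (scaledEdge E p.1) (scaledEdge' E p.1) p.2 (amp f φ p.1)
      = edgeOsc E p (fun t => edgeAmp E f φ p t * (normalFactor E p t : ℂ)) := rfl

lemma edgeOsc_const_mul (p : ℝ × ℝ × ℝ) (c : ℂ) (h : ℝ → ℂ) :
    edgeOsc E p (fun t => c * h t) = fun l => c * edgeOsc E p h l := by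
  ext l
  exact osc_const_mul c h l

lemma edgeB_eq' (hK : EdgeBound E K) {p : ℝ × ℝ × ℝ} (hp : p ∈ steepRange K) (a : ℝ → ℂ) :
    edgeOsc E p a = fun l => (p.2.2 : ℂ)⁻¹ *
        edgeOsc E p (fun t => a t * (invPhase E p t : ℂ) * phase' E p t) l := by
  rw [← edgeOsc_const_mul]
  refine edgeOsc_congr p fun t ht => ?_
  have h1 := invPhase_mul hK hp ht
  have hv : (p.2.2 : ℂ) ≠ 0 := Complex.ofReal_ne_zero.mpr (steep_ne hK.nonneg hp)
  have h2 : (invPhase E p t : ℂ) * phase' E p t = p.2.2 := by exact_mod_cast h1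
  rw [mul_assoc (a t), h2]
  field_simp

lemma est_edgeB_one (hE : ContDiff ℝ 2 E) (hK : EdgeBound E K) (hf : Continuous f)
    (hφ : IsBump φ) :
    Est (steepRange K) (fun p => edgeB (scaledEdge E p.1) (scaledEdge' E p.1) p.2 (amp f φ p.1))
      (fun p => |p.2.2|⁻¹) := by
  refine est_edgeOsc hE hK (h := fun p t => edgeAmp E f φ p t * (normalFactor E p t : ℂ)) ?_
  exact (ub_edgeAmp (k := 0) (P := fun i : steepRange K => i.1) hE hK (fun i => i.2.1.1)
    (Nat.zero_le _)
    (contDiff_zero.mpr hf) hφ).mul (ub_normalFactor (fun p hp => hp.1) hE hK).zero.ofReal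

lemma norm_inv_sq (x : ℝ) : ‖((x : ℂ))⁻¹‖ ^ 2 = |x|⁻¹ ^ 2 := by
  rw [norm_inv, Complex.norm_real, Real.norm_eq_abs]

lemma est_edgeB_two (hE : ContDiff ℝ 2 E) (hK : EdgeBound E K) (hf : ContDiff ℝ 1 f)
    (hφ : IsBump φ) :
    Est (steepRange K) (fun p => edgeB (scaledEdge E p.1) (scaledEdge' E p.1) p.2 (amp f φ p.1))
      (fun p => (p.1 ^ 2)⁻¹ * |p.2.2|⁻¹ ^ 3) := by
  have hA := ub_edgeAmp (k := 1) (P := fun i : steepRange K => i.1) hE hK (fun i => i.2.1.1)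
    (by norm_num) (by exact_mod_cast hf) hφ
  have hk := (hA.mul (ub_normalFactor (fun p hp => hp.1) hE hK).ofReal).mul
    (ub_invPhase hE hK).ofReal
  have h1 := est_edgeOsc_mul_phase' hE hK (k := fun p t => edgeAmp E f φ p t *
      (normalFactor E p t : ℂ) * (invPhase E p t : ℂ)) hk
    (fun p _ => by rw [edgeAmp_eq_zero hφ p (by simp)]; simp)
    (fun p _ => by rw [edgeAmp_eq_zero hφ p (by simp)]; simp)
  refine (h1.smul (fun p => (p.2.2 : ℂ)⁻¹) zero_le_one fun p hp => ?_).congr fun p hp => ?_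
  · rw [norm_inv_sq, one_mul]
    exact le_of_eq (by ring)
  · rw [edgeB_eq]
    exact (edgeB_eq' hK hp _).symm

lemma est_edgeB_three (hE : ContDiff ℝ 2 E) (hK : EdgeBound E K) (hf : ContDiff ℝ 2 f)
    (hφ : IsBump φ) :
    Est (steepRange K) (fun p => edgeB (scaledEdge E p.1) (scaledEdge' E p.1) p.2 (amp f φ p.1))
      (fun p => (p.1 ^ 2)⁻¹ ^ 2 * |p.2.2|⁻¹ ^ 5) := by
  have hR : ∀ i : steepRange K, 1 ≤ i.1.1 := fun i => i.2.1.1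
  have hA := ub_edgeAmp (k := 2) (P := fun i : steepRange K => i.1) hE hK hR
    (by norm_num) (by exact_mod_cast hf) hφ
  have hr := (ub_normalFactor (S := steepRange K) (fun p hp => hp.1) hE hK).ofReal
  have hκ := (ub_invPhase hE hK).ofReal
  obtain ⟨A', hA', hd⟩ := hA.exists_deriv
  have hA0 : ∀ p ∈ steepRange K, A' p (-π) = 0 := fun p hp =>
    (edgeAmp_deriv_endpoints hφ p).1 (hd p hp (-π) (by simp [pi_pos.le]))
  have hA1 : ∀ p ∈ steepRange K, A' p π = 0 := fun p hp =>
    (edgeAmp_deriv_endpoints hφ p).2 (hd p hp π (by simp [pi_pos.le]))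
  have e1 := (est_edgeOsc_mul_phase' hE hK (k := fun p t => A' p t *
      ((normalFactor E p t : ℂ) * (invPhase E p t : ℂ)) * (invPhase E p t : ℂ))
      ((hA'.mul (hr.mul hκ)).mul hκ)
    (fun p hp => by simp [hA0 p hp]) (fun p hp => by simp [hA1 p hp])).smul
      (fun p => (p.2.2 : ℂ)⁻¹) (w' := fun p => (p.1 ^ 2)⁻¹ * |p.2.2|⁻¹ ^ 3) zero_le_one
      (fun p hp => by rw [norm_inv_sq, one_mul]; exact le_of_eq (by ring))
  have hE'' := (ub_scaledEdge'' (P := fun i : steepRange K => i.1) hE hK hR).ofReal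
  have e2 := (est_edgeOsc hE hK (h := fun p t => edgeAmp E f φ p t *
      (((p.1 * scaledEdge'' E p.1 t : ℝ) : ℂ) * ((invPhase E p t : ℂ) * (invPhase E p t : ℂ))))
      (hA.zero.mul (hE''.mul (hκ.zero.mul hκ.zero)))).smul
      (fun p => ((-((p.2.1 ^ 2 + p.2.2 ^ 2) / (p.1 * p.2.2)) : ℝ) : ℂ))
      (w' := fun p => (p.1 ^ 2)⁻¹ * |p.2.2|⁻¹ ^ 3) (K := 100) (by norm_num)
      (fun p hp => by
        have hp0 : 0 < p.1 := by linarith [hp.1.1]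
        rw [Complex.norm_real, Real.norm_eq_abs, abs_neg, abs_div, abs_mul, abs_of_pos hp0,
          abs_of_nonneg (by positivity : 0 ≤ p.2.1 ^ 2 + p.2.2 ^ 2)]
        have h1 : (p.2.1 ^ 2 + p.2.2 ^ 2) ^ 2 ≤ 100 := by
          nlinarith [hp.1.2.2, hp.1.2.1]
        calc ((p.2.1 ^ 2 + p.2.2 ^ 2) / (p.1 * |p.2.2|)) ^ 2 * |p.2.2|⁻¹
            = (p.2.1 ^ 2 + p.2.2 ^ 2) ^ 2 * ((p.1 ^ 2)⁻¹ * |p.2.2|⁻¹ ^ 3) := by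
              rw [div_eq_mul_inv, mul_inv]
              ring
          _ ≤ _ := by gcongr)
  have e3 := ((e1.add e2).smul (fun p => (p.2.2 : ℂ)⁻¹)
      (w' := fun p => (p.1 ^ 2)⁻¹ * |p.2.2|⁻¹ ^ 5) zero_le_one
      (fun p hp => by rw [norm_inv_sq, one_mul]; exact le_of_eq (by ring)))
  have hB := est_edgeB_two hE hK (hf.of_le (by norm_num)) hφ
  refine (e3.of_mul (F := fun p => edgeB (scaledEdge E p.1) (scaledEdge' E p.1) p.2 (amp f φ p.1))
    (fun p hp => by linarith [hp.1.1]) hB.1 fun p hp l => ?_).mono_weight zero_le_one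
    fun p _ => le_of_eq (by ring)
  have hpc : Continuous (phase' E p) := by
    have := continuous_scaledEdge' hE p.1
    unfold phase'
    fun_prop
  have hder : ∀ t ∈ Icc (-π) π, HasDerivAt (fun t => edgeAmp E f φ p t *
      ((normalFactor E p t * invPhase E p t : ℝ) : ℂ))
      (A' p t * ((normalFactor E p t : ℂ) * (invPhase E p t : ℂ))
        + ((-((p.2.1 ^ 2 + p.2.2 ^ 2) / (p.1 * p.2.2)) : ℝ) : ℂ) * (edgeAmp E f φ p t *
      (((p.1 * scaledEdge'' E p.1 t : ℝ) : ℂ) * ((invPhase E p t : ℂ) * (invPhase E p t : ℂ))))) t := by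
    intro t ht
    refine ((hd p hp t ht).mul
      (hasDerivAt_normalFactor_mul_invPhase hE hK hp ht).ofReal_comp).congr_deriv ?_
    push_cast
    ring
  have c1 : ContinuousOn (fun t => A' p t * ((normalFactor E p t : ℂ) * (invPhase E p t : ℂ)))
      (Icc (-π) π) := (hA'.mul (hr.mul hκ)).zero.1 ⟨p, hp⟩
  have c2 : ContinuousOn (fun t => ((-((p.2.1 ^ 2 + p.2.2 ^ 2) / (p.1 * p.2.2)) : ℝ) : ℂ) *
      (edgeAmp E f φ p t * (((p.1 * scaledEdge'' E p.1 t : ℝ) : ℂ) *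
        ((invPhase E p t : ℂ) * (invPhase E p t : ℂ))))) (Icc (-π) π) :=
    continuousOn_const.mul ((hA.zero.mul (hE''.mul (hκ.zero.mul hκ.zero))).1 ⟨p, hp⟩)
  have hibp := osc_interval_ibp (hasDerivAt_phase hE p) hpc hder (c1.add c2)
    (by rw [edgeAmp_eq_zero hφ p (by simp)]; simp) (by rw [edgeAmp_eq_zero hφ p (by simp)]; simp) l
  rw [osc_add (measurable_edgePhase hE p) (c1.integrableOn_compact isCompact_Icc)
    (c2.integrableOn_compact isCompact_Icc)] at hibp
  change _ = edgeOsc E p _ l + edgeOsc E p _ l at hibp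
  rw [edgeOsc_const_mul, edgeB_eq' hK hp] at hibp
  rw [← hibp, edgeB_eq, edgeB_eq' hK hp]
  simp only [norm_mul, Complex.norm_I, Complex.norm_real, Real.norm_eq_abs, one_mul]
  refine le_of_eq ?_
  rw [mul_left_comm]
  congr 3
  simp only [edgeOsc]
  congr 2
  ext t
  push_cast
  ring

end edgeEst

section core
variable {E : ℝ → ℝ} {K : ℝ} {f φ : ℝ × ℝ → ℂ}

lemma steep_inv (hK : 0 ≤ K) {p : ℝ × ℝ × ℝ} (hp : p ∈ steepRange K) :
    1 ≤ p.1 ∧ 0 < p.1 ∧ 0 < |p.2.2|⁻¹ ∧ 1 ≤ 4 * |p.2.2|⁻¹ := by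
  have h1 := hp.1.1
  have h2 := (steep_aux hK hp).2
  refine ⟨h1, by linarith, by positivity, ?_⟩
  rw [← div_eq_mul_inv, le_div_iff₀ h2, one_mul]
  exact (abs_fst_le_four hp.1).2

lemma steep_weight (hK : 0 ≤ K) {p : ℝ × ℝ × ℝ} (hp : p ∈ steepRange K) {w : ℝ} (hw : 0 ≤ w)
    (n : ℕ) : w ≤ 4 ^ n * (w * |p.2.2|⁻¹ ^ n) := by
  have h := one_le_pow₀ (steep_inv hK hp).2.2.2 (n := n)
  rw [mul_pow] at h
  calc w = w * 1 := by ring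
    _ ≤ w * (4 ^ n * |p.2.2|⁻¹ ^ n) := by gcongr
    _ = _ := by ring

lemma est_steep_one (hE : ContDiff ℝ 2 E) (hK : EdgeBound E K) (hf : ContDiff ℝ 1 f)
    (hφ : IsBump φ) :
    Est (steepRange K) (fun p => edgeT (scaledEdge E p.1) p.2 (amp f φ p.1))
      (fun p => (p.1 ^ 2)⁻¹ * |p.2.2|⁻¹) := by
  have hS : steepRange K ⊆ baseRange := fun p hp => hp.1
  refine est_edgeT_step hS (hasDerivAt_scaledEdge hE) (continuous_scaledEdge' hE) hf hφ
    (fun p _ => by positivity) (fun e => ?_) (fun e => ?_) (est_edgeB_one hE hK hf.continuous hφ)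
  · refine (est_edgeT_one hS (continuous_scaledEdge hE) (contDiff_pdir (n := 0)
      (by simpa using hf) e).continuous hφ).mono_weight (K := 4) (by norm_num) fun p hp => ?_
    obtain ⟨h1, h2, h3, h4⟩ := steep_inv hK.nonneg hp
    have : 1 ≤ p.1 ^ 2 := one_le_pow₀ h1
    nlinarith
  · refine (est_edgeT_one hS (continuous_scaledEdge hE) hf.continuous
      (hφ.pdir e)).mono_weight (K := 4) (by norm_num) fun p hp => (steep_inv hK.nonneg hp).2.2.2

lemma est_steep_two (hE : ContDiff ℝ 2 E) (hK : EdgeBound E K) (hf : ContDiff ℝ 1 f)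
    (hφ : IsBump φ) :
    Est (steepRange K) (fun p => edgeT (scaledEdge E p.1) p.2 (amp f φ p.1))
      (fun p => (p.1 ^ 2)⁻¹ * ((p.1 ^ 2)⁻¹ * |p.2.2|⁻¹ ^ 3)) := by
  have hS : steepRange K ⊆ baseRange := fun p hp => hp.1
  refine est_edgeT_step hS (hasDerivAt_scaledEdge hE) (continuous_scaledEdge' hE) hf hφ
    (fun p _ => by positivity) (fun e => ?_) (fun e => ?_) (est_edgeB_two hE hK hf hφ)
  · refine (est_edgeT_one hS (continuous_scaledEdge hE) (contDiff_pdir (n := 0)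
      (by simpa using hf) e).continuous hφ).mono_weight (K := 4 ^ 3) (by norm_num) fun p hp => ?_
    have h := steep_weight hK.nonneg hp zero_le_one 3
    have h2 := (steep_inv hK.nonneg hp).2.1.ne'
    rwa [mul_inv_cancel_left₀ (pow_ne_zero 2 h2), ← one_mul (|p.2.2|⁻¹ ^ 3)]
  · refine (est_steep_one hE hK hf (hφ.pdir e)).mono_weight (K := 4 ^ 2) (by norm_num)
      fun p hp => (steep_weight hK.nonneg hp (by positivity) 2).trans_eq (by ring)

lemma est_steep_three (hE : ContDiff ℝ 2 E) (hK : EdgeBound E K) (hf : ContDiff ℝ 2 f)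
    (hφ : IsBump φ) :
    Est (steepRange K) (fun p => edgeT (scaledEdge E p.1) p.2 (amp f φ p.1))
      (fun p => (p.1 ^ 2)⁻¹ * ((p.1 ^ 2)⁻¹ ^ 2 * |p.2.2|⁻¹ ^ 5)) := by
  have hS : steepRange K ⊆ baseRange := fun p hp => hp.1
  have hf1 : ContDiff ℝ 1 f := hf.of_le (by norm_num)
  refine est_edgeT_step hS (hasDerivAt_scaledEdge hE) (continuous_scaledEdge' hE) hf1 hφ
    (fun p _ => by positivity) (fun e => ?_) (fun e => ?_) (est_edgeB_three hE hK hf hφ)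
  · refine (est_steep_one hE hK (contDiff_pdir (n := 1) (by exact_mod_cast hf) e)
      hφ).mono_weight (K := 4 ^ 4) (by norm_num) fun p hp => ?_
    refine (steep_weight hK.nonneg hp (by positivity) 4).trans_eq ?_
    have h2 := (steep_inv hK.nonneg hp).2.1.ne'
    field_simp
  · refine (est_steep_two hE hK hf1 (hφ.pdir e)).mono_weight (K := 4 ^ 2) (by norm_num)
      fun p hp => (steep_weight hK.nonneg hp (by positivity) 2).trans_eq (by ring)

lemma est_edgeB_bounded (hE : ContDiff ℝ 2 E) (hK : EdgeBound E K) (hf : Continuous f)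
    (hφ : IsBump φ) :
    Est baseRange (fun p => edgeB (scaledEdge E p.1) (scaledEdge' E p.1) p.2 (amp f φ p.1))
      (fun p => p.1) := by
  have hac : ∀ R, Continuous (amp f φ R) := fun R =>
    (amp_contDiff (n := 0) (contDiff_zero.mpr hf) hφ R).continuous
  have hc : ∀ p : ℝ × ℝ × ℝ,
      Continuous (edgeB (scaledEdge E p.1) (scaledEdge' E p.1) p.2 (amp f φ p.1)) := fun p =>
    edgeB_continuous (continuous_scaledEdge hE _) (continuous_scaledEdge' hE _) _ (hac _)
  obtain ⟨-, C, hC⟩ := (ub_edgeAmp (k := 0) (P := fun i : baseRange => i.1) hE hK (fun i => i.2.1)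
    (Nat.zero_le _) (contDiff_zero.mpr hf) hφ).mul
      (ub_normalFactor (S := baseRange) subset_rfl hE hK).zero.ofReal
  refine ⟨fun p _ => hc p, 3 * (C * (volume.restrict (Icc (-π) π)).real univ) ^ 2, by positivity,
    fun p hp => ?_⟩
  refine energy_le_of_bounded (by linarith [hp.1]) (hc p) fun l => norm_osc_le ?_ l
  filter_upwards [ae_restrict_mem measurableSet_Icc] with t ht
  exact hC ⟨p, hp⟩ t ht

lemma est_flat (hE : ContDiff ℝ 2 E) (hK : EdgeBound E K) (hf : ContDiff ℝ 1 f)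
    (hφ : IsBump φ) :
    Est baseRange (fun p => edgeT (scaledEdge E p.1) p.2 (amp f φ p.1))
      (fun p => (p.1 ^ 2)⁻¹ * p.1) := by
  refine est_edgeT_step subset_rfl (hasDerivAt_scaledEdge hE) (continuous_scaledEdge' hE) hf hφ
    (fun p hp => by linarith [hp.1]) (fun e => ?_) (fun e => ?_)
    (est_edgeB_bounded hE hK hf.continuous hφ)
  · refine (est_edgeT_one subset_rfl (continuous_scaledEdge hE) (contDiff_pdir (n := 0)
      (by simpa using hf) e).continuous hφ).mono_weight (K := 1) (by norm_num) fun p hp => ?_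
    have h1 := hp.1
    have : 1 ≤ p.1 ^ 2 := one_le_pow₀ h1
    nlinarith
  · refine (est_edgeT_one subset_rfl (continuous_scaledEdge hE) hf.continuous
      (hφ.pdir e)).mono_weight (K := 1) (by norm_num) fun p hp => by linarith [hp.1]

lemma Est.union {S T : Set (ℝ × ℝ × ℝ)} {F : ℝ × ℝ × ℝ → ℝ → ℂ} {w : ℝ × ℝ × ℝ → ℝ}
    (hS : Est S F w) (hT : Est T F w) (hw : ∀ p ∈ S ∪ T, 0 ≤ w p) : Est (S ∪ T) F w := by
  obtain ⟨c₁, C₁, h₁, b₁⟩ := hS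
  obtain ⟨c₂, C₂, h₂, b₂⟩ := hT
  refine ⟨fun p hp => hp.elim (c₁ p) (c₂ p), C₁ + C₂, by positivity, fun p hp => ?_⟩
  have h0 := hw p hp
  rcases hp with hp | hp
  · nlinarith [b₁ p hp]
  · nlinarith [b₂ p hp]

lemma Est.subset {S T : Set (ℝ × ℝ × ℝ)} {F : ℝ × ℝ × ℝ → ℝ → ℂ} {w : ℝ × ℝ × ℝ → ℝ}
    (hT : Est T F w) (h : S ⊆ T) : Est S F w := by
  obtain ⟨c, C, h₁, b⟩ := hT
  exact ⟨fun p hp => c p (h hp), C, h₁, fun p hp => b p (h hp)⟩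

/-- The energy estimate for an edge of class `C²`. -/
lemma est_edge (hE : ContDiff ℝ 2 E) (h0 : E 0 = 0) (h0' : deriv E 0 = 0) (hf : ContDiff ℝ 2 f)
    (hφ : IsBump φ) :
    Est baseRange (fun p => edgeT (scaledEdge E p.1) p.2 (amp f φ p.1))
      (fun p => p.1⁻¹ * ((1 + p.1 * |p.2.2|) ^ 5)⁻¹) := by
  obtain ⟨K, hK⟩ := exists_edgeBound hE h0 h0'
  have hK0 := hK.nonneg
  have h1 := (est_steep_three hE hK hf hφ).mono_weight
    (w' := fun p => p.1⁻¹ * ((1 + p.1 * |p.2.2|) ^ 5)⁻¹) (K := 32) (by norm_num) fun p hp => by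
      have hR := (steep_inv hK.nonneg hp).2.1
      have hv := (steep_aux hK.nonneg hp).2
      have hs := hp.2
      have h5 : (1 + p.1 * |p.2.2|) ^ 5 ≤ (2 * (p.1 * |p.2.2|)) ^ 5 := by
        gcongr
        linarith
      calc (p.1 ^ 2)⁻¹ * ((p.1 ^ 2)⁻¹ ^ 2 * |p.2.2|⁻¹ ^ 5)
          = 32 * (p.1⁻¹ * ((2 * (p.1 * |p.2.2|)) ^ 5)⁻¹) := by
            field_simp
            norm_num
        _ ≤ _ := by gcongr
  have h2 := ((est_flat hE hK (hf.of_le (by norm_num)) hφ).subset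
    (S := {p | p ∈ baseRange ∧ p.1 * |p.2.2| ≤ 8 * K + 1}) fun p hp => hp.1).mono_weight
    (w' := fun p => p.1⁻¹ * ((1 + p.1 * |p.2.2|) ^ 5)⁻¹) (K := (1 + (8 * K + 1)) ^ 5)
    (by positivity) fun p hp => by
      have hR : 0 < p.1 := by linarith [hp.1.1]
      have hv := abs_nonneg p.2.2
      have hs := hp.2
      have h5 : (1 + p.1 * |p.2.2|) ^ 5 ≤ (1 + (8 * K + 1)) ^ 5 := by gcongr
      have h6 : (p.1 ^ 2)⁻¹ * p.1 = p.1⁻¹ := by field_simp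
      rw [h6, mul_left_comm]
      refine le_mul_of_one_le_right (by positivity) ?_
      rwa [← div_eq_mul_inv, one_le_div (by positivity)]
  refine (h1.union h2 ?_).subset fun p hp => ?_
  · intro p hp
    have : 0 ≤ p.1 := hp.elim (fun h => by linarith [h.1.1]) fun h => by linarith [h.1.1]
    positivity
  · rcases le_total (8 * K + 1) (p.1 * |p.2.2|) with h | h
    · exact Or.inl ⟨hp, h⟩
    · exact Or.inr ⟨hp, h⟩

end core

lemma lin_add_smul (x e y : ℝ × ℝ) (s : ℝ) : lin (x + s • e) y = lin x y + s * lin e y := by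
  simp [lin]
  ring

lemma rotT_add_smul (γ : ℝ) (x e : ℝ × ℝ) (s : ℝ) :
    rotT γ (x + s • e) = rotT γ x + s • rotT γ e := by
  ext <;> simp [rotT] <;> ring

lemma rotT_smul (γ : ℝ) (x : ℝ × ℝ) (s : ℝ) : rotT γ (s • x) = s • rotT γ x := by
  ext <;> simp [rotT] <;> ring

lemma abs_rotT_le (γ : ℝ) (e : ℝ × ℝ) :
    |(rotT γ e).1| ≤ |e.1| + |e.2| ∧ |(rotT γ e).2| ≤ |e.1| + |e.2| := by
  have hc := abs_cos_le_one γ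
  have hs := abs_sin_le_one γ
  have h1 := abs_nonneg e.1
  have h2 := abs_nonneg e.2
  constructor
  · refine (abs_add_le _ _).trans ?_
    rw [abs_mul, abs_mul]
    nlinarith
  · refine (abs_add_le _ _).trans ?_
    rw [abs_mul, abs_mul, abs_neg]
    nlinarith

/-- Differentiation of an oscillatory integral with respect to the phase. -/
lemma hasDerivAt_osc_phase {Y : Type*} [MeasurableSpace Y] {μ : Measure Y} {a b : Y → ℝ}
    {h : Y → ℂ} (ha : Measurable a) (hb : Measurable b) (hh : Integrable h μ)
    (hhb : Integrable (fun y => h y * (b y : ℂ)) μ) (l t : ℝ) :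
    HasDerivAt (fun s => osc μ (fun y => a y + s * b y) h l)
      (-(Complex.I) * l * osc μ (fun y => a y + t * b y) (fun y => h y * (b y : ℂ)) l) t := by
  have hm : ∀ s : ℝ, Measurable (fun y => a y + s * b y) := fun s => ha.add (hb.const_mul s)
  have key := hasDerivAt_integral_of_dominated_loc_of_deriv_le (μ := μ) (𝕜 := ℝ)
    (F := fun s y => h y * Complex.exp (-(Complex.I) * ((l * (a y + s * b y) : ℝ) : ℂ)))
    (F' := fun s y => (-(Complex.I) * l) * (h y * (b y : ℂ) *
      Complex.exp (-(Complex.I) * ((l * (a y + s * b y) : ℝ) : ℂ)))) (x₀ := t) (s := univ)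
    (bound := fun y => |l| * ‖h y * (b y : ℂ)‖) Filter.univ_mem
    (Filter.Eventually.of_forall fun s => (osc_integrand_integrable (hm s) hh l).aestronglyMeasurable)
    (osc_integrand_integrable (hm t) hh l)
    ((osc_integrand_integrable (hm t) hhb l).const_mul _).aestronglyMeasurable
    (Filter.Eventually.of_forall fun y s _ => ?_) (hhb.norm.const_mul _)
    (Filter.Eventually.of_forall fun y s _ => ?_)
  · simpa only [osc, integral_const_mul] using key.2
  · rw [norm_mul, norm_mul _ (Complex.exp _), norm_exp_neg_I_mul]
    simp
  · have h1 : HasDerivAt (fun s : ℝ => ((l * (a y + s * b y) : ℝ) : ℂ)) ((l * b y : ℝ) : ℂ) s := by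
      refine HasDerivAt.ofReal_comp ?_
      simpa using ((((hasDerivAt_id s).mul_const (b y)).const_add (a y)).const_mul l)
    refine (((h1.const_mul (-(Complex.I))).cexp).const_mul (h y)).congr_deriv ?_
    push_cast
    ring

/-- Parameters `(R, m₀, γ)`: scale, slope and rotation angle. -/
def parRange : Set (ℝ × ℝ × ℝ) := {P | 1 ≤ P.1 ∧ |P.2.1| ≤ 1}

/-- The rotated and rescaled Fourier integral of `u φ`. -/
def fourierRot (u : ℝ → ℝ × ℝ → ℂ) (φ : ℝ × ℝ → ℂ) (P : ℝ × ℝ × ℝ) (z : ℝ × ℝ) : ℂ :=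
  osc (volume.restrict sqr) (lin (rotT P.2.2 z)) (fun y => u P.1 y * φ y) P.1⁻¹

/-- The coordinates of `z`, exchanged in the vertical case. -/
def coords (i : Bool) (z : ℝ × ℝ) : ℝ × ℝ := if i then z else z.swap

/-- The window in the frequency domain. -/
def freqWindow (i : Bool) (w₁ w₂ : ℝ → ℝ) (P : ℝ × ℝ × ℝ) (z : ℝ × ℝ) : ℝ :=
  w₁ ((P.1 ^ 2)⁻¹ * (coords i z).1) * w₂ (P.1⁻¹ * ((coords i z).2 - P.2.1 * (coords i z).1))

/-- The linear span (over bounded coefficients) of products of Fourier integrals and windows with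
smoothness `m`. -/
inductive Adm (u : ℝ → ℝ × ℝ → ℂ) (i : Bool) : ℕ → (ℝ × ℝ × ℝ → ℝ × ℝ → ℂ) → Prop
  | base (m : ℕ) (φ : ℝ × ℝ → ℂ) (w₁ w₂ : ℝ → ℝ) (hφ : IsBump φ) (hw₁ : ContDiff ℝ m w₁)
      (hw₂ : ContDiff ℝ m w₂) (hs₁ : tsupport w₁ ⊆ freqWin 1)
      (hs₂ : tsupport w₂ ⊆ Icc (-(2 / 3)) (2 / 3)) :
      Adm u i m (fun P z => fourierRot u φ P z * (freqWindow i w₁ w₂ P z : ℂ))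
  | add (m : ℕ) (H H' : ℝ × ℝ × ℝ → ℝ × ℝ → ℂ) (h : Adm u i m H) (h' : Adm u i m H') :
      Adm u i m (fun P z => H P z + H' P z)
  | smul (m : ℕ) (H : ℝ × ℝ × ℝ → ℝ × ℝ → ℂ) (c : ℝ × ℝ × ℝ → ℂ) (C : ℝ)
      (hc : ∀ P ∈ parRange, ‖c P‖ ≤ C) (h : Adm u i m H) : Adm u i m (fun P z => c P * H P z)

section adm
variable {u : ℝ → ℝ × ℝ → ℂ} {i : Bool} {φ : ℝ × ℝ → ℂ}

lemma integrable_mul_bump (hu : ∀ R, IntegrableOn (u R) sqr) (hφ : Continuous φ) (R : ℝ) :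
    Integrable (fun y => u R y * φ y) (volume.restrict sqr) :=
  (hu R).mul_continuousOn hφ.continuousOn isCompact_sqr

lemma IsBump.coord_mul (hφ : IsBump φ) :
    IsBump (fun y => φ y * (y.1 : ℂ)) ∧ IsBump (fun y => φ y * (y.2 : ℂ)) := by
  have h1 : ContDiff ℝ (⊤ : ℕ∞) (fun y : ℝ × ℝ => (y.1 : ℂ)) :=
    Complex.ofRealCLM.contDiff.comp contDiff_fst
  have h2 : ContDiff ℝ (⊤ : ℕ∞) (fun y : ℝ × ℝ => (y.2 : ℂ)) :=
    Complex.ofRealCLM.contDiff.comp contDiff_snd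
  exact ⟨⟨hφ.1.mul h1, tsupport_mul_subset_left.trans hφ.2⟩,
    ⟨hφ.1.mul h2, tsupport_mul_subset_left.trans hφ.2⟩⟩

lemma hasDerivAt_fourierRot (hu : ∀ R, IntegrableOn (u R) sqr) (hφ : IsBump φ) (P : ℝ × ℝ × ℝ)
    (e x : ℝ × ℝ) (t : ℝ) :
    HasDerivAt (fun s => fourierRot u φ P (x + s • e))
      ((P.1 : ℂ)⁻¹ * (-(Complex.I) * (rotT P.2.2 e).1 *
          fourierRot u (fun y => φ y * (y.1 : ℂ)) P (x + t • e)
        + -(Complex.I) * (rotT P.2.2 e).2 *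
          fourierRot u (fun y => φ y * (y.2 : ℂ)) P (x + t • e))) t := by
  have hi := integrable_mul_bump hu hφ.1.continuous P.1
  have hi1 := integrable_mul_bump hu hφ.coord_mul.1.1.continuous P.1
  have hi2 := integrable_mul_bump hu hφ.coord_mul.2.1.continuous P.1
  have hsplit : (fun y : ℝ × ℝ => u P.1 y * φ y * (lin (rotT P.2.2 e) y : ℂ))
      = fun y => (rotT P.2.2 e).1 * (u P.1 y * (φ y * (y.1 : ℂ)))
        + (rotT P.2.2 e).2 * (u P.1 y * (φ y * (y.2 : ℂ))) := by
    ext y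
    simp only [lin]
    push_cast
    ring
  have key := hasDerivAt_osc_phase (measurable_lin (rotT P.2.2 x)) (measurable_lin (rotT P.2.2 e)) hi
    (by rw [hsplit]; exact (hi1.const_mul _).add (hi2.const_mul _)) P.1⁻¹ t
  have hph : ∀ s : ℝ, (fun y => lin (rotT P.2.2 x) y + s * lin (rotT P.2.2 e) y)
      = lin (rotT P.2.2 (x + s • e)) := by
    intro s
    ext y
    rw [rotT_add_smul, lin_add_smul]
  simp only [hph] at key
  refine key.congr_deriv ?_
  rw [hsplit, osc_add (measurable_lin _) (hi1.const_mul _) (hi2.const_mul _), osc_const_mul,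
    osc_const_mul]
  simp only [fourierRot]
  push_cast
  ring

lemma coords_add_smul (x e : ℝ × ℝ) (s : ℝ) :
    coords i (x + s • e) = coords i x + s • coords i e := by
  cases i <;> simp [coords, Prod.swap]

lemma hasDerivAt_freqWindow {w₁ w₂ : ℝ → ℝ} (hw₁ : ContDiff ℝ 1 w₁) (hw₂ : ContDiff ℝ 1 w₂)
    (P : ℝ × ℝ × ℝ) (e x : ℝ × ℝ) (t : ℝ) :
    HasDerivAt (fun s => freqWindow i w₁ w₂ P (x + s • e))
      (P.1⁻¹ * (P.1⁻¹ * (coords i e).1 * freqWindow i (deriv w₁) w₂ P (x + t • e)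
        + ((coords i e).2 - P.2.1 * (coords i e).1) *
          freqWindow i w₁ (deriv w₂) P (x + t • e))) t := by
  simp only [freqWindow, coords_add_smul]
  set a := coords i x
  set b := coords i e
  have h1 : HasDerivAt (fun s : ℝ => (P.1 ^ 2)⁻¹ * (a + s • b).1) ((P.1 ^ 2)⁻¹ * b.1) t := by
    simpa using (((hasDerivAt_id t).mul_const b.1).const_add a.1).const_mul (P.1 ^ 2)⁻¹
  have h2 : HasDerivAt (fun s : ℝ => P.1⁻¹ * ((a + s • b).2 - P.2.1 * (a + s • b).1))
      (P.1⁻¹ * (b.2 - P.2.1 * b.1)) t := by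
    simpa using ((((hasDerivAt_id t).mul_const b.2).const_add a.2).sub
      ((((hasDerivAt_id t).mul_const b.1).const_add a.1).const_mul P.2.1)).const_mul P.1⁻¹
  have d1 := ((hw₁.differentiable one_ne_zero _).hasDerivAt).comp t h1
  have d2 := ((hw₂.differentiable one_ne_zero _).hasDerivAt).comp t h2
  refine (d1.mul d2).congr_deriv ?_
  simp only [Function.comp_apply]
  ring

lemma tsupport_deriv_subset' {w : ℝ → ℝ} {s : Set ℝ} (h : tsupport w ⊆ s) :
    tsupport (deriv w) ⊆ s := (closure_minimal support_deriv_subset isClosed_closure).trans h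

lemma contDiff_deriv_of_succ {w : ℝ → ℝ} {m : ℕ} (h : ContDiff ℝ (m + 1 : ℕ) w) :
    ContDiff ℝ m (deriv w) := by
  have h' : ContDiff ℝ ((m : WithTop ℕ∞) + 1) w := by exact_mod_cast h
  exact (contDiff_succ_iff_deriv.mp h').2.2

lemma Adm.exists_deriv (hu : ∀ R, IntegrableOn (u R) sqr) (e : ℝ × ℝ) {m : ℕ}
    {H : ℝ × ℝ × ℝ → ℝ × ℝ → ℂ} (h : Adm u i (m + 1) H) :
    ∃ H', Adm u i m H' ∧ ∀ P ∈ parRange, ∀ x : ℝ × ℝ, ∀ t : ℝ,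
      HasDerivAt (fun s => H P (x + s • e)) ((P.1 : ℂ)⁻¹ * H' P (x + t • e)) t := by
  induction h with
  | base φ w₁ w₂ hφ hw₁ hw₂ hs₁ hs₂ =>
    have h1 : ((1 : ℕ) : WithTop ℕ∞) ≤ ((m + 1 : ℕ) : WithTop ℕ∞) := by
      exact_mod_cast Nat.le_add_left 1 m
    have hm : ((m : ℕ) : WithTop ℕ∞) ≤ ((m + 1 : ℕ) : WithTop ℕ∞) := by
      exact_mod_cast Nat.le_add_right m 1
    have a1 := Adm.smul m _ (fun P => -(Complex.I) * (rotT P.2.2 e).1) (|e.1| + |e.2|)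
      (fun P _ => by simpa using (abs_rotT_le P.2.2 e).1)
      (Adm.base (u := u) (i := i) m _ w₁ w₂ hφ.coord_mul.1 (hw₁.of_le hm) (hw₂.of_le hm) hs₁ hs₂)
    have a2 := Adm.smul m _ (fun P => -(Complex.I) * (rotT P.2.2 e).2) (|e.1| + |e.2|)
      (fun P _ => by simpa using (abs_rotT_le P.2.2 e).2)
      (Adm.base (u := u) (i := i) m _ w₁ w₂ hφ.coord_mul.2 (hw₁.of_le hm) (hw₂.of_le hm) hs₁ hs₂)
    have a3 := Adm.smul m _ (fun P => ((P.1⁻¹ * (coords i e).1 : ℝ) : ℂ)) (|(coords i e).1|)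
      (fun P hP => by
        rw [Complex.norm_real, Real.norm_eq_abs, abs_mul,
          abs_of_nonneg (inv_nonneg.mpr (by linarith [hP.1]))]
        exact mul_le_of_le_one_left (abs_nonneg _) (inv_le_one_of_one_le₀ hP.1))
      (Adm.base (u := u) (i := i) m _ (deriv w₁) w₂ hφ (contDiff_deriv_of_succ hw₁) (hw₂.of_le hm)
        (tsupport_deriv_subset' hs₁) hs₂)
    have a4 := Adm.smul m _ (fun P => (((coords i e).2 - P.2.1 * (coords i e).1 : ℝ) : ℂ))
      (|(coords i e).2| + |(coords i e).1|)
      (fun P hP => by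
        rw [Complex.norm_real, Real.norm_eq_abs]
        refine (abs_sub _ _).trans ?_
        rw [abs_mul]
        gcongr
        exact mul_le_of_le_one_left (abs_nonneg _) hP.2)
      (Adm.base (u := u) (i := i) m _ w₁ (deriv w₂) hφ (hw₁.of_le hm) (contDiff_deriv_of_succ hw₂)
        hs₁ (tsupport_deriv_subset' hs₂))
    refine ⟨_, Adm.add m _ _ (Adm.add m _ _ a1 a2) (Adm.add m _ _ a3 a4), fun P hP x t => ?_⟩
    refine ((hasDerivAt_fourierRot hu hφ P e x t).mul (hasDerivAt_freqWindow (i := i)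
      (hw₁.of_le (by exact_mod_cast h1)) (hw₂.of_le (by exact_mod_cast h1))
      P e x t).ofReal_comp).congr_deriv ?_
    push_cast
    ring
  | add H₁ H₂ _ _ ih₁ ih₂ =>
    obtain ⟨H₁', h₁, d₁⟩ := ih₁
    obtain ⟨H₂', h₂, d₂⟩ := ih₂
    refine ⟨_, Adm.add m _ _ h₁ h₂, fun P hP x t => ?_⟩
    refine ((d₁ P hP x t).add (d₂ P hP x t)).congr_deriv ?_
    ring
  | smul H c C hc _ ih =>
    obtain ⟨H', h', d'⟩ := ih
    refine ⟨_, Adm.smul m _ c C hc h', fun P hP x t => ?_⟩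
    refine ((d' P hP x t).const_mul (c P)).congr_deriv ?_
    ring

lemma Adm.of_succ {n m : ℕ} (hnm : m ≤ n) {H : ℝ × ℝ × ℝ → ℝ × ℝ → ℂ} (h : Adm u i n H) :
    Adm u i m H := by
  have hm : ((m : ℕ) : WithTop ℕ∞) ≤ ((n : ℕ) : WithTop ℕ∞) := by exact_mod_cast hnm
  induction h with
  | base φ w₁ w₂ hφ hw₁ hw₂ hs₁ hs₂ =>
    exact Adm.base m φ w₁ w₂ hφ (hw₁.of_le hm) (hw₂.of_le hm) hs₁ hs₂
  | add H₁ H₂ _ _ ih₁ ih₂ => exact Adm.add m _ _ ih₁ ih₂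
  | smul H c C hc _ ih => exact Adm.smul m _ c C hc ih

lemma Adm.exists_Lop (hu : ∀ R, IntegrableOn (u R) sqr) {m : ℕ} {H : ℝ × ℝ × ℝ → ℝ × ℝ → ℂ}
    (h : Adm u i (m + 2) H) :
    ∃ H', Adm u i m H' ∧ ∀ P ∈ parRange, ∀ j : ℕ, P.1 ^ 2 = (2 : ℝ) ^ (j : ℝ) →
      Lop j (H P) = H' P := by
  obtain ⟨H₁, h₁, d₁⟩ := h.exists_deriv (m := m + 1) hu (1, 0)
  obtain ⟨H₁₁, h₁₁, d₁₁⟩ := h₁.exists_deriv (m := m) hu (1, 0)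
  obtain ⟨H₂, h₂, d₂⟩ := h.exists_deriv (m := m + 1) hu (0, 1)
  obtain ⟨H₂₂, h₂₂, d₂₂⟩ := h₂.exists_deriv (m := m) hu (0, 1)
  refine ⟨_, Adm.add m _ _ (h.of_succ (Nat.le_add_right m 2)) (Adm.add m _ _ h₁₁ h₂₂),
    fun P hP j hj => ?_⟩
  have hpd1 : ∀ {F F' : ℝ × ℝ × ℝ → ℝ × ℝ → ℂ}, (∀ P ∈ parRange, ∀ x : ℝ × ℝ, ∀ t : ℝ,
      HasDerivAt (fun s => F P (x + s • ((1 : ℝ), (0 : ℝ))))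
        ((P.1 : ℂ)⁻¹ * F' P (x + t • ((1 : ℝ), (0 : ℝ)))) t) →
      pd1 (F P) = fun z => (P.1 : ℂ)⁻¹ * F' P z := by
    intro F F' hF
    ext z
    simpa [pd1] using (hF P hP (0, z.2) z.1).deriv
  have hpd2 : ∀ {F F' : ℝ × ℝ × ℝ → ℝ × ℝ → ℂ}, (∀ P ∈ parRange, ∀ x : ℝ × ℝ, ∀ t : ℝ,
      HasDerivAt (fun s => F P (x + s • ((0 : ℝ), (1 : ℝ))))
        ((P.1 : ℂ)⁻¹ * F' P (x + t • ((0 : ℝ), (1 : ℝ)))) t) →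
      pd2 (F P) = fun z => (P.1 : ℂ)⁻¹ * F' P z := by
    intro F F' hF
    ext z
    simpa [pd2] using (hF P hP (z.1, 0) z.2).deriv
  have hc1 : ∀ (c : ℂ) (F : ℝ × ℝ → ℂ), pd1 (fun z => c * F z) = fun z => c * pd1 F z := by
    intro c F
    ext z
    exact deriv_const_mul_field c
  have hc2 : ∀ (c : ℂ) (F : ℝ × ℝ → ℂ), pd2 (fun z => c * F z) = fun z => c * pd2 F z := by
    intro c F
    ext z
    exact deriv_const_mul_field c
  have hR : (P.1 : ℂ) ≠ 0 := by
    have : P.1 ≠ 0 := by linarith [hP.1]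
    exact_mod_cast this
  ext z
  have e1 : pd (2, 0) (H P) z = (P.1 : ℂ)⁻¹ * ((P.1 : ℂ)⁻¹ * H₁₁ P z) := by
    change pd1 (pd1 (H P)) z = _
    rw [hpd1 d₁, hc1, hpd1 d₁₁]
  have e2 : pd (0, 2) (H P) z = (P.1 : ℂ)⁻¹ * ((P.1 : ℂ)⁻¹ * H₂₂ P z) := by
    change pd2 (pd2 (H P)) z = _
    rw [hpd2 d₂, hc2, hpd2 d₂₂]
  simp only [Lop]
  rw [e1, e2, ← hj]
  push_cast
  field_simp

lemma Adm.exists_iterate_Lop (hu : ∀ R, IntegrableOn (u R) sqr) (n : ℕ) :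
    ∀ {H : ℝ × ℝ × ℝ → ℝ × ℝ → ℂ}, Adm u i (2 * n) H →
    ∃ H', Adm u i 0 H' ∧ ∀ P ∈ parRange, ∀ j : ℕ, P.1 ^ 2 = (2 : ℝ) ^ (j : ℝ) →
      (Lop j)^[n] (H P) = H' P := by
  induction n with
  | zero => exact fun {H} h => ⟨H, h, fun P _ j _ => rfl⟩
  | succ n ih =>
    intro H h
    obtain ⟨H₁, h₁, e₁⟩ := Adm.exists_Lop (m := 2 * n) hu h
    obtain ⟨H₂, h₂, e₂⟩ := ih h₁
    refine ⟨H₂, h₂, fun P hP j hj => ?_⟩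
    rw [Function.iterate_succ_apply, e₁ P hP j hj, e₂ P hP j hj]

end adm

lemma lintegral_eq_mul_comp_mul_left {a : ℝ} (ha : a ≠ 0) {F : ℝ → ENNReal} (hF : Measurable F) :
    ∫⁻ b, F b = ENNReal.ofReal |a| * ∫⁻ m, F (a * m) := by
  conv_lhs => rw [← Real.smul_map_volume_mul_left ha]
  rw [lintegral_smul_measure, lintegral_map hF (measurable_const_mul a), smul_eq_mul]

lemma coords_measurePreserving (i : Bool) :
    MeasurePreserving (coords i) (volume : Measure (ℝ × ℝ)) volume := by
  cases i
  · exact Measure.measurePreserving_swap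
  · exact MeasurePreserving.id _

lemma measurable_coords (i : Bool) : Measurable (coords i) := (coords_measurePreserving i).measurable

lemma coords_coords (i : Bool) (z : ℝ × ℝ) : coords i (coords i z) = z := by
  cases i <;> simp [coords]

lemma coords_smul (i : Bool) (s : ℝ) (z : ℝ × ℝ) : coords i (s • z) = s • coords i z := by
  cases i <;> simp [coords, Prod.swap]

/-- Integration over rays through the origin. -/
lemma lintegral_rays (i : Bool) {Φ : ℝ × ℝ → ENNReal} (hΦ : Measurable Φ) :
    ∫⁻ z, Φ z = ∫⁻ m, ∫⁻ a, ENNReal.ofReal |a| * Φ (a • coords i (1, m)) := by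
  have h1 : ∀ a m : ℝ, a • coords i (1, m) = coords i (a, a * m) := fun a m => by
    rw [← coords_smul]
    simp
  have hm : Measurable fun z : ℝ × ℝ => Φ (coords i z) := hΦ.comp (measurable_coords i)
  rw [← (coords_measurePreserving i).lintegral_comp hΦ, Measure.volume_eq_prod,
    lintegral_prod _ hm.aemeasurable, lintegral_lintegral_swap
      (f := fun m a => ENNReal.ofReal |a| * Φ (a • coords i (1, m)))]
  · refine lintegral_congr_ae ?_
    have h0 : ∀ᵐ a : ℝ, a ≠ 0 := by simp [ae_iff]
    filter_upwards [h0] with a ha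
    simp only [h1]
    have hma : Measurable fun b : ℝ => Φ (coords i (a, b)) := hm.comp measurable_prodMk_left
    rw [lintegral_eq_mul_comp_mul_left ha hma]
    exact (lintegral_const_mul _ (hma.comp (measurable_const_mul a))).symm
  · simp only [h1, Function.uncurry_def]
    refine Measurable.aemeasurable ?_
    refine Measurable.mul (by fun_prop) (hm.comp ?_)
    fun_prop

lemma ofReal_energy (R : ℝ) {F : ℝ → ℂ} (hF : Continuous F) :
    ENNReal.ofReal (energy R F) = ∫⁻ l in freqWin R, ‖F l‖ₑ ^ 2 := by
  unfold energy
  rw [ofReal_integral_eq_lintegral_ofReal (energy_integrable R hF)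
    (Filter.Eventually.of_forall fun l => by positivity)]
  refine lintegral_congr fun l => ?_
  rw [ENNReal.ofReal_pow (norm_nonneg _), ofReal_norm]

/-- A function supported in a frequency tube is controlled by its energies along rays. -/
lemma lintegral_tube_le (i : Bool) {R m₀ C : ℝ} (hR : 1 ≤ R) {F : ℝ × ℝ → ℂ} (hF : Continuous F)
    (hsupp : ∀ z, F z ≠ 0 → (coords i z).1 ∈ freqWin (R ^ 2) ∧
      |(coords i z).2 - m₀ * (coords i z).1| ≤ 2 / 3 * R)
    (hray : ∀ m, |m - m₀| ≤ 2 / R → energy R (fun l => F ((R * l) • coords i (1, m))) ≤ C) :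
    ∫⁻ z, ‖F z‖ₑ ^ 2 ≤ ENNReal.ofReal (6 * R ^ 2 * C) := by
  have hR0 : 0 < R := by linarith
  have hm2 : Measurable fun z => ‖F z‖ₑ ^ 2 := by fun_prop
  have hcc : ∀ a m : ℝ, coords i (a • coords i (1, m)) = (a, a * m) := fun a m => by
    rw [coords_smul, coords_coords]
    simp
  have hin : ∀ m, ∫⁻ a, ENNReal.ofReal |a| * ‖F (a • coords i (1, m))‖ₑ ^ 2
      ≤ (Icc (m₀ - 2 / R) (m₀ + 2 / R)).indicator (fun _ => ENNReal.ofReal (4 / 3 * R ^ 3 * C)) m := by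
    intro m
    have hz : ∀ a, F (a • coords i (1, m)) ≠ 0 → a ∈ freqWin (R ^ 2) ∧ |m - m₀| ≤ 2 / R := by
      intro a ha
      obtain ⟨h1, h2⟩ := hsupp _ ha
      rw [hcc] at h1 h2
      refine ⟨h1, ?_⟩
      have h3 : |a| * |m - m₀| ≤ 2 / 3 * R := by
        rw [← abs_mul]
        calc |a * (m - m₀)| = |a * m - m₀ * a| := by ring_nf
          _ ≤ _ := h2
      have h4 : R ^ 2 / 3 ≤ |a| := h1.1
      rw [le_div_iff₀ hR0]
      have h5 : R ^ 2 / 3 * |m - m₀| ≤ 2 / 3 * R :=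
        (mul_le_mul_of_nonneg_right h4 (abs_nonneg _)).trans h3
      have h6 : R * (|m - m₀| * R) ≤ R * 2 := by nlinarith
      exact le_of_mul_le_mul_left h6 hR0
    by_cases hm : |m - m₀| ≤ 2 / R
    · have hmem : m ∈ Icc (m₀ - 2 / R) (m₀ + 2 / R) := by
        rw [abs_le] at hm
        constructor <;> linarith
      rw [indicator_of_mem hmem]
      have hline : Continuous fun l : ℝ => F ((R * l) • coords i (1, m)) :=
        hF.comp (by fun_prop)
      calc ∫⁻ a, ENNReal.ofReal |a| * ‖F (a • coords i (1, m))‖ₑ ^ 2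
          ≤ ∫⁻ a, ENNReal.ofReal (4 * R ^ 2 / 3) * ‖F (a • coords i (1, m))‖ₑ ^ 2 := by
            refine lintegral_mono fun a => ?_
            by_cases ha : F (a • coords i (1, m)) = 0
            · simp [ha]
            · have := (hz a ha).1.2
              gcongr
        _ = ENNReal.ofReal (4 * R ^ 2 / 3) * ∫⁻ a, ‖F (a • coords i (1, m))‖ₑ ^ 2 :=
            lintegral_const_mul _ (hm2.comp (by fun_prop))
        _ = ENNReal.ofReal (4 * R ^ 2 / 3) * (ENNReal.ofReal R *
              ∫⁻ l, ‖F ((R * l) • coords i (1, m))‖ₑ ^ 2) := by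
            rw [lintegral_eq_mul_comp_mul_left hR0.ne' (F := fun a =>
              ‖F (a • coords i (1, m))‖ₑ ^ 2) (hm2.comp (by fun_prop)), abs_of_pos hR0]
        _ = ENNReal.ofReal (4 * R ^ 2 / 3) * (ENNReal.ofReal R *
              ∫⁻ l in freqWin R, ‖F ((R * l) • coords i (1, m))‖ₑ ^ 2) := by
            rw [setLIntegral_eq_of_support_subset]
            intro l hl
            have h0 : F ((R * l) • coords i (1, m)) ≠ 0 := by
              intro h0
              simp [h0] at hl
            obtain ⟨h1, h2⟩ := (hz _ h0).1
            rw [abs_mul, abs_of_pos hR0] at h1 h2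
            constructor
            · refine le_of_mul_le_mul_left (a := R) ?_ hR0
              linarith
            · refine le_of_mul_le_mul_left (a := R) ?_ hR0
              linarith
        _ = ENNReal.ofReal (4 / 3 * R ^ 3 * energy R (fun l => F ((R * l) • coords i (1, m)))) := by
            rw [← ofReal_energy R hline, ← ENNReal.ofReal_mul hR0.le,
              ← ENNReal.ofReal_mul (by positivity)]
            congr 1
            ring
        _ ≤ _ := by
            refine ENNReal.ofReal_le_ofReal ?_
            exact mul_le_mul_of_nonneg_left (hray m hm) (by positivity)
    · have h0 : ∀ a, F (a • coords i (1, m)) = 0 := fun a => by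
        by_contra h
        exact hm (hz a h).2
      simp [h0]
  rw [lintegral_rays i hm2]
  refine (lintegral_mono hin).trans ?_
  rw [lintegral_indicator_const measurableSet_Icc, Real.volume_Icc]
  have hC : 0 ≤ C := by
    refine (energy_nonneg R _).trans (hray m₀ ?_)
    rw [sub_self, abs_zero]
    positivity
  rw [← ENNReal.ofReal_mul (by positivity)]
  refine ENNReal.ofReal_le_ofReal ?_
  have h1 : 4 / 3 * R ^ 3 * C * (m₀ + 2 / R - (m₀ - 2 / R)) = 16 / 3 * (R ^ 2 * C) := by
    field_simp
    ring
  rw [h1]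
  have : 0 ≤ R ^ 2 * C := by positivity
  linarith

lemma lin_smul (s : ℝ) (v y : ℝ × ℝ) : lin (s • v) y = s * lin v y := by
  simp [lin]
  ring

lemma enorm_sq_eq (x : ℂ) : ‖x‖ₑ ^ 2 = ENNReal.ofReal (‖x‖ ^ 2) := by
  rw [ENNReal.ofReal_pow (norm_nonneg _), ofReal_norm]

section admBound
variable {u : ℝ → ℝ × ℝ → ℂ} {i : Bool} {φ : ℝ × ℝ → ℂ}

lemma fourierRot_ray {P : ℝ × ℝ × ℝ} (hP : P.1 ≠ 0) (d : ℝ × ℝ) (l : ℝ) :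
    fourierRot u φ P ((P.1 * l) • d)
      = osc (volume.restrict sqr) (lin (rotT P.2.2 d)) (fun y => u P.1 y * φ y) l := by
  unfold fourierRot osc
  congr 1
  ext y
  rw [rotT_smul, lin_smul, mul_assoc P.1, inv_mul_cancel_left₀ hP]

lemma continuous_fourierRot (hu : ∀ R, IntegrableOn (u R) sqr) (hφ : IsBump φ) (P : ℝ × ℝ × ℝ) :
    Continuous (fourierRot u φ P) := by
  have hi := integrable_mul_bump hu hφ.1.continuous P.1
  unfold fourierRot osc
  refine continuous_of_dominated (bound := fun y => ‖u P.1 y * φ y‖)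
    (fun z => (osc_integrand_integrable (measurable_lin _) hi _).aestronglyMeasurable)
    (fun z => ?_) hi.norm ?_
  · filter_upwards with y
    rw [norm_mul, norm_exp_neg_I_mul, mul_one]
  · filter_upwards with y
    unfold lin rotT
    fun_prop

lemma continuous_coords : Continuous (coords i) := by
  cases i
  · exact continuous_swap
  · exact continuous_id

lemma continuous_freqWindow {w₁ w₂ : ℝ → ℝ} (hw₁ : Continuous w₁) (hw₂ : Continuous w₂)
    (P : ℝ × ℝ × ℝ) : Continuous (freqWindow i w₁ w₂ P) := by
  have := continuous_coords (i := i)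
  unfold freqWindow
  fun_prop

lemma freqWindow_support {w₁ w₂ : ℝ → ℝ} (hs₁ : tsupport w₁ ⊆ freqWin 1)
    (hs₂ : tsupport w₂ ⊆ Icc (-(2 / 3)) (2 / 3)) {P : ℝ × ℝ × ℝ} (hP : P ∈ parRange) {z : ℝ × ℝ}
    (hz : freqWindow i w₁ w₂ P z ≠ 0) : (coords i z).1 ∈ freqWin (P.1 ^ 2) ∧
      |(coords i z).2 - P.2.1 * (coords i z).1| ≤ 2 / 3 * P.1 := by
  have hR : 0 < P.1 := by linarith [hP.1]
  have h1 := hs₁ (subset_tsupport _ (left_ne_zero_of_mul hz))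
  have h2 := abs_le.mpr (hs₂ (subset_tsupport _ (right_ne_zero_of_mul hz)))
  simp only [freqWin, Set.mem_ofPred_eq, abs_mul, abs_inv, abs_of_pos hR,
    abs_of_pos (pow_pos hR 2)] at h1 h2 ⊢
  rw [inv_mul_eq_div, div_le_iff₀ hR] at h2
  rw [inv_mul_eq_div, le_div_iff₀ (by positivity), div_le_iff₀ (by positivity)] at h1
  exact ⟨⟨by linarith [h1.1], by linarith [h1.2]⟩, h2⟩

lemma Adm.lintegral_le (hu : ∀ R, IntegrableOn (u R) sqr) {κ : ℝ × ℝ × ℝ → ℝ}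
    (hcore : ∀ φ, IsBump φ → ∃ C, 0 ≤ C ∧ ∀ P ∈ parRange, ∀ m, |m - P.2.1| ≤ 2 / P.1 →
      energy P.1 (osc (volume.restrict sqr) (lin (rotT P.2.2 (coords i (1, m))))
        (fun y => u P.1 y * φ y)) ≤ C * κ P)
    {H : ℝ × ℝ × ℝ → ℝ × ℝ → ℂ} (h : Adm u i 0 H) :
    (∀ P, Continuous (H P)) ∧ ∃ C, 0 ≤ C ∧ ∀ P ∈ parRange,
      ∫⁻ z, ‖H P z‖ₑ ^ 2 ≤ ENNReal.ofReal (C * (P.1 ^ 2 * κ P)) := by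
  induction h with
  | base φ w₁ w₂ hφ hw₁ hw₂ hs₁ hs₂ =>
    have hc : ∀ P, Continuous fun z => fourierRot u φ P z * (freqWindow i w₁ w₂ P z : ℂ) :=
      fun P => (continuous_fourierRot hu hφ P).mul (Complex.continuous_ofReal.comp
        (continuous_freqWindow hw₁.continuous hw₂.continuous P))
    refine ⟨hc, ?_⟩
    obtain ⟨M₁, hM₁⟩ := (HasCompactSupport.of_support_subset_isCompact (isCompact_freqWin 1)
      ((subset_tsupport _).trans hs₁)).exists_bound_of_continuous hw₁.continuous
    obtain ⟨M₂, hM₂⟩ := (HasCompactSupport.of_support_subset_isCompact isCompact_Icc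
      ((subset_tsupport _).trans hs₂)).exists_bound_of_continuous hw₂.continuous
    obtain ⟨C, hC, hb⟩ := hcore φ hφ
    refine ⟨6 * (2 * (M₁ * M₂) ^ 2 * C), by positivity, fun P hP => ?_⟩
    have hR : 0 < P.1 := by linarith [hP.1]
    refine (lintegral_tube_le i hP.1 (m₀ := P.2.1) (C := 2 * (M₁ * M₂) ^ 2 * (C * κ P)) (hc P)
      (fun z hz => ?_) fun m hm => ?_).trans (ENNReal.ofReal_le_ofReal (le_of_eq (by ring)))
    · refine freqWindow_support hs₁ hs₂ hP ?_
      have := right_ne_zero_of_mul hz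
      exact_mod_cast this
    · have hcl : Continuous fun l : ℝ => (P.1 * l) • coords i (1, m) := by fun_prop
      have hosc := osc_continuous (measurable_lin (rotT P.2.2 (coords i (1, m))))
        (integrable_mul_bump hu hφ.1.continuous P.1)
      refine (energy_le_of_le (c := M₁ * M₂) (G₂ := 0) ((hc P).comp hcl) hosc continuous_const
        fun l => ?_).trans ?_
      · simp only [Function.comp_apply, norm_mul, fourierRot_ray hR.ne', Pi.zero_apply, norm_zero,
          add_zero, Complex.norm_real, freqWindow]
        rw [mul_comm]
        gcongr
        · exact (norm_nonneg _).trans (hM₁ 0)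
        · exact hM₁ _
        · exact hM₂ _
      · have h0 : energy P.1 0 = 0 := by simp [energy]
        rw [h0, add_zero]
        exact mul_le_mul_of_nonneg_left (hb P hP m hm) (by positivity)
  | add H₁ H₂ _ _ ih₁ ih₂ =>
    obtain ⟨c₁, C₁, h₁, b₁⟩ := ih₁
    obtain ⟨c₂, C₂, h₂, b₂⟩ := ih₂
    refine ⟨fun P => (c₁ P).add (c₂ P), 2 * (C₁ + C₂), by positivity, fun P hP => ?_⟩
    have hm : Measurable fun z => ‖H₁ P z‖ₑ ^ 2 := by
      have := (c₁ P).measurable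
      fun_prop
    calc ∫⁻ z, ‖H₁ P z + H₂ P z‖ₑ ^ 2
        ≤ ∫⁻ z, ENNReal.ofReal 2 * (‖H₁ P z‖ₑ ^ 2 + ‖H₂ P z‖ₑ ^ 2) := by
          refine lintegral_mono fun z => ?_
          simp only [enorm_sq_eq]
          rw [← ENNReal.ofReal_add (by positivity) (by positivity),
            ← ENNReal.ofReal_mul (by norm_num)]
          refine ENNReal.ofReal_le_ofReal ?_
          have h3 := pow_le_pow_left₀ (norm_nonneg _) (norm_add_le (H₁ P z) (H₂ P z)) 2
          nlinarith [sq_nonneg (‖H₁ P z‖ - ‖H₂ P z‖)]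
      _ = ENNReal.ofReal 2 * ((∫⁻ z, ‖H₁ P z‖ₑ ^ 2) + ∫⁻ z, ‖H₂ P z‖ₑ ^ 2) := by
          rw [lintegral_const_mul' _ _ ENNReal.ofReal_ne_top, lintegral_add_left hm]
      _ ≤ ENNReal.ofReal 2 * (ENNReal.ofReal (C₁ * (P.1 ^ 2 * κ P))
            + ENNReal.ofReal (C₂ * (P.1 ^ 2 * κ P))) := by
          gcongr
          · exact b₁ P hP
          · exact b₂ P hP
      _ = ENNReal.ofReal (2 * (C₁ + C₂) * (P.1 ^ 2 * κ P)) := by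
          rcases le_total 0 (P.1 ^ 2 * κ P) with hk | hk
          · rw [← ENNReal.ofReal_add (by positivity) (by positivity),
              ← ENNReal.ofReal_mul (by norm_num)]
            congr 1
            ring
          · rw [ENNReal.ofReal_of_nonpos (mul_nonpos_of_nonneg_of_nonpos h₁ hk),
              ENNReal.ofReal_of_nonpos (mul_nonpos_of_nonneg_of_nonpos h₂ hk),
              ENNReal.ofReal_of_nonpos (mul_nonpos_of_nonneg_of_nonpos (by positivity) hk)]
            simp
  | smul H c C hc _ ih =>
    obtain ⟨cH, C', h', b'⟩ := ih
    refine ⟨fun P => continuous_const.mul (cH P), C ^ 2 * C', by positivity, fun P hP => ?_⟩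
    calc ∫⁻ z, ‖c P * H P z‖ₑ ^ 2
        ≤ ∫⁻ z, ENNReal.ofReal (C ^ 2) * ‖H P z‖ₑ ^ 2 := by
          refine lintegral_mono fun z => ?_
          simp only [enorm_sq_eq]
          rw [← ENNReal.ofReal_mul (by positivity), norm_mul, mul_pow]
          have := hc P hP
          gcongr
      _ = ENNReal.ofReal (C ^ 2) * ∫⁻ z, ‖H P z‖ₑ ^ 2 :=
          lintegral_const_mul' _ _ ENNReal.ofReal_ne_top
      _ ≤ ENNReal.ofReal (C ^ 2) * ENNReal.ofReal (C' * (P.1 ^ 2 * κ P)) := by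
          gcongr
          exact b' P hP
      _ = _ := by
          rw [← ENNReal.ofReal_mul (by positivity), mul_assoc]

end admBound

section windows
variable {g : ℝ → ℝ}

lemma IsWindow.eq_zero (hg : IsWindow g) {x : ℝ} (hx : 2 / 3 ≤ |x|) : g x = 0 := by
  rw [← Function.notMem_support, hg.supp_eq]
  exact fun h => absurd (abs_lt.mpr h) hx.not_gt

lemma IsWindow.tsupport_subset (hg : IsWindow g) : tsupport g ⊆ Icc (-(2 / 3)) (2 / 3) := by
  refine closure_minimal ?_ isClosed_Icc
  rw [hg.supp_eq]
  exact Ioo_subset_Icc_self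

lemma IsWindow.eq_one (hg : IsWindow g) {x : ℝ} (hx : |x| ≤ 1 / 3) : g x = 1 := by
  have h := hg.partition x
  have h' : HasSum (fun z : ℤ => g (x + (z : ℝ))) (g (x + ((0 : ℤ) : ℝ))) := by
    refine hasSum_single 0 fun z hz => hg.eq_zero ?_
    have h1 : (1 : ℝ) ≤ |(z : ℝ)| := by exact_mod_cast Int.one_le_abs hz
    have h2 := abs_sub_abs_le_abs_sub (z : ℝ) (-x)
    rw [abs_neg, sub_neg_eq_add, add_comm] at h2
    linarith
  simpa using h'.unique h

lemma IsWindow.tsupport_gtilde_subset (hg : IsWindow g) : tsupport (gtilde g) ⊆ freqWin 1 := by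
  refine closure_minimal (fun x hx => ?_) (isCompact_freqWin 1).isClosed
  by_contra h
  refine hx ?_
  simp only [freqWin, Set.mem_ofPred_eq, not_and_or, not_le] at h
  have h2 : |x / 2| = |x| / 2 := by rw [abs_div, abs_two]
  unfold gtilde
  rcases h with h | h
  · have h0 := abs_nonneg x
    rw [hg.eq_one (by linarith), hg.eq_one (by linarith), sub_self]
  · rw [hg.eq_zero (by linarith), hg.eq_zero (by linarith), sub_self]

lemma IsWindowQ.contDiff_gtilde {q : ℕ} (hg : IsWindowQ g q) : ContDiff ℝ q (gtilde g) :=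
  (hg.2.comp (contDiff_id.div_const 2)).sub hg.2

lemma PsiJL_eq_freqWindow (g : ℝ → ℝ) (i : Bool) (j : ℕ) (ℓ : ℤ) (γ : ℝ) (z : ℝ × ℝ) :
    PsiJL g i j ℓ z = freqWindow i (gtilde g) g
      ((2 : ℝ) ^ ((j : ℝ) / 2), ℓ * (2 : ℝ) ^ (-(j : ℝ) / 2), γ) z := by
  have h1 : ((2 : ℝ) ^ ((j : ℝ) / 2))⁻¹ = (2 : ℝ) ^ (-(j : ℝ) / 2) := by
    rw [← Real.rpow_neg zero_le_two, neg_div]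
  have h2 : (((2 : ℝ) ^ ((j : ℝ) / 2)) ^ 2)⁻¹ = (2 : ℝ) ^ (-(j : ℝ)) := by
    rw [← Real.rpow_mul_natCast zero_le_two, ← Real.rpow_neg zero_le_two]
    congr 1
    push_cast
    ring
  have h3 : (2 : ℝ) ^ (-(j : ℝ)) = (2 : ℝ) ^ (-(j : ℝ) / 2) * (2 : ℝ) ^ (-(j : ℝ) / 2) := by
    rw [← Real.rpow_add two_pos, add_halves]
  unfold freqWindow
  rw [h1, h2]
  cases i
  · simp only [PsiJL, PsiV, coords, Bool.false_eq_true, if_false, Prod.fst_swap, Prod.snd_swap]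
    rw [mul_comm (g _), h3]
    congr 2
    ring
  · simp only [PsiJL, PsiH, coords, if_true]
    rw [h3]
    congr 2
    ring

end windows

/-- The prefactor produced by rescaling the Fourier integral. -/
def ftScale (R : ℝ) : ℂ := ((2 * π) ^ 2 : ℂ)⁻¹ * (((R ^ 2)⁻¹ : ℝ) : ℂ)

lemma FT_rotT_eq_fourierRot {φ : ℝ × ℝ → ℂ} (hφ : IsBump φ) {P : ℝ × ℝ × ℝ} (hP : 0 < P.1)
    (V : ℝ → ℝ × ℝ → ℂ) (z : ℝ × ℝ) :
    FT (fun x => V P.1 (P.1 • x) * φ (P.1 • x)) (rotT P.2.2 z)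
      = fourierRot (fun R y => ftScale R * V R y) φ P z := by
  have hs := Measure.integral_comp_smul (volume : Measure (ℝ × ℝ))
    (fun y => V P.1 y * φ y *
      Complex.exp (-(Complex.I) * ((P.1⁻¹ * lin (rotT P.2.2 z) y : ℝ) : ℂ))) P.1
  have hd : Module.finrank ℝ (ℝ × ℝ) = 2 := by simp
  rw [hd, abs_of_pos (by positivity)] at hs
  have hr : fourierRot (fun R y => ftScale R * V R y) φ P z = ftScale P.1 * ∫ y, V P.1 y * φ y *
      Complex.exp (-(Complex.I) * ((P.1⁻¹ * lin (rotT P.2.2 z) y : ℝ) : ℂ)) := by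
    unfold fourierRot
    simp only [mul_assoc]
    rw [osc_const_mul]
    unfold osc
    simp only [mul_assoc]
    congr 1
    refine setIntegral_eq_integral_of_forall_compl_eq_zero fun y hy => ?_
    rw [hφ.eq_zero hy]
    ring
  rw [hr]
  unfold FT ftScale
  rw [mul_assoc, ← Complex.real_smul, ← hs]
  congr 2
  ext x
  congr 4
  simp only [lin, Prod.smul_fst, Prod.smul_snd, smul_eq_mul]
  field_simp

lemma norm_ftScale_sq_le (R : ℝ) : ‖ftScale R‖ ^ 2 ≤ (R ^ 4)⁻¹ := by
  have h1 : (1 : ℝ) ≤ (2 * π) ^ 2 := by nlinarith [pi_gt_three]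
  have h2 : ‖ftScale R‖ ≤ (R ^ 2)⁻¹ := by
    unfold ftScale
    rw [norm_mul, Complex.norm_real, Real.norm_of_nonneg (by positivity), norm_inv, norm_pow,
      norm_mul, Complex.norm_real, Real.norm_of_nonneg pi_pos.le, Complex.norm_ofNat]
    exact mul_le_of_le_one_left (by positivity) (inv_le_one_of_one_le₀ h1)
  calc ‖ftScale R‖ ^ 2 ≤ ((R ^ 2)⁻¹) ^ 2 := pow_le_pow_left₀ (norm_nonneg _) h2 2
    _ = (R ^ 4)⁻¹ := by rw [← inv_pow, ← inv_pow, ← pow_mul]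

/-- `L²` bound for iterates of `Lop` applied to windowed Fourier transforms, from an energy bound
along rays. -/
lemma exists_integral_iterate_Lop_le {V : ℝ → ℝ × ℝ → ℂ} (hV : ∀ R, IntegrableOn (V R) sqr)
    {φ : ℝ × ℝ → ℂ} (hφ : IsBump φ) {g : ℝ → ℝ} {q : ℕ} (hg : IsWindowQ g (2 * q)) (i : Bool)
    {κ : ℝ × ℝ × ℝ → ℝ}
    (hκ : ∀ φ, IsBump φ → ∃ C, 0 ≤ C ∧ ∀ P ∈ parRange, ∀ m, |m - P.2.1| ≤ 2 / P.1 →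
      energy P.1 (osc (volume.restrict sqr) (lin (rotT P.2.2 (coords i (1, m))))
        (fun y => V P.1 y * φ y)) ≤ C * κ P) (hκ0 : ∀ P ∈ parRange, 0 ≤ κ P) :
    ∃ C > 0, ∀ (j : ℕ) (ℓ : ℤ) (γ : ℝ), |(ℓ : ℝ)| ≤ (2 : ℝ) ^ ((j : ℝ) / 2) →
      ∫ ξ : ℝ × ℝ, ‖(Lop j)^[q] (fun z =>
        FT (fun x => V ((2 : ℝ) ^ ((j : ℝ) / 2)) ((2 : ℝ) ^ ((j : ℝ) / 2) • x) *
          φ ((2 : ℝ) ^ ((j : ℝ) / 2) • x)) (rotT γ z) * (PsiJL g i j ℓ z : ℂ)) ξ‖ ^ 2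
      ≤ C * ((((2 : ℝ) ^ ((j : ℝ) / 2)) ^ 2)⁻¹ *
          κ ((2 : ℝ) ^ ((j : ℝ) / 2), ℓ * (2 : ℝ) ^ (-(j : ℝ) / 2), γ)) := by
  have hu : ∀ R, IntegrableOn (fun y => ftScale R * V R y) sqr := fun R => (hV R).const_mul _
  obtain ⟨H', hH', hL⟩ := Adm.exists_iterate_Lop hu q (Adm.base (i := i) (2 * q) φ (gtilde g) g hφ
    (by exact_mod_cast hg.contDiff_gtilde) (by exact_mod_cast hg.2) hg.1.tsupport_gtilde_subset
    hg.1.tsupport_subset)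
  obtain ⟨hc, C, hC, hb⟩ := hH'.lintegral_le hu (κ := fun P => (P.1 ^ 4)⁻¹ * κ P) fun φ hφ => by
    obtain ⟨C, hC, hb⟩ := hκ φ hφ
    refine ⟨C, hC, fun P hP m hm => ?_⟩
    have h1 := hb P hP m hm
    simp only [mul_assoc]
    have h2 : osc (volume.restrict sqr) (lin (rotT P.2.2 (coords i (1, m))))
        (fun y => ftScale P.1 * (V P.1 y * φ y)) = fun l => ftScale P.1 *
          osc (volume.restrict sqr) (lin (rotT P.2.2 (coords i (1, m))))
            (fun y => V P.1 y * φ y) l := funext fun l => osc_const_mul ..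
    rw [h2, energy_const_mul]
    calc _ ≤ (P.1 ^ 4)⁻¹ * (C * κ P) :=
          mul_le_mul (norm_ftScale_sq_le _) h1 (energy_nonneg _ _) (by positivity)
      _ = _ := by ring
  refine ⟨C + 1, by positivity, fun j ℓ γ hℓ => ?_⟩
  set P : ℝ × ℝ × ℝ := ((2 : ℝ) ^ ((j : ℝ) / 2), ℓ * (2 : ℝ) ^ (-(j : ℝ) / 2), γ) with hPdef
  have hR : 0 < P.1 := Real.rpow_pos_of_pos two_pos _
  have hP : P ∈ parRange := by
    refine ⟨Real.one_le_rpow one_le_two (by positivity), ?_⟩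
    change |(ℓ : ℝ) * (2 : ℝ) ^ (-(j : ℝ) / 2)| ≤ 1
    rw [abs_mul, abs_of_pos (Real.rpow_pos_of_pos two_pos _), neg_div,
      Real.rpow_neg zero_le_two, ← div_eq_mul_inv]
    exact div_le_one_of_le₀ hℓ (Real.rpow_pos_of_pos two_pos _).le
  have hP2 : P.1 ^ 2 = (2 : ℝ) ^ (j : ℝ) := by
    change ((2 : ℝ) ^ ((j : ℝ) / 2)) ^ 2 = _
    rw [← Real.rpow_mul_natCast zero_le_two]
    congr 1
    push_cast
    ring
  have hfun : (fun z => FT (fun x => V ((2 : ℝ) ^ ((j : ℝ) / 2)) ((2 : ℝ) ^ ((j : ℝ) / 2) • x) *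
          φ ((2 : ℝ) ^ ((j : ℝ) / 2) • x)) (rotT γ z) * (PsiJL g i j ℓ z : ℂ))
      = fun z => fourierRot (fun R y => ftScale R * V R y) φ P z *
          (freqWindow i (gtilde g) g P z : ℂ) := by
    ext z
    rw [PsiJL_eq_freqWindow g i j ℓ γ, ← FT_rotT_eq_fourierRot hφ hR]
  have hk := hκ0 P hP
  rw [hfun, hL P hP j hP2, integral_eq_lintegral_of_nonneg_ae
    (Filter.Eventually.of_forall fun z => by positivity)
    (by have := (hc P).norm.pow 2; exact this.aestronglyMeasurable)]
  simp only [← enorm_sq_eq]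
  refine ENNReal.toReal_le_of_le_ofReal (by positivity) ((hb P hP).trans
    (ENNReal.ofReal_le_ofReal ?_))
  have h3 : P.1 ^ 2 * ((P.1 ^ 4)⁻¹ * κ P) = (P.1 ^ 2)⁻¹ * κ P := by field_simp
  rw [h3]
  change C * ((P.1 ^ 2)⁻¹ * κ P) ≤ (C + 1) * ((P.1 ^ 2)⁻¹ * κ P)
  have : 0 ≤ (P.1 ^ 2)⁻¹ * κ P := by positivity
  nlinarith

section rays
variable {i : Bool} {P : ℝ × ℝ × ℝ} {m : ℝ}

lemma ray_mem_baseRange (hP : P ∈ parRange) (hm : |m - P.2.1| ≤ 2 / P.1) :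
    (P.1, rotT P.2.2 (coords i (1, m))) ∈ baseRange := by
  have h1 : 2 / P.1 ≤ 2 := div_le_self zero_le_two hP.1
  have h2 := abs_le.mp (hm.trans h1)
  have h3 := abs_le.mp hP.2
  have h4 : (rotT P.2.2 (coords i (1, m))).1 ^ 2 + (rotT P.2.2 (coords i (1, m))).2 ^ 2
      = 1 + m ^ 2 := by
    have h := sin_sq_add_cos_sq P.2.2
    cases i
    · simp only [rotT, coords, Bool.false_eq_true, if_false, Prod.swap_prod_mk]
      linear_combination (1 + m ^ 2) * h
    · simp only [rotT, coords, if_true]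
      linear_combination (1 + m ^ 2) * h
  refine ⟨hP.1, ?_, ?_⟩
  · simp only [h4]
    nlinarith
  · simp only [h4]
    nlinarith [h2.1, h2.2, h3.1, h3.2]

/-- The direction angle of slope `m`. -/
def slopeAngle (i : Bool) (m : ℝ) : ℝ := if i then arctan m else π / 2 - arctan m

lemma mul_abs_sin_le (hP : P ∈ parRange) (hm : |m - P.2.1| ≤ 2 / P.1) :
    P.1 * |sin (slopeAngle i P.2.1 - P.2.2)|
      ≤ P.1 * |(rotT P.2.2 (coords i (1, m))).2| + 2 := by
  have hR : 0 < P.1 := by linarith [hP.1]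
  have hc0 := cos_arctan_pos P.2.1
  have hc1 := cos_le_one (arctan P.2.1)
  have hs : sin (arctan P.2.1) = P.2.1 * cos (arctan P.2.1) := by
    rw [← tan_mul_cos hc0.ne', tan_arctan]
  have key : ∃ t, |t| ≤ 1 ∧ sin (slopeAngle i P.2.1 - P.2.2)
      = cos (arctan P.2.1) * ((rotT P.2.2 (coords i (1, m))).2 + (m - P.2.1) * t) := by
    cases i
    · refine ⟨sin P.2.2, abs_sin_le_one _, ?_⟩
      simp only [slopeAngle, rotT, coords, Bool.false_eq_true, if_false, Prod.swap_prod_mk]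
      rw [sin_sub, sin_pi_div_two_sub, cos_pi_div_two_sub, hs]
      ring
    · refine ⟨-cos P.2.2, by rw [abs_neg]; exact abs_cos_le_one _, ?_⟩
      simp only [slopeAngle, rotT, coords, if_true]
      rw [sin_sub, hs]
      ring
  obtain ⟨t, ht, hsin⟩ := key
  have h1 : |sin (slopeAngle i P.2.1 - P.2.2)|
      ≤ |(rotT P.2.2 (coords i (1, m))).2| + 2 / P.1 := by
    rw [hsin, abs_mul, abs_of_pos hc0]
    refine (mul_le_of_le_one_left (abs_nonneg _) hc1).trans ((abs_add_le _ _).trans ?_)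
    rw [abs_mul]
    gcongr
    exact (mul_le_of_le_one_right (abs_nonneg _) ht).trans hm
  calc _ ≤ P.1 * (|(rotT P.2.2 (coords i (1, m))).2| + 2 / P.1) := by gcongr
    _ = _ := by field_simp

end rays

lemma IsBump.ofReal {φ : ℝ × ℝ → ℝ} (hφ : ContDiff ℝ (⊤ : ℕ∞) φ)
    (hφs : tsupport φ ⊆ Icc (-π) π ×ˢ Icc (-π) π) : IsBump (fun y => (φ y : ℂ)) := by
  refine ⟨Complex.ofRealCLM.contDiff.comp hφ, (closure_mono fun y hy => ?_).trans hφs⟩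
  simpa using hy

lemma exists_energy_interior_le {u : ℕ} {f : ℝ × ℝ → ℂ} (hf : ContDiff ℝ u f) (i : Bool)
    {φ : ℝ × ℝ → ℂ} (hφ : IsBump φ) :
    ∃ C, 0 ≤ C ∧ ∀ P ∈ parRange, ∀ m, |m - P.2.1| ≤ 2 / P.1 →
      energy P.1 (osc (volume.restrict sqr) (lin (rotT P.2.2 (coords i (1, m))))
        (fun y => f (P.1⁻¹ • y) * φ y)) ≤ C * ((P.1 ^ 2)⁻¹) ^ (2 * u) := by
  obtain ⟨-, C, hC, hb⟩ := est_interior (2 * u) u f φ le_rfl hf hφ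
  refine ⟨C, hC, fun P hP m hm => (le_of_eq ?_).trans
    (hb (P.1, rotT P.2.2 (coords i (1, m))) (ray_mem_baseRange hP hm))⟩
  congr 1
  ext l
  refine setIntegral_congr_fun measurableSet_sqr fun y hy => ?_
  have hy1 : (-4 : ℝ) ≤ y.1 := by linarith [hy.1.1, pi_lt_four]
  simp [amp, Set.indicator, hy1]

lemma exists_energy_edge_le {E : ℝ → ℝ} (hE : ContDiff ℝ 2 E) (h0 : E 0 = 0)
    (h0' : deriv E 0 = 0) {f : ℝ × ℝ → ℂ} (hf : ContDiff ℝ 2 f) (i : Bool)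
    {φ : ℝ × ℝ → ℂ} (hφ : IsBump φ) :
    ∃ C, 0 ≤ C ∧ ∀ P ∈ parRange, ∀ m, |m - P.2.1| ≤ 2 / P.1 →
      energy P.1 (osc (volume.restrict sqr) (lin (rotT P.2.2 (coords i (1, m))))
        (fun y => {y : ℝ × ℝ | scaledEdge E P.1 y.2 ≤ y.1}.indicator
          (fun y => f (P.1⁻¹ • y)) y * φ y))
        ≤ C * (P.1⁻¹ * ((1 + P.1 * |sin (slopeAngle i P.2.1 - P.2.2)|) ^ 5)⁻¹) := by
  obtain ⟨-, C, hC, hb⟩ := est_edge hE h0 h0' hf hφ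
  refine ⟨C * 3 ^ 5, by positivity, fun P hP m hm => ?_⟩
  have hR : 0 < P.1 := by linarith [hP.1]
  have h1 := hb _ (ray_mem_baseRange (i := i) hP hm)
  have h2 := mul_abs_sin_le (i := i) hP hm
  simp only [edgeT] at h1
  simp only [← Set.indicator_mul_left]
  refine h1.trans ?_
  set a := P.1 * |(rotT P.2.2 (coords i (1, m))).2| with ha
  set b := P.1 * |sin (slopeAngle i P.2.1 - P.2.2)| with hb'
  have ha0 : 0 ≤ a := by positivity
  have hb0 : 0 ≤ b := by positivity
  have h3 : ((1 + a) ^ 5)⁻¹ ≤ 3 ^ 5 * ((1 + b) ^ 5)⁻¹ := by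
    rw [← div_eq_mul_inv, le_div_iff₀ (by positivity), inv_mul_le_iff₀ (by positivity), ← mul_pow]
    exact pow_le_pow_left₀ (by positivity) (by linarith) 5
  calc C * (P.1⁻¹ * ((1 + a) ^ 5)⁻¹) ≤ C * (P.1⁻¹ * (3 ^ 5 * ((1 + b) ^ 5)⁻¹)) := by gcongr
    _ = _ := by ring

/-- Bounds for the iterated operator `L^q = (I + 2^jΔ)^q`:
(a) `‖L^q[𝓕[f_j]·Ψ_{j,ℓ}^{(i)}]‖²_{L₂} ≤ C₁(u,q) 2^{-j(2u+1)}`; and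
(b) for a standard edge fragment,
`‖L^q[𝓕[ℰ_j(R_γᵀ·)]·Ψ_{j,ℓ}^{(i)}]‖²_{L₂} ≤ C₂(q) 2^{-3j/2} (1 + 2^{j/2}|sin(θ_{j,ℓ}^{(i)} − γ)|)^{-5}`. -/
theorem norm_Lq_bound (u : ℕ) (hu : 1 ≤ u) (f : ℝ × ℝ → ℝ) (hf : ContDiff ℝ u f)
    (φ : ℝ × ℝ → ℝ) (hφ : ContDiff ℝ (⊤ : ℕ∞) φ)
    (hφs : tsupport φ ⊆ Icc (-π) π ×ˢ Icc (-π) π)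
    (g : ℝ → ℝ) (q : ℕ) (hq : 2 ≤ q) (hg : IsWindowQ g (2*q)) (i : Bool)
    (E : ℝ → ℝ) (hE : ContDiff ℝ 2 E) (hE0 : E 0 = 0) (hE0' : deriv E 0 = 0)
    (fe : ℝ × ℝ → ℝ) (hfe : ContDiff ℝ 2 fe) :
    (∃ C₁ > 0, ∀ j : ℕ, Even j → 10 ≤ j → ∀ ℓ : ℤ, |(ℓ : ℝ)| ≤ (2:ℝ)^((j:ℝ)/2) →
      (∫ ξ : ℝ × ℝ,
          ‖(Lop j)^[q] (fun z =>
              FT (fun x =>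
                ((f x * φ ((2:ℝ)^((j:ℝ)/2)*x.1, (2:ℝ)^((j:ℝ)/2)*x.2) : ℝ) : ℂ)) z
              * (PsiJL g i j ℓ z : ℂ)) ξ‖^2)
        ≤ C₁ * (2:ℝ)^(-(j:ℝ)*(2*(u:ℝ)+1))) ∧
    (∃ C₂ > 0, ∀ j : ℕ, Even j → 10 ≤ j → ∀ ℓ : ℤ, |(ℓ : ℝ)| ≤ (2:ℝ)^((j:ℝ)/2) →
      ∀ γ ∈ Ico (0:ℝ) (2*π),
      (∫ ξ : ℝ × ℝ,
          ‖(Lop j)^[q] (fun z =>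
              FT (fun x => (edgeFragment fe φ E j x : ℂ)) (rotT γ z)
              * (PsiJL g i j ℓ z : ℂ)) ξ‖^2)
        ≤ C₂ * (2:ℝ)^(-(3*(j:ℝ))/2)
            * (1 + (2:ℝ)^((j:ℝ)/2) * |Real.sin (thetaJL i j ℓ - γ)|)^(-(5:ℝ))) := by
  have hφc := IsBump.ofReal hφ hφs
  have hpos : ∀ j : ℕ, (0 : ℝ) < (2 : ℝ) ^ ((j : ℝ) / 2) := fun j => Real.rpow_pos_of_pos two_pos _
  have hsq : ∀ j : ℕ, (((2 : ℝ) ^ ((j : ℝ) / 2)) ^ 2)⁻¹ = (2 : ℝ) ^ (-(j : ℝ)) := fun j => by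
    rw [← Real.rpow_mul_natCast zero_le_two, ← Real.rpow_neg zero_le_two]
    congr 1
    push_cast
    ring
  constructor
  · have hfc : ContDiff ℝ u (fun x => (f x : ℂ)) := Complex.ofRealCLM.contDiff.comp hf
    have hcont := hfc.continuous
    obtain ⟨C, hC, hb⟩ := exists_integral_iterate_Lop_le
      (V := fun R y => (f (R⁻¹ • y) : ℂ))
      (fun R => ContinuousOn.integrableOn_compact isCompact_sqr
        (hcont.comp (continuous_const_smul _)).continuousOn) hφc hg i
      (κ := fun P => ((P.1 ^ 2)⁻¹) ^ (2 * u))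
      (fun φ hφ => exists_energy_interior_le hfc i hφ) (fun P _ => by positivity)
    refine ⟨C, hC, fun j _ _ ℓ hℓ => ?_⟩
    have h := hb j ℓ 0 hℓ
    have hrot : ∀ z : ℝ × ℝ, rotT 0 z = z := fun z => by simp [rotT]
    simp only [hrot, inv_smul_smul₀ (hpos j).ne'] at h
    simp only [Complex.ofReal_mul]
    refine h.trans_eq ?_
    rw [hsq, ← Real.rpow_mul_natCast zero_le_two, ← Real.rpow_add two_pos]
    congr 2
    push_cast
    ring
  · have hfc : ContDiff ℝ 2 (fun x => (fe x : ℂ)) := Complex.ofRealCLM.contDiff.comp hfe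
    have hcont := hfc.continuous
    obtain ⟨C, hC, hb⟩ := exists_integral_iterate_Lop_le
      (V := fun R => {y : ℝ × ℝ | scaledEdge E R y.2 ≤ y.1}.indicator
        (fun y => (fe (R⁻¹ • y) : ℂ)))
      (fun R => edge_integrable (continuous_scaledEdge hE R)
        (hcont.comp (continuous_const_smul _))) hφc hg i
      (κ := fun P => P.1⁻¹ * ((1 + P.1 * |sin (slopeAngle i P.2.1 - P.2.2)|) ^ 5)⁻¹)
      (fun φ hφ => exists_energy_edge_le hE hE0 hE0' hfc i hφ)
      (fun P hP => by
        have : 0 < P.1 := by linarith [hP.1]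
        positivity)
    refine ⟨C, hC, fun j _ _ ℓ hℓ γ _ => ?_⟩
    have hR := hpos j
    have hfrag : (fun x => (edgeFragment fe φ E j x : ℂ)) = fun x =>
        {y : ℝ × ℝ | scaledEdge E ((2 : ℝ) ^ ((j : ℝ) / 2)) y.2 ≤ y.1}.indicator
          (fun y => (fe (((2 : ℝ) ^ ((j : ℝ) / 2))⁻¹ • y) : ℂ)) ((2 : ℝ) ^ ((j : ℝ) / 2) • x) *
          (φ ((2 : ℝ) ^ ((j : ℝ) / 2) • x) : ℂ) := by
      ext x
      have hmem : (scaledEdge E ((2 : ℝ) ^ ((j : ℝ) / 2)) (((2 : ℝ) ^ ((j : ℝ) / 2) • x).2)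
          ≤ ((2 : ℝ) ^ ((j : ℝ) / 2) • x).1) ↔ E x.2 ≤ x.1 := by
        simp only [scaledEdge, Prod.smul_fst, Prod.smul_snd, smul_eq_mul,
          inv_mul_cancel_left₀ hR.ne', mul_le_mul_iff_right₀ hR]
      simp only [edgeFragment, Set.indicator, Set.mem_ofPred_eq, hmem, inv_smul_smul₀ hR.ne']
      split_ifs
      · push_cast
        rw [mul_one]
        rfl
      · simp
    have hθ : slopeAngle i (ℓ * (2 : ℝ) ^ (-(j : ℝ) / 2)) = thetaJL i j ℓ := rfl
    have h := hb j ℓ γ hℓ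
    rw [hfrag]
    simp only [hθ] at h
    refine h.trans_eq ?_
    have h5 : ∀ x : ℝ, 0 ≤ x → ((1 + x) ^ 5)⁻¹ = (1 + x) ^ (-(5 : ℝ)) := fun x hx => by
      rw [Real.rpow_neg (by linarith)]
      norm_cast
    rw [hsq, ← Real.rpow_neg zero_le_two, h5 _ (by positivity), ← mul_assoc, ← mul_assoc,
      mul_assoc C, ← Real.rpow_add two_pos]
    congr 3
    ring
end
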